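/- arXiv:math/0102148 — 3 statements merged into one kernel-verified Lean document; each statement's English description precedes it below -/
import Mathlib

section
/- In the exterior Dirichlet setting, there is a constant c independent of R such that for every sufficiently large R, every solution u = u^R, and every x₀ ∈ ∂B_R with ν = x₀/|x₀|, one has |D²u(x₀)(ν,ν)| ≤ c. -/
open Metric Set Filter
open scoped Topology RealInnerProductSpace

noncomputable section

abbrev Euc (n : ℕ) : Type := EuclideanSpace ℝ (Fin n)

/-- The Hessian matrix of `u` at `x`, `(u_{ij})`. -/
noncomputable def Hess {n : ℕ} (u : Euc n → ℝ) (x : Euc n) : Matrix (Fin n) (Fin n) ℝ :=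
  fun i j => iteratedFDeriv ℝ 2 u x ![EuclideanSpace.single i 1, EuclideanSpace.single j 1]

/-- The Gauß curvature operator `K[u] = det D²u / (1+|Du|²)^((n+2)/2)`. -/
noncomputable def gaussK {n : ℕ} (u : Euc n → ℝ) (x : Euc n) : ℝ :=
  (Hess u x).det / (1 + ‖fderiv ℝ u x‖ ^ 2) ^ (((n : ℝ) + 2) / 2)

/-- Partial derivative `w_i` relative to a set `S`. -/
noncomputable def pdW {n : ℕ} (S : Set (Euc n)) (w : Euc n → ℝ) (x : Euc n) (i : Fin n) : ℝ :=
  fderivWithin ℝ w S x (EuclideanSpace.single i 1)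

/-- The Hessian matrix `(w_{ij})` relative to a set `S`. -/
noncomputable def HessW {n : ℕ} (S : Set (Euc n)) (w : Euc n → ℝ) (x : Euc n) :
    Matrix (Fin n) (Fin n) ℝ :=
  fun i j => iteratedFDerivWithin ℝ 2 w S x
    ![EuclideanSpace.single i 1, EuclideanSpace.single j 1]

/-- The exterior Dirichlet setting of Finster–Schnürer. -/
structure ExtSetting (n : ℕ) where
  K : Set (Euc n)
  f : Euc n → ℝ → ℝ
  u₀ : Euc n → ℝ
  ul : Euc n → ℝ
  R₀ : ℝ
  hn : 2 ≤ n
  hR₀ : 0 < R₀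
  hKne : K.Nonempty
  hKc : IsCompact K
  hK0 : 0 ∈ interior K
  hKsm : ∃ g : Euc n → ℝ, ContDiff ℝ (⊤ : ℕ∞) g ∧ K = {x | g x ≤ 0} ∧
    ∀ x ∈ frontier K, fderiv ℝ g x ≠ 0
  hKR₀ : K ⊆ ball 0 R₀
  hfsm : ContDiffOn ℝ (⊤ : ℕ∞) (fun p : Euc n × ℝ => f p.1 p.2) ((interior K)ᶜ ×ˢ univ)
  hfpos : ∀ x ∈ (interior K)ᶜ, ∀ z : ℝ, 0 < f x z
  hfz : ∀ x ∈ (interior K)ᶜ, Monotone (f x)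
  hfdec : ∃ C : ℝ, ∀ x ∈ (interior K)ᶜ, ∀ z : ℝ, f x z * ‖x‖ ^ (n + 1) ≤ C
  hfder : ∃ C : ℝ, ∀ p ∈ (interior K)ᶜ ×ˢ (univ : Set ℝ),
    ‖fderivWithin ℝ (fun q : Euc n × ℝ => f q.1 q.2) ((interior K)ᶜ ×ˢ univ) p‖ +
      ‖iteratedFDerivWithin ℝ 2 (fun q : Euc n × ℝ => f q.1 q.2) ((interior K)ᶜ ×ˢ univ) p‖
        ≤ C * f p.1 p.2
  hulsm : ContDiffOn ℝ (⊤ : ℕ∞) ul (interior K)ᶜ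
  hulconv : ∀ x ∈ Kᶜ, (Hess ul x).PosDef
  hulsub : ∀ x ∈ Kᶜ, f x (ul x) ≤ gaussK ul x
  hulbc : ∀ x ∈ frontier K, ul x = u₀ x
  hulcone : ∃ C : ℝ, ∀ x ∈ (interior K)ᶜ, |ul x - ‖x‖| ≤ C
  huldec1 : ∃ C R₁ : ℝ, ∀ x : Euc n, R₁ ≤ ‖x‖ →
    ‖fderiv ℝ (fun y => ul y - ‖y‖) x‖ ≤ C / ‖x‖
  huldec2 : ∃ C R₁ : ℝ, ∀ x : Euc n, R₁ ≤ ‖x‖ →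
    ‖iteratedFDeriv ℝ 2 (fun y => ul y - ‖y‖) x‖ + ‖iteratedFDeriv ℝ 3 ul x‖ ≤ C / ‖x‖ ^ 2

/-- The domain `B_R ∖ int K` of the compact Dirichlet problem. -/
def solDom {n : ℕ} (S : ExtSetting n) (R : ℝ) : Set (Euc n) :=
  closedBall 0 R \ interior S.K

/-- `u` is a smooth strictly convex solution `u^R` of the compact Dirichlet problem
`K[u^R] = f(x,u^R)` in `B_R ∖ K`, `u^R = u̲` on `∂B_R ∪ ∂K`. -/
def IsSol {n : ℕ} (S : ExtSetting n) (R : ℝ) (u : Euc n → ℝ) : Prop :=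
  ContDiffOn ℝ (⊤ : ℕ∞) u (solDom S R) ∧
  (∀ x ∈ ball 0 R \ S.K, (Hess u x).PosDef) ∧
  (∀ x ∈ ball 0 R \ S.K, gaussK u x = S.f x (u x)) ∧
  (∀ x ∈ sphere (0 : Euc n) R ∪ frontier S.K, u x = S.ul x)

/-! ### Positive definite matrices -/

lemma Matrix.PosDef.exists_inv_eq_transpose_mul_self {m : ℕ} {A : Matrix (Fin m) (Fin m) ℝ}
    (hA : A.PosDef) : ∃ L : Matrix (Fin m) (Fin m) ℝ, A⁻¹ = L.transpose * L := by
  open scoped MatrixOrder in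
  obtain ⟨X, hX, -, h⟩ := CFC.exists_sqrt_of_isSelfAdjoint_of_quasispectrumRestricts
    hA.inv.isHermitian (QuasispectrumRestricts.nnreal_of_nonneg hA.inv.posSemidef.nonneg)
  refine ⟨X, ?_⟩
  have h2 : X.transpose = X := by
    have := hX.star_eq
    rwa [Matrix.star_eq_conjTranspose, Matrix.conjTranspose_eq_transpose_of_trivial] at this
  rw [h2]
  exact h.symm

/-- Concavity of `log det`, in the form of its tangent plane inequality. -/
lemma Matrix.PosDef.log_det_le_trace {m : ℕ} {A B : Matrix (Fin m) (Fin m) ℝ}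
    (hA : A.PosDef) (hB : B.PosDef) :
    Real.log B.det - Real.log A.det ≤ (A⁻¹ * B).trace - m := by
  obtain ⟨L, hL⟩ := hA.exists_inv_eq_transpose_mul_self
  have hdet : A⁻¹.det = L.det * L.det := by rw [hL, Matrix.det_mul, Matrix.det_transpose]
  have hL0 : L.det ≠ 0 := by
    have := hA.inv.det_pos
    rw [hdet] at this
    exact fun h => by simp [h] at this
  have hLu : IsUnit L := (Matrix.isUnit_iff_isUnit_det L).2 (isUnit_iff_ne_zero.2 hL0)
  have hP : (L * B * L.transpose).PosDef := by
    have := hB.mul_mul_conjTranspose_same (B := L) (Matrix.vecMul_injective_of_isUnit hLu)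
    rwa [Matrix.conjTranspose_eq_transpose_of_trivial] at this
  have htr : (A⁻¹ * B).trace = (L * B * L.transpose).trace := by
    rw [hL, Matrix.mul_assoc, Matrix.trace_mul_comm, Matrix.mul_assoc]
  have hPdet : Real.log (L * B * L.transpose).det = Real.log B.det - Real.log A.det := by
    have hAi : A⁻¹.det = A.det⁻¹ := by
      rw [Matrix.det_nonsing_inv, Ring.inverse_eq_inv']
    have : (L * B * L.transpose).det = B.det * A.det⁻¹ := by
      rw [Matrix.det_mul, Matrix.det_mul, Matrix.det_transpose, ← hAi, hdet]; ring
    rw [this, Real.log_mul hB.det_pos.ne' (inv_ne_zero hA.det_pos.ne'), Real.log_inv]; ring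
  rw [htr, ← hPdet, hP.isHermitian.trace_eq_sum_eigenvalues,
    hP.isHermitian.det_eq_prod_eigenvalues]
  simp only [RCLike.ofReal_real_eq_id, id]
  rw [Real.log_prod (fun i _ => (hP.eigenvalues_pos i).ne')]
  have : ∑ i, Real.log (hP.isHermitian.eigenvalues i)
      ≤ ∑ i, (hP.isHermitian.eigenvalues i - 1) :=
    Finset.sum_le_sum fun i _ => Real.log_le_sub_one_of_pos (hP.eigenvalues_pos i)
  simpa [Finset.sum_sub_distrib] using this

lemma Matrix.PosDef.trace_inv_mul_mono {m : ℕ} {A B C : Matrix (Fin m) (Fin m) ℝ}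
    (hA : A.PosDef) (hBC : (C - B).PosSemidef) : (A⁻¹ * B).trace ≤ (A⁻¹ * C).trace := by
  obtain ⟨L, hL⟩ := hA.exists_inv_eq_transpose_mul_self
  have h := (hBC.mul_mul_conjTranspose_same L).trace_nonneg
  rw [Matrix.conjTranspose_eq_transpose_of_trivial] at h
  have htr : (A⁻¹ * (C - B)).trace = (L * (C - B) * L.transpose).trace := by
    rw [hL, Matrix.mul_assoc, Matrix.trace_mul_comm, Matrix.mul_assoc]
  rw [← htr, Matrix.mul_sub, Matrix.trace_sub] at h
  linarith

lemma Matrix.posSemidef_sub_of_forall_le {m : ℕ} {B C : Matrix (Fin m) (Fin m) ℝ}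
    (hB : B.IsHermitian) (hC : C.IsHermitian)
    (h : ∀ x, x ⬝ᵥ (B.mulVec x) ≤ x ⬝ᵥ (C.mulVec x)) : (C - B).PosSemidef := by
  refine .of_dotProduct_mulVec_nonneg (hC.sub hB) fun x => ?_
  simp only [star_trivial, Matrix.sub_mulVec, dotProduct_sub]
  linarith [h x]

lemma Matrix.PosDef.inv_mul_self {m : ℕ} {A : Matrix (Fin m) (Fin m) ℝ} (hA : A.PosDef) :
    A⁻¹ * A = 1 :=
  Matrix.nonsing_inv_mul _ ((Matrix.isUnit_iff_isUnit_det A).1 hA.isUnit)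

/-- Concavity of `log det` along `B + η S ≤ (1 + η) A`. -/
lemma Matrix.PosDef.log_det_concave {m : ℕ} {A B S : Matrix (Fin m) (Fin m) ℝ} {η : ℝ}
    (hη : 0 ≤ η) (hA : A.PosDef) (hB : B.PosDef) (hS : S.PosDef)
    (h : ∀ x, x ⬝ᵥ (B.mulVec x) ≤ (1 + η) * (x ⬝ᵥ (A.mulVec x)) - η * (x ⬝ᵥ (S.mulVec x))) :
    Real.log B.det - Real.log A.det ≤ η * (Real.log A.det - Real.log S.det) := by
  have h1 := hA.log_det_le_trace hB
  have h2 := hA.log_det_le_trace hS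
  have hC : ((1 + η) • A - η • S).IsHermitian := by
    have := hA.isHermitian
    have := hS.isHermitian
    simp only [Matrix.IsHermitian, Matrix.conjTranspose_eq_transpose_of_trivial] at *
    simp_all
  have h3 := hA.trace_inv_mul_mono (Matrix.posSemidef_sub_of_forall_le hB.isHermitian hC
    (fun x => by
      simpa [Matrix.sub_mulVec, dotProduct_sub, Matrix.smul_mulVec] using h x))
  have h4 : (A⁻¹ * ((1 + η) • A - η • S)).trace = (1 + η) * m - η * (A⁻¹ * S).trace := by
    rw [Matrix.mul_sub, Matrix.trace_sub, Matrix.mul_smul, Matrix.mul_smul, hA.inv_mul_self]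
    simp
  have h5 := mul_le_mul_of_nonneg_left h2 hη
  nlinarith

lemma Matrix.PosDef.det_mono {m : ℕ} {A B : Matrix (Fin m) (Fin m) ℝ}
    (hA : A.PosDef) (hB : B.PosDef) (h : ∀ x, x ⬝ᵥ (B.mulVec x) ≤ x ⬝ᵥ (A.mulVec x)) :
    B.det ≤ A.det := by
  have := Matrix.PosDef.log_det_concave le_rfl hA hB hB (by simpa using h)
  rw [zero_mul, sub_nonpos] at this
  exact (Real.log_le_log_iff hB.det_pos hA.det_pos).1 this

/-- If `A - δ e eᵀ` dominates `B`, then `log det` drops by a definite amount. -/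
lemma Matrix.PosDef.log_det_le_sub_of_rank_one {m : ℕ} {A B : Matrix (Fin m) (Fin m) ℝ}
    {e : Fin m → ℝ} {δ Λ : ℝ} (hδ : 0 ≤ δ) (hΛ : 0 < Λ) (hA : A.PosDef) (hB : B.PosDef)
    (he : e ⬝ᵥ e = 1) (hAe : e ⬝ᵥ (A.mulVec e) ≤ Λ)
    (h : ∀ x, x ⬝ᵥ (B.mulVec x) ≤ x ⬝ᵥ (A.mulVec x) - δ * (e ⬝ᵥ x) ^ 2) :
    Real.log B.det - Real.log A.det ≤ -(δ / Λ) := by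
  have h1 := hA.log_det_le_trace hB
  have hH : (A - δ • Matrix.vecMulVec e e).IsHermitian := by
    have := hA.isHermitian
    simp only [Matrix.IsHermitian, Matrix.conjTranspose_eq_transpose_of_trivial] at *
    simp [this, Matrix.transpose_vecMulVec]
  have h3 := hA.trace_inv_mul_mono (Matrix.posSemidef_sub_of_forall_le hB.isHermitian hH
    (fun x => by
      have := h x
      simp only [Matrix.sub_mulVec, dotProduct_sub, Matrix.smul_mulVec, dotProduct_smul,
        smul_eq_mul, Matrix.vecMulVec_mulVec]
      simp only [op_smul_eq_smul, smul_eq_mul]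
      rw [dotProduct_comm x e]
      linarith))
  have h4 : (A⁻¹ * (A - δ • Matrix.vecMulVec e e)).trace
      = m - δ * (e ⬝ᵥ (A⁻¹.mulVec e)) := by
    rw [Matrix.mul_sub, Matrix.trace_sub, Matrix.mul_smul, hA.inv_mul_self, Matrix.mul_vecMulVec]
    simp [Matrix.trace_vecMulVec, dotProduct_comm]
  have h5 : 1 / Λ ≤ e ⬝ᵥ (A⁻¹.mulVec e) := by
    set v := A⁻¹.mulVec e with hv
    have hAv : A.mulVec v = e := by
      rw [hv, Matrix.mulVec_mulVec,
        Matrix.mul_nonsing_inv _ ((Matrix.isUnit_iff_isUnit_det A).1 hA.isUnit), Matrix.one_mulVec]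
    have hsym : v ⬝ᵥ (A.mulVec e) = e ⬝ᵥ e := by
      have hT : A.transpose = A := by
        simpa [Matrix.IsHermitian, Matrix.conjTranspose_eq_transpose_of_trivial]
          using hA.isHermitian
      rw [Matrix.dotProduct_mulVec, ← Matrix.mulVec_transpose, hT, hAv]
    have hp := hA.posSemidef.dotProduct_mulVec_nonneg (v - Λ⁻¹ • e)
    simp only [star_trivial, Matrix.mulVec_sub, Matrix.mulVec_smul, hAv, sub_dotProduct,
      dotProduct_sub, smul_dotProduct, dotProduct_smul, smul_eq_mul, hsym, he,
      dotProduct_comm v e] at hp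
    have : Λ⁻¹ * (Λ⁻¹ * (e ⬝ᵥ (A.mulVec e))) ≤ Λ⁻¹ := by
      have : Λ⁻¹ * (Λ⁻¹ * (e ⬝ᵥ (A.mulVec e))) ≤ Λ⁻¹ * (Λ⁻¹ * Λ) := by gcongr
      rwa [inv_mul_cancel₀ hΛ.ne', mul_one] at this
    rw [one_div]; linarith
  have h6 := mul_le_mul_of_nonneg_left h5 hδ
  have : δ * (1 / Λ) = δ / Λ := by ring
  linarith

/-- The matrix `a (1 - ν νᵀ) + b ν νᵀ`. -/
def radialMatrix {m : ℕ} (a b : ℝ) (ν : Fin m → ℝ) : Matrix (Fin m) (Fin m) ℝ :=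
  a • (1 : Matrix (Fin m) (Fin m) ℝ) + (b - a) • Matrix.vecMulVec ν ν

lemma radialMatrix_quadratic {m : ℕ} (a b : ℝ) (ν x : Fin m → ℝ) :
    x ⬝ᵥ ((radialMatrix a b ν).mulVec x) = a * (x ⬝ᵥ x - (ν ⬝ᵥ x) ^ 2) + b * (ν ⬝ᵥ x) ^ 2 := by
  simp only [radialMatrix, Matrix.add_mulVec, dotProduct_add, Matrix.smul_mulVec, dotProduct_smul,
        smul_eq_mul, Matrix.vecMulVec_mulVec, Matrix.one_mulVec]
  simp only [op_smul_eq_smul, smul_eq_mul]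
  rw [dotProduct_comm x ν]
  ring

lemma sq_dotProduct_le {m : ℕ} {ν : Fin m → ℝ} (hν : ν ⬝ᵥ ν = 1) (x : Fin m → ℝ) :
    (ν ⬝ᵥ x) ^ 2 ≤ x ⬝ᵥ x := by
  have h := dotProduct_star_self_nonneg (x - (ν ⬝ᵥ x) • ν)
  simp only [star_trivial, sub_dotProduct, dotProduct_sub, smul_dotProduct, dotProduct_smul,
    smul_eq_mul, hν, dotProduct_comm x ν] at h
  nlinarith

lemma radialMatrix_posDef {m : ℕ} {a b : ℝ} (ha : 0 < a) (hb : 0 < b) {ν : Fin m → ℝ}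
    (hν : ν ⬝ᵥ ν = 1) : (radialMatrix a b ν).PosDef := by
  refine .of_dotProduct_mulVec_pos ?_ fun x hx => ?_
  · simp [Matrix.IsHermitian, Matrix.conjTranspose_eq_transpose_of_trivial, radialMatrix,
      Matrix.transpose_vecMulVec]
  · rw [star_trivial, radialMatrix_quadratic]
    have h1 := sq_dotProduct_le hν x
    have h2 : 0 < x ⬝ᵥ x := by simpa using Matrix.dotProduct_star_self_pos_iff.2 hx
    rcases eq_or_ne (ν ⬝ᵥ x) 0 with h | h
    · rw [h]; simp; positivity
    · have : 0 < (ν ⬝ᵥ x) ^ 2 := by positivity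
      have := mul_nonneg ha.le (sub_nonneg.2 h1)
      positivity

lemma radialMatrix_det {m : ℕ} {a : ℝ} (ha : a ≠ 0) (b : ℝ) {ν : Fin (m + 1) → ℝ}
    (hν : ν ⬝ᵥ ν = 1) : (radialMatrix a b ν).det = a ^ m * b := by
  have h : radialMatrix a b ν
      = a • (1 + Matrix.replicateCol Unit (((b - a) / a) • ν) * Matrix.replicateRow Unit ν) := by
    rw [← Matrix.vecMulVec_eq, radialMatrix, smul_add, Matrix.smul_vecMulVec, smul_smul,
      mul_div_cancel₀ _ ha]
  rw [h, Matrix.det_smul, Matrix.det_one_add_replicateCol_mul_replicateRow]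
  simp only [dotProduct_smul, hν, Fintype.card_fin, smul_eq_mul]
  field_simp
  ring

/-! ### Second order jets of functions on the line -/

/-- `φ` is differentiable near `0`, with first derivative `a` and second derivative `b` at `0`. -/
def HasJet (φ : ℝ → ℝ) (a b : ℝ) : Prop :=
  ∃ φ' : ℝ → ℝ, (∀ᶠ t in 𝓝 0, HasDerivAt φ (φ' t) t) ∧ φ' 0 = a ∧ HasDerivAt φ' b 0

lemma HasJet.add {φ ψ : ℝ → ℝ} {a b c d : ℝ} (h : HasJet φ a b) (k : HasJet ψ c d) :
    HasJet (fun t => φ t + ψ t) (a + c) (b + d) := by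
  obtain ⟨φ', h1, rfl, h3⟩ := h
  obtain ⟨ψ', k1, rfl, k3⟩ := k
  exact ⟨fun t => φ' t + ψ' t, by filter_upwards [h1, k1] with t ht kt using ht.add kt, rfl,
    h3.add k3⟩

lemma HasJet.const_mul {φ : ℝ → ℝ} {a b : ℝ} (h : HasJet φ a b) (c : ℝ) :
    HasJet (fun t => c * φ t) (c * a) (c * b) := by
  obtain ⟨φ', h1, rfl, h3⟩ := h
  exact ⟨fun t => c * φ' t, by filter_upwards [h1] with t ht using ht.const_mul c, rfl,
    h3.const_mul c⟩

lemma HasJet.sub {φ ψ : ℝ → ℝ} {a b c d : ℝ} (h : HasJet φ a b) (k : HasJet ψ c d) :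
    HasJet (fun t => φ t - ψ t) (a - c) (b - d) := by
  have := h.add (k.const_mul (-1))
  simpa [← sub_eq_add_neg] using this

lemma HasJet.of_isLocalMin {φ : ℝ → ℝ} {a b : ℝ} (h : HasJet φ a b) (hm : IsLocalMin φ 0) :
    a = 0 ∧ 0 ≤ b := by
  obtain ⟨φ', h1, rfl, h3⟩ := h
  have h0 : φ' 0 = 0 := hm.hasDerivAt_eq_zero h1.self_of_nhds
  refine ⟨h0, ?_⟩
  by_contra! hb
  have hd : deriv φ =ᶠ[𝓝 0] φ' := by filter_upwards [h1] with t ht using ht.deriv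
  have hdd : deriv (deriv φ) 0 = b := by rw [hd.deriv_eq, h3.deriv]
  have hM := isLocalMax_of_deriv_deriv_neg (f := φ) (x₀ := 0) (by rw [hdd]; exact hb)
    (by rw [hd.self_of_nhds, h0]) h1.self_of_nhds.continuousAt
  have hc : φ =ᶠ[𝓝 0] fun _ => φ 0 := by
    filter_upwards [hm, hM] with t h h' using le_antisymm h' h
  have : deriv (deriv φ) 0 = 0 := by
    have : deriv φ =ᶠ[𝓝 0] fun _ => 0 := by simpa using hc.deriv
    rw [this.deriv_eq]; simp
  linarith

lemma hasJet_quadratic (p q r : ℝ) : HasJet (fun t => p + q * t + r * t ^ 2) q (2 * r) := by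
  refine ⟨fun t => q + 2 * r * t, Eventually.of_forall fun t => ?_, by simp, ?_⟩
  · have := (((hasDerivAt_id' t).const_mul q).const_add p).add
      (((hasDerivAt_id' t).pow 2).const_mul r)
    exact this.congr_deriv (by norm_num; ring)
  · simpa using ((hasDerivAt_id' (0 : ℝ)).const_mul (2 * r)).const_add q

lemma HasJet.sq {φ : ℝ → ℝ} {a b : ℝ} (h : HasJet φ a b) :
    HasJet (fun t => φ t ^ 2) (2 * φ 0 * a) (2 * a ^ 2 + 2 * φ 0 * b) := by
  obtain ⟨φ', h1, rfl, h3⟩ := h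
  refine ⟨fun t => 2 * (φ t * φ' t), ?_, by ring, ?_⟩
  · filter_upwards [h1] with t ht
    exact (ht.pow 2).congr_deriv (by norm_num; ring)
  · exact ((h1.self_of_nhds.mul h3).const_mul 2).congr_deriv (by ring)

lemma hasJet_exp (p q : ℝ) :
    HasJet (fun t => Real.exp (p + q * t)) (q * Real.exp p) (q ^ 2 * Real.exp p) := by
  have h : ∀ t, HasDerivAt (fun t => Real.exp (p + q * t)) (q * Real.exp (p + q * t)) t :=
    fun t => (((hasDerivAt_id' t).const_mul q).const_add p).exp.congr_deriv (by ring)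
  refine ⟨fun t => q * Real.exp (p + q * t), Eventually.of_forall h, by simp, ?_⟩
  exact ((h 0).const_mul q).congr_deriv (by simp; ring)

/-! ### The Hessian as a quadratic form -/

section HessForm

variable {n : ℕ}

/-- The quadratic form `D²u(x)(ξ,ξ)`. -/
def hessForm (u : Euc n → ℝ) (x ξ : Euc n) : ℝ := iteratedFDeriv ℝ 2 u x ![ξ, ξ]

lemma hasDerivAt_line {u : Euc n → ℝ} {x ξ : Euc n} {t : ℝ}
    (h : DifferentiableAt ℝ u (x + t • ξ)) :
    HasDerivAt (fun t : ℝ => u (x + t • ξ)) (fderiv ℝ u (x + t • ξ) ξ) t := by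
  have hl : HasDerivAt (fun t : ℝ => x + t • ξ) ξ t := by
    simpa using ((hasDerivAt_id t).smul_const ξ).const_add x
  exact h.hasFDerivAt.comp_hasDerivAt t hl

lemma hasDerivAt_fderiv_line {u : Euc n → ℝ} {x ξ : Euc n} {t : ℝ}
    (h : ContDiffAt ℝ 2 u (x + t • ξ)) :
    HasDerivAt (fun t : ℝ => fderiv ℝ u (x + t • ξ) ξ) (hessForm u (x + t • ξ) ξ) t := by
  have hl : HasDerivAt (fun t : ℝ => x + t • ξ) ξ t := by
    simpa using ((hasDerivAt_id t).smul_const ξ).const_add x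
  have hd : DifferentiableAt ℝ (fderiv ℝ u) (x + t • ξ) :=
    (h.fderiv_right (m := 1) (by norm_num)).differentiableAt (by norm_num)
  have h2 : HasDerivAt (fun t : ℝ => fderiv ℝ u (x + t • ξ))
      (fderiv ℝ (fderiv ℝ u) (x + t • ξ) ξ) t := hd.hasFDerivAt.comp_hasDerivAt t hl
  have h3 : hessForm u (x + t • ξ) ξ = fderiv ℝ (fderiv ℝ u) (x + t • ξ) ξ ξ := by
    rw [hessForm, iteratedFDeriv_two_apply]; rfl
  rw [h3]
  exact (h2.clm_apply (hasDerivAt_const t ξ)).congr_deriv (by simp)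

lemma hasJet_line {u : Euc n → ℝ} {x : Euc n} (ξ : Euc n) (h : ContDiffAt ℝ 2 u x) :
    HasJet (fun t : ℝ => u (x + t • ξ)) (fderiv ℝ u x ξ) (hessForm u x ξ) := by
  refine ⟨fun t => fderiv ℝ u (x + t • ξ) ξ, ?_, by simp, ?_⟩
  · have hc : Tendsto (fun t : ℝ => x + t • ξ) (𝓝 0) (𝓝 x) := by
      have : Continuous fun t : ℝ => x + t • ξ := by fun_prop
      simpa using this.tendsto 0
    filter_upwards [hc.eventually (h.eventually (by simp))] with t ht
    exact hasDerivAt_line (ht.differentiableAt (by norm_num))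
  · simpa using hasDerivAt_fderiv_line (u := u) (x := x) (ξ := ξ) (t := 0) (by simpa using h)

lemma euc_eq_sum (ξ : Euc n) : ξ = ∑ i, ξ i • EuclideanSpace.single i (1 : ℝ) := by
  ext j
  simp [Pi.single_apply]

lemma hessForm_eq_matrix (u : Euc n → ℝ) (x ξ : Euc n) :
    hessForm u x ξ = ξ.ofLp ⬝ᵥ ((Hess u x).mulVec ξ.ofLp) := by
  have hb : ∀ a b : Euc n, iteratedFDeriv ℝ 2 u x ![a, b] = fderiv ℝ (fderiv ℝ u) x a b :=
    fun a b => by rw [iteratedFDeriv_two_apply]; rfl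
  rw [hessForm, hb]
  conv_lhs => rw [euc_eq_sum ξ]
  simp only [map_sum, map_smul, sum_apply, smul_apply,
    smul_eq_mul, dotProduct, Matrix.mulVec, Hess, hb, Finset.mul_sum]
  rw [Finset.sum_comm]
  refine Finset.sum_congr rfl fun i _ => Finset.sum_congr rfl fun j _ => ?_
  ring

lemma inner_eq_dot (x y : Euc n) : ⟪x, y⟫ = x.ofLp ⬝ᵥ y.ofLp := by
  simp [PiLp.inner_apply, dotProduct, mul_comm]

lemma norm_sq_eq_dot (x : Euc n) : ‖x‖ ^ 2 = x.ofLp ⬝ᵥ x.ofLp := by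
  rw [← inner_eq_dot, real_inner_self_eq_norm_sq]

/-- The matrix of a linear isometry. -/
def isoMatrix (Q : Euc n →ₗᵢ[ℝ] Euc n) : Matrix (Fin n) (Fin n) ℝ :=
  fun i j => Q (EuclideanSpace.single j 1) i

lemma isoMatrix_mulVec (Q : Euc n →ₗᵢ[ℝ] Euc n) (ξ : Euc n) :
    (isoMatrix Q).mulVec ξ.ofLp = (Q ξ).ofLp := by
  ext i
  conv_rhs => rw [euc_eq_sum ξ]
  simp [Matrix.mulVec, dotProduct, isoMatrix, mul_comm]

lemma isoMatrix_transpose_mul (Q : Euc n →ₗᵢ[ℝ] Euc n) :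
    (isoMatrix Q).transpose * isoMatrix Q = 1 := by
  ext i j
  have h : ⟪Q (EuclideanSpace.single i (1 : ℝ)), Q (EuclideanSpace.single j (1 : ℝ))⟫
      = (1 : Matrix (Fin n) (Fin n) ℝ) i j := by
    rw [Q.inner_map_map]
    simp [inner_eq_dot, Matrix.one_apply, Pi.single_apply, eq_comm]
  rw [← h, inner_eq_dot]
  simp [Matrix.mul_apply, isoMatrix, dotProduct]

/-- The Hessian of `u ∘ Q` at `x`, expressed through the Hessian of `u` at `Q x`. -/
def rotHess (u : Euc n → ℝ) (Q : Euc n →ₗᵢ[ℝ] Euc n) (x : Euc n) : Matrix (Fin n) (Fin n) ℝ :=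
  (isoMatrix Q).transpose * Hess u (Q x) * isoMatrix Q

lemma rotHess_quadratic (u : Euc n → ℝ) (Q : Euc n →ₗᵢ[ℝ] Euc n) (x ξ : Euc n) :
    ξ.ofLp ⬝ᵥ ((rotHess u Q x).mulVec ξ.ofLp) = hessForm u (Q x) (Q ξ) := by
  rw [hessForm_eq_matrix, ← isoMatrix_mulVec, rotHess, ← Matrix.mulVec_mulVec,
    ← Matrix.mulVec_mulVec, Matrix.dotProduct_mulVec, Matrix.vecMul_transpose]

lemma rotHess_det (u : Euc n → ℝ) (Q : Euc n →ₗᵢ[ℝ] Euc n) (x : Euc n) :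
    (rotHess u Q x).det = (Hess u (Q x)).det := by
  have h := congrArg Matrix.det (isoMatrix_transpose_mul Q)
  rw [Matrix.det_mul, Matrix.det_one] at h
  rw [rotHess, Matrix.det_mul, Matrix.det_mul]
  linear_combination (Hess u (Q x)).det * h

lemma rotHess_posDef {u : Euc n → ℝ} (Q : Euc n →ₗᵢ[ℝ] Euc n) {x : Euc n}
    (h : (Hess u (Q x)).PosDef) : (rotHess u Q x).PosDef := by
  have := h.conjTranspose_mul_mul_same (B := isoMatrix Q) (fun a b hab => by
    simpa [Matrix.mulVec_mulVec, isoMatrix_transpose_mul] using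
      congrArg (isoMatrix Q).transpose.mulVec hab)
  rwa [Matrix.conjTranspose_eq_transpose_of_trivial] at this

lemma hessForm_nonneg {u : Euc n → ℝ} {x : Euc n} (h : (Hess u x).PosDef) (ξ : Euc n) :
    0 ≤ hessForm u x ξ := by
  rw [hessForm_eq_matrix]
  simpa using h.posSemidef.dotProduct_mulVec_nonneg ξ.ofLp

lemma log_det_of_gaussK {u : Euc n → ℝ} {x : Euc n} (h : (Hess u x).PosDef) :
    Real.log (Hess u x).det
      = Real.log (gaussK u x) + ((n : ℝ) + 2) / 2 * Real.log (1 + ‖fderiv ℝ u x‖ ^ 2) := by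
  have h1 : 0 < 1 + ‖fderiv ℝ u x‖ ^ 2 := by positivity
  rw [gaussK, Real.log_div h.det_pos.ne' (Real.rpow_pos_of_pos h1 _).ne', Real.log_rpow h1]
  ring

lemma log_one_add_sq_le {a b δ : ℝ} (ha : 0 ≤ a) (hδ : 0 ≤ δ) (h : a ≤ b + δ) :
    Real.log (1 + a ^ 2) ≤ Real.log (1 + b ^ 2) + 2 * δ := by
  have h1 : 1 + a ^ 2 ≤ (1 + b ^ 2) * Real.exp (2 * δ) := by
    have h2 := Real.quadratic_le_exp_of_nonneg (x := 2 * δ) (by positivity)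
    have h4 : a ^ 2 ≤ (b + δ) ^ 2 := by gcongr
    have h3 : (1 + b ^ 2) * (1 + 2 * δ + (2 * δ) ^ 2 / 2) ≤ (1 + b ^ 2) * Real.exp (2 * δ) := by
      gcongr
    nlinarith [mul_nonneg hδ (sq_nonneg (b - 1)), sq_nonneg (b * δ)]
  calc Real.log (1 + a ^ 2) ≤ Real.log ((1 + b ^ 2) * Real.exp (2 * δ)) :=
        Real.log_le_log (by positivity) h1
    _ = _ := by rw [Real.log_mul (by positivity) (by positivity), Real.log_exp]

end HessForm

/-! ### The comparison principle -/

section Comparison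

lemma nat_le_infty (k : ℕ) : (k : WithTop ℕ∞) ≤ ((⊤ : ℕ∞) : WithTop ℕ∞) :=
  WithTop.coe_le_coe.2 (le_top (a := (k : ℕ∞)))

lemma two_le_infty : (2 : WithTop ℕ∞) ≤ ((⊤ : ℕ∞) : WithTop ℕ∞) := nat_le_infty 2

variable {n : ℕ} {S : ExtSetting n} {R : ℝ} {u : Euc n → ℝ}

lemma ExtSetting.compl_mem_nhds (S : ExtSetting n) {x : Euc n} (hx : x ∉ S.K) :
    (interior S.K)ᶜ ∈ 𝓝 x :=
  mem_of_superset (S.hKc.isClosed.isOpen_compl.mem_nhds hx)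
    (compl_subset_compl.2 interior_subset)

lemma ExtSetting.contDiffAt_ul (S : ExtSetting n) {x : Euc n} (hx : x ∉ S.K) :
    ContDiffAt ℝ (⊤ : ℕ∞) S.ul x :=
  S.hulsm.contDiffAt (S.compl_mem_nhds hx)

lemma ExtSetting.notMem_K (S : ExtSetting n) {x : Euc n} (hx : S.R₀ ≤ ‖x‖) : x ∉ S.K :=
  fun h => by
    have := S.hKR₀ h
    rw [mem_ball_zero_iff] at this
    linarith

lemma solDom_mem_nhds {x : Euc n} (hx : x ∈ ball (0 : Euc n) R \ S.K) : solDom S R ∈ 𝓝 x :=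
  inter_mem (mem_of_superset (isOpen_ball.mem_nhds hx.1) ball_subset_closedBall)
    (S.compl_mem_nhds hx.2)

lemma IsSol.contDiffAt (hu : IsSol S R u) {x : Euc n} (hx : x ∈ ball (0 : Euc n) R \ S.K) :
    ContDiffAt ℝ (⊤ : ℕ∞) u x :=
  hu.1.contDiffAt (solDom_mem_nhds hx)

lemma isCompact_solDom : IsCompact (solDom S R) :=
  (isCompact_closedBall 0 R).diff isOpen_interior

lemma mem_of_mem_solDom {x : Euc n} (hx : x ∈ solDom S R) :
    x ∈ ball (0 : Euc n) R \ S.K ∨ x ∈ sphere (0 : Euc n) R ∪ frontier S.K := by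
  by_cases h1 : x ∈ sphere (0 : Euc n) R
  · exact Or.inr (Or.inl h1)
  by_cases h2 : x ∈ S.K
  · exact Or.inr (Or.inr (by rw [S.hKc.isClosed.frontier_eq]; exact ⟨h2, hx.2⟩))
  · refine Or.inl ⟨?_, h2⟩
    have := hx.1
    rw [mem_closedBall_zero_iff] at this
    rw [mem_sphere_zero_iff_norm] at h1
    rw [mem_ball_zero_iff]
    exact lt_of_le_of_ne this h1

lemma IsSol.log_det (hu : IsSol S R u) {x : Euc n} (hx : x ∈ ball (0 : Euc n) R \ S.K) :
    Real.log (Hess u x).det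
      = Real.log (S.f x (u x)) + ((n : ℝ) + 2) / 2 * Real.log (1 + ‖fderiv ℝ u x‖ ^ 2) := by
  rw [log_det_of_gaussK (hu.2.1 x hx), hu.2.2.1 x hx]

lemma ContDiffAt.continuousAt_hessForm {x : Euc n} (h : ContDiffAt ℝ (⊤ : ℕ∞) u x) (ξ : Euc n) :
    ContinuousAt (fun y => hessForm u y ξ) x := by
  have h1 : ContinuousAt (iteratedFDeriv ℝ 2 u) x :=
    (h.iteratedFDeriv_right (m := 0) (i := 2) (nat_le_infty (0 + 2))).continuousAt
  exact (ContinuousMultilinearMap.apply ℝ (fun _ : Fin 2 => Euc n) ℝ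
    ![ξ, ξ]).continuous.continuousAt.comp h1

/-- The subsolution lies below every solution. -/
theorem IsSol.ul_le (hu : IsSol S R u) {x₁ : Euc n} (hx₁ : x₁ ∈ solDom S R) :
    S.ul x₁ ≤ u x₁ := by
  by_contra! hlt
  have hwc : ContinuousOn (fun x => u x - S.ul x) (solDom S R) :=
    hu.1.continuousOn.sub (S.hulsm.continuousOn.mono fun x hx => hx.2)
  set m : ℝ := S.ul x₁ - u x₁ with hm
  have hm0 : 0 < m := sub_pos.2 hlt
  let D : Set (Euc n) := {x | x ∈ solDom S R ∧ u x - S.ul x ≤ -(m / 2)}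
  have hDc : IsCompact D := by
    have := hwc.preimage_isClosed_of_isClosed (isCompact_solDom (S := S) (R := R)).isClosed
      (isClosed_Iic (a := -(m / 2)))
    exact (isCompact_solDom (S := S) (R := R)).of_isClosed_subset this inter_subset_left
  have hDint : ∀ x ∈ D, x ∈ ball (0 : Euc n) R \ S.K := fun x hx =>
    (mem_of_mem_solDom hx.1).resolve_right fun hb => by
      have := hx.2
      rw [hu.2.2.2 x hb] at this
      linarith
  let i : Fin n := ⟨0, by have := S.hn; omega⟩
  let e : Euc n := EuclideanSpace.single i 1
  obtain ⟨Λ, hΛ0, hΛ⟩ : ∃ Λ : ℝ, 0 < Λ ∧ ∀ x ∈ D, hessForm u x e ≤ Λ := by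
    have hc : ContinuousOn (fun y => hessForm u y e) D := fun x hx =>
      ((hu.contDiffAt (hDint x hx)).continuousAt_hessForm e).continuousWithinAt
    obtain ⟨Λ, h⟩ := hDc.bddAbove_image hc
    exact ⟨max Λ 1, by positivity, fun x hx => (h (mem_image_of_mem _ hx)).trans (le_max_left _ _)⟩
  set l : ℝ := ((n : ℝ) + 3) * Λ with hl
  have hl0 : 0 < l := by positivity
  let h : Euc n → ℝ := fun x => Real.exp (l * x i)
  have hhc : Continuous h := by fun_prop
  obtain ⟨H, hH0, hH⟩ : ∃ H : ℝ, 0 < H ∧ ∀ x ∈ solDom S R, h x ≤ H := by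
    obtain ⟨H, h'⟩ := (isCompact_solDom (S := S) (R := R)).bddAbove_image hhc.continuousOn
    exact ⟨max H 1, by positivity, fun x hx =>
      (h' (mem_image_of_mem _ hx)).trans (le_max_left _ _)⟩
  set ε : ℝ := m / (4 * H) with hε
  have hε0 : 0 < ε := by positivity
  have hεH : ε * H = m / 4 := by rw [hε]; field_simp
  obtain ⟨x, hx, hmin⟩ := (isCompact_solDom (S := S) (R := R)).exists_isMinOn ⟨x₁, hx₁⟩
    (hwc.sub (hhc.continuousOn.const_smul ε))
  have hxD : x ∈ D := by
    refine ⟨hx, ?_⟩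
    have h1 : u x - S.ul x - ε * h x ≤ u x₁ - S.ul x₁ - ε * h x₁ := hmin hx₁
    have h2 : ε * h x ≤ ε * H := mul_le_mul_of_nonneg_left (hH x hx) hε0.le
    have h3 : 0 ≤ ε * h x₁ := mul_nonneg hε0.le (Real.exp_pos _).le
    rw [hεH] at h2
    linarith
  have hxi := hDint x hxD
  have hxlocal : IsLocalMin (fun y => (u y - S.ul y) - ε * h y) x :=
    hmin.isLocalMin (solDom_mem_nhds hxi)
  have hjet : ∀ ξ : Euc n,
      (fderiv ℝ u x ξ - fderiv ℝ S.ul x ξ) - ε * (l * ξ i * h x) = 0 ∧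
      0 ≤ (hessForm u x ξ - hessForm S.ul x ξ) - ε * ((l * ξ i) ^ 2 * h x) := fun ξ => by
    have h1 := (hasJet_line ξ ((hu.contDiffAt hxi).of_le two_le_infty)).sub
      (hasJet_line ξ ((S.contDiffAt_ul hxi.2).of_le two_le_infty))
    have h2 := h1.sub ((hasJet_exp (l * x i) (l * ξ i)).const_mul ε)
    refine h2.of_isLocalMin ?_
    have hcont : Tendsto (fun t : ℝ => x + t • ξ) (𝓝 0) (𝓝 x) := by
      have : Continuous fun t : ℝ => x + t • ξ := by fun_prop
      simpa using this.tendsto 0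
    have := hcont.eventually hxlocal
    filter_upwards [this] with t ht
    simp only [h] at ht ⊢
    simp only [PiLp.add_apply, PiLp.smul_apply, smul_eq_mul, zero_smul, add_zero] at ht ⊢
    have e1 : l * (x.ofLp i + t * ξ.ofLp i) = l * x.ofLp i + l * ξ.ofLp i * t := by ring
    rw [e1] at ht
    simpa using ht
  have hxi0 : 0 ≤ h x := (Real.exp_pos _).le
  have hdet := (hu.2.1 x hxi).log_det_le_sub_of_rank_one (e := e.ofLp) (δ := ε * l ^ 2 * h x)
    (Λ := Λ) (by positivity) hΛ0 (S.hulconv x hxi.2)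
    (by simp [e]) (by rw [← hessForm_eq_matrix]; exact hΛ x hxD) (fun ξ => by
      have := (hjet (WithLp.toLp 2 ξ)).2
      rw [hessForm_eq_matrix, hessForm_eq_matrix] at this
      have e2 : e.ofLp ⬝ᵥ ξ = ξ i := by simp [e]
      rw [e2]
      simp only at this
      nlinarith)
  have hgrad : ‖fderiv ℝ u x‖ ≤ ‖fderiv ℝ S.ul x‖ + ε * l * h x := by
    refine ContinuousLinearMap.opNorm_le_bound _ (by positivity) fun ξ => ?_
    have h1 := (hjet ξ).1
    have h2 : fderiv ℝ u x ξ = fderiv ℝ S.ul x ξ + ε * l * h x * ξ i := by linarith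
    rw [h2, add_mul]
    refine (norm_add_le _ _).trans (add_le_add (ContinuousLinearMap.le_opNorm _ _) ?_)
    rw [norm_mul, Real.norm_of_nonneg (by positivity)]
    exact mul_le_mul_of_nonneg_left (PiLp.norm_apply_le ξ i) (by positivity)
  have hlog := log_one_add_sq_le (norm_nonneg _) (by positivity) hgrad
  rw [hu.log_det hxi, log_det_of_gaussK (S.hulconv x hxi.2)] at hdet
  have hfc : x ∈ (interior S.K)ᶜ := hx.2
  have hf1 : Real.log (S.f x (u x)) ≤ Real.log (gaussK S.ul x) := by
    refine Real.log_le_log (S.hfpos x hfc _) (le_trans ?_ (S.hulsub x hxi.2))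
    exact S.hfz x hfc (by have := hxD.2; linarith)
  have hfin : ε * l ^ 2 * h x / Λ = ε * l * h x * ((n : ℝ) + 3) := by
    rw [hl]; field_simp
  rw [hfin] at hdet
  have hpos : 0 < ε * l * h x := mul_pos (mul_pos hε0 hl0) (Real.exp_pos _)
  have hn0 : (0 : ℝ) ≤ ((n : ℝ) + 2) / 2 := by positivity
  have := mul_le_mul_of_nonneg_left hlog hn0
  nlinarith

end Comparison

/-! ### Derivatives of the norm and asymptotics of the subsolution -/

section Asymptotics

variable {n : ℕ}

lemma hasFDerivAt_norm_euc {x : Euc n} (hx : x ≠ 0) :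
    HasFDerivAt (fun y : Euc n => ‖y‖) (‖x‖⁻¹ • innerSL ℝ x) x := by
  have h0 : ‖x‖ ≠ 0 := norm_ne_zero_iff.2 hx
  have h := ((hasStrictFDerivAt_norm_sq x).hasFDerivAt).sqrt (by positivity)
  simp only [Real.sqrt_sq (norm_nonneg _)] at h
  convert! h using 1
  ext ξ
  simp only [smul_apply, smul_eq_mul, innerSL_apply_apply, nsmul_eq_mul, Nat.cast_ofNat]
  field_simp

lemma iteratedFDeriv_two_norm {x : Euc n} (hx : x ≠ 0) (m : Fin 2 → Euc n) :
    iteratedFDeriv ℝ 2 (fun y : Euc n => ‖y‖) x m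
      = (⟪m 0, m 1⟫ - ⟪x, m 0⟫ * ⟪x, m 1⟫ / ‖x‖ ^ 2) / ‖x‖ := by
  have h0 : ‖x‖ ≠ 0 := norm_ne_zero_iff.2 hx
  have he : fderiv ℝ (fun y : Euc n => ‖y‖) =ᶠ[𝓝 x] fun y => ‖y‖⁻¹ • innerSL ℝ y := by
    filter_upwards [isOpen_ne.mem_nhds hx] with y hy
    exact (hasFDerivAt_norm_euc hy).fderiv
  have h1 : HasFDerivAt (fun y : Euc n => ‖y‖⁻¹)
      (-(‖x‖ ^ 2)⁻¹ • (‖x‖⁻¹ • innerSL ℝ x)) x :=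
    (hasDerivAt_inv h0).comp_hasFDerivAt x (hasFDerivAt_norm_euc hx)
  have h2 := h1.fun_smul (innerSL ℝ (E := Euc n)).hasFDerivAt
  rw [iteratedFDeriv_two_apply, he.fderiv_eq, h2.fderiv]
  change ‖x‖⁻¹ * ⟪m 0, m 1⟫ + -(‖x‖ ^ 2)⁻¹ * (‖x‖⁻¹ * ⟪x, m 0⟫) * ⟪x, m 1⟫ = _
  field_simp
  ring

/-- Quantitative control of the data of the exterior Dirichlet problem far away from the origin. -/
structure ExtSetting.Bounds (S : ExtSetting n) (C ρ : ℝ) : Prop where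
  one_le : 1 ≤ C
  one_le_radius : 1 ≤ ρ
  R₀_le : S.R₀ ≤ ρ
  cone : ∀ x ∈ (interior S.K)ᶜ, |S.ul x - ‖x‖| ≤ C
  grad : ∀ x, ρ ≤ ‖x‖ → ‖fderiv ℝ S.ul x‖ ≤ C
  radial : ∀ x, ρ ≤ ‖x‖ → |fderiv ℝ S.ul x x - ‖x‖| ≤ C
  hess : ∀ x, ρ ≤ ‖x‖ → ‖iteratedFDeriv ℝ 2 S.ul x‖ ≤ C / ‖x‖
  third : ∀ x, ρ ≤ ‖x‖ → ‖iteratedFDeriv ℝ 3 S.ul x‖ ≤ C / ‖x‖ ^ 2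
  hess_lower : ∀ x ξ, ρ ≤ ‖x‖ →
    (‖ξ‖ ^ 2 - ⟪x, ξ⟫ ^ 2 / ‖x‖ ^ 2) / ‖x‖ - C / ‖x‖ ^ 2 * ‖ξ‖ ^ 2 ≤ hessForm S.ul x ξ
  f_le : ∀ x, ρ ≤ ‖x‖ → ∀ z, S.f x z ≤ C / ‖x‖ ^ (n + 1)
  f_grad : ∀ x, x ∉ S.K → ∀ z,
    ‖fderiv ℝ (fun q : Euc n × ℝ => S.f q.1 q.2) (x, z)‖ ≤ C * S.f x z

theorem ExtSetting.exists_bounds (S : ExtSetting n) : ∃ C ρ, S.Bounds C ρ := by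
  obtain ⟨C₀, h0⟩ := S.hulcone
  obtain ⟨C₁, ρ₁, h1⟩ := S.huldec1
  obtain ⟨C₂, ρ₂, h2⟩ := S.huldec2
  obtain ⟨C₃, h3⟩ := S.hfdec
  obtain ⟨C₄, h4⟩ := S.hfder
  obtain ⟨C, hC⟩ : ∃ C, C = 2 + |C₀| + |C₁| + |C₂| + |C₃| + |C₄| := ⟨_, rfl⟩
  obtain ⟨ρ, hρ⟩ : ∃ ρ, ρ = 1 + |ρ₁| + |ρ₂| + S.R₀ := ⟨_, rfl⟩
  have hR₀ := S.hR₀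
  have a0 := le_abs_self C₀
  have a1 := le_abs_self C₁
  have a2 := le_abs_self C₂
  have a3 := le_abs_self C₃
  have a4 := le_abs_self C₄
  have b0 := abs_nonneg C₀
  have b1 := abs_nonneg C₁
  have b2 := abs_nonneg C₂
  have b3 := abs_nonneg C₃
  have b4 := abs_nonneg C₄
  have r1 := le_abs_self ρ₁
  have r2 := le_abs_self ρ₂
  have s1 := abs_nonneg ρ₁
  have s2 := abs_nonneg ρ₂
  have hC0 : 0 ≤ C := by linarith
  have hone : ∀ x : Euc n, ρ ≤ ‖x‖ → 1 ≤ ‖x‖ := fun x hx => by linarith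
  have hK : ∀ x : Euc n, ρ ≤ ‖x‖ → x ∉ S.K := fun x hx => S.notMem_K (by linarith)
  have hne : ∀ x : Euc n, ρ ≤ ‖x‖ → x ≠ 0 := fun x hx h => by
    have := hone x hx
    rw [h, norm_zero] at this
    linarith
  have hgrad : ∀ x : Euc n, ρ ≤ ‖x‖ → fderiv ℝ S.ul x
      = fderiv ℝ (fun y => S.ul y - ‖y‖) x + ‖x‖⁻¹ • innerSL ℝ x := fun x hx => by
    rw [fderiv_fun_sub ((S.contDiffAt_ul (hK x hx)).differentiableAt (by simp))
      (hasFDerivAt_norm_euc (hne x hx)).differentiableAt,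
      (hasFDerivAt_norm_euc (hne x hx)).fderiv]
    abel
  have hhess : ∀ x : Euc n, ρ ≤ ‖x‖ → ∀ m, iteratedFDeriv ℝ 2 S.ul x m
      = iteratedFDeriv ℝ 2 (fun y => S.ul y - ‖y‖) x m
        + (⟪m 0, m 1⟫ - ⟪x, m 0⟫ * ⟪x, m 1⟫ / ‖x‖ ^ 2) / ‖x‖ := fun x hx m => by
    rw [← iteratedFDeriv_two_norm (hne x hx), fun_iteratedFDeriv_sub_apply
      ((S.contDiffAt_ul (hK x hx)).of_le two_le_infty) (contDiffAt_norm ℝ (hne x hx))]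
    simp
  have hw1 : ∀ x : Euc n, ρ ≤ ‖x‖ →
      ‖fderiv ℝ (fun y => S.ul y - ‖y‖) x‖ ≤ |C₁| / ‖x‖ := fun x hx =>
    (h1 x (by linarith)).trans (by gcongr)
  have hw2 : ∀ x : Euc n, ρ ≤ ‖x‖ →
      ‖iteratedFDeriv ℝ 2 (fun y => S.ul y - ‖y‖) x‖ ≤ |C₂| / ‖x‖ ^ 2 := fun x hx =>
    (le_add_of_nonneg_right (norm_nonneg _)).trans <|
      (h2 x (by linarith)).trans (by gcongr)
  refine ⟨C, ρ, by linarith, by linarith, by linarith, fun x hx => (h0 x hx).trans (by linarith),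
    fun x hx => ?_, fun x hx => ?_, fun x hx => ?_, fun x hx => ?_, fun x ξ hx => ?_,
    fun x hx z => ?_, fun x hx z => ?_⟩
  · have hx1 := hone x hx
    rw [hgrad x hx]
    refine (norm_add_le _ _).trans ?_
    rw [norm_smul, innerSL_apply_norm, norm_inv, norm_norm, inv_mul_cancel₀ (by positivity)]
    have := (hw1 x hx).trans (div_le_self b1 hx1)
    linarith
  · have hx1 := hone x hx
    have hx0 : ‖x‖ ≠ 0 := by positivity
    have e : fderiv ℝ S.ul x x - ‖x‖ = fderiv ℝ (fun y => S.ul y - ‖y‖) x x := by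
      rw [hgrad x hx]
      simp only [add_apply, smul_apply, innerSL_apply_apply, real_inner_self_eq_norm_sq,
        smul_eq_mul]
      field_simp
      ring
    rw [e]
    have := (ContinuousLinearMap.le_of_opNorm_le _ (hw1 x hx) x)
    rw [div_mul_cancel₀ _ hx0] at this
    exact this.trans (by linarith)
  · have hx1 := hone x hx
    refine ContinuousMultilinearMap.opNorm_le_bound (by positivity) fun m => ?_
    have e1 : |⟪m 0, m 1⟫| ≤ ‖m 0‖ * ‖m 1‖ := abs_real_inner_le_norm _ _
    have e2 : |⟪x, m 0⟫ * ⟪x, m 1⟫ / ‖x‖ ^ 2| ≤ ‖m 0‖ * ‖m 1‖ := by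
      rw [abs_div, abs_mul, abs_of_nonneg (by positivity : 0 ≤ ‖x‖ ^ 2),
        div_le_iff₀ (by positivity)]
      calc |⟪x, m 0⟫| * |⟪x, m 1⟫| ≤ (‖x‖ * ‖m 0‖) * (‖x‖ * ‖m 1‖) := by
            gcongr <;> exact abs_real_inner_le_norm _ _
        _ = _ := by ring
    have e3 : ‖iteratedFDeriv ℝ 2 (fun y => S.ul y - ‖y‖) x m‖
        ≤ |C₂| / ‖x‖ * (‖m 0‖ * ‖m 1‖) := by
      refine (ContinuousMultilinearMap.le_of_opNorm_le (hw2 x hx) m).trans ?_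
      rw [Fin.prod_univ_two]
      have : ‖x‖ ≤ ‖x‖ ^ 2 := by nlinarith
      gcongr
    rw [hhess x hx, Fin.prod_univ_two]
    calc _ ≤ |C₂| / ‖x‖ * (‖m 0‖ * ‖m 1‖)
          + (‖m 0‖ * ‖m 1‖ + ‖m 0‖ * ‖m 1‖) / ‖x‖ := by
          refine (norm_add_le _ _).trans (add_le_add e3 ?_)
          rw [norm_div, norm_norm]
          gcongr
          exact (abs_sub _ _).trans (add_le_add e1 e2)
      _ = (|C₂| + 2) / ‖x‖ * (‖m 0‖ * ‖m 1‖) := by ring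
      _ ≤ _ := by
          gcongr
          linarith
  · exact (le_add_of_nonneg_left (norm_nonneg _)).trans <|
      (h2 x (by linarith)).trans (by gcongr; linarith)
  · have hx1 := hone x hx
    have e3 := ContinuousMultilinearMap.le_of_opNorm_le (hw2 x hx) ![ξ, ξ]
    rw [hessForm, hhess x hx]
    simp only [Fin.prod_univ_two, Matrix.cons_val_zero, Matrix.cons_val_one,
      real_inner_self_eq_norm_sq] at e3 ⊢
    have e4 := neg_le_of_abs_le e3
    have e5 : |C₂| / ‖x‖ ^ 2 * (‖ξ‖ * ‖ξ‖) ≤ C / ‖x‖ ^ 2 * ‖ξ‖ ^ 2 := by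
      rw [← sq]
      gcongr
      linarith
    rw [← sq]
    linarith
  · have hx1 := hone x hx
    rw [le_div_iff₀ (by positivity)]
    exact (h3 x (fun h => hK x hx (interior_subset h)) z).trans (by linarith)
  · have hmem : (interior S.K)ᶜ ×ˢ (univ : Set ℝ) ∈ 𝓝 (x, z) :=
      prod_mem_nhds (S.compl_mem_nhds hx) univ_mem
    have := h4 (x, z) (mem_of_mem_nhds hmem)
    rw [fderivWithin_of_mem_nhds hmem] at this
    have hf := S.hfpos x (fun h => hx (interior_subset h)) z
    refine (le_add_of_nonneg_right (norm_nonneg _)).trans (this.trans ?_)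
    simp only
    gcongr
    linarith

end Asymptotics

/-! ### Estimates for the values and the gradient of solutions -/

section Gradient

variable {n : ℕ} {S : ExtSetting n} {R C ρ : ℝ} {u : Euc n → ℝ}

lemma mem_solDom_of_norm {x : Euc n} (h1 : S.R₀ ≤ ‖x‖) (h2 : ‖x‖ ≤ R) : x ∈ solDom S R :=
  ⟨mem_closedBall_zero_iff.2 h2, fun h => S.notMem_K h1 (interior_subset h)⟩

lemma mem_ball_diff_of_norm {x : Euc n} (h1 : S.R₀ ≤ ‖x‖) (h2 : ‖x‖ < R) :
    x ∈ ball (0 : Euc n) R \ S.K :=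
  ⟨mem_ball_zero_iff.2 h2, S.notMem_K h1⟩

/-- A solution lies above its tangent lines along segments in its domain. -/
lemma IsSol.tangent_le (hu : IsSol S R u) {x v : Euc n} {G : Euc n →L[ℝ] ℝ}
    (hG : HasFDerivWithinAt u G (solDom S R) x) (hx : x ∈ solDom S R) (hy : x + v ∈ solDom S R)
    (h : ∀ t ∈ Ioo (0 : ℝ) 1, x + t • v ∈ ball (0 : Euc n) R \ S.K) :
    G v ≤ u (x + v) - u x := by
  have hmaps : MapsTo (fun t : ℝ => x + t • v) (Icc 0 1) (solDom S R) := fun t ht => by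
    rcases eq_or_lt_of_le ht.1 with h0 | h0
    · simpa [← h0] using hx
    rcases eq_or_lt_of_le ht.2 with h1 | h1
    · simpa [h1] using hy
    exact mem_of_mem_nhds (solDom_mem_nhds (h t ⟨h0, h1⟩))
  have hline : ∀ t : ℝ, HasDerivAt (fun t : ℝ => x + t • v) v t := fun t => by
    simpa using ((hasDerivAt_id t).smul_const v).const_add x
  have hconv : ConvexOn ℝ (Icc 0 1) (fun t : ℝ => u (x + t • v)) := by
    refine convexOn_of_hasDerivWithinAt2_nonneg (f' := fun t => fderiv ℝ u (x + t • v) v)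
      (f'' := fun t => hessForm u (x + t • v) v) (convex_Icc 0 1)
      (hu.1.continuousOn.comp (by fun_prop) hmaps) ?_ ?_ ?_ <;> rw [interior_Icc] <;> intro t ht
    · exact (hasDerivAt_line ((hu.contDiffAt (h t ht)).differentiableAt
        (by simp))).hasDerivWithinAt
    · exact (hasDerivAt_fderiv_line ((hu.contDiffAt (h t ht)).of_le
        two_le_infty)).hasDerivWithinAt
    · exact hessForm_nonneg (hu.2.1 _ (h t ht)) v
  have hG' : HasFDerivWithinAt u G (solDom S R) (x + (0 : ℝ) • v) := by simpa using hG
  have hd : HasDerivWithinAt (fun t : ℝ => u (x + t • v)) (G v) (Icc 0 1) 0 :=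
    hG'.comp_hasDerivWithinAt 0 (hline 0).hasDerivWithinAt hmaps
  have := hconv.le_slope_of_hasDerivWithinAt (by simp) (by simp : (1 : ℝ) ∈ Icc 0 1)
    one_pos hd
  simpa [slope_def_field] using this

lemma IsSol.hasFDerivAt (hu : IsSol S R u) {x : Euc n} (hx : x ∈ ball (0 : Euc n) R \ S.K) :
    HasFDerivAt u (fderiv ℝ u x) x :=
  ((hu.contDiffAt hx).differentiableAt (by simp)).hasFDerivAt

/-- Solutions lie below a translated cone. -/
lemma IsSol.le_norm_add (hB : S.Bounds C ρ) (hu : IsSol S R u) {x : Euc n}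
    (hx : x ∈ solDom S R) : u x ≤ ‖x‖ + C := by
  have hc : ContinuousOn (fun x => ‖x‖ - u x) (solDom S R) :=
    continuous_norm.continuousOn.sub hu.1.continuousOn
  obtain ⟨y, hy, hmin⟩ := (isCompact_solDom (S := S) (R := R)).exists_isMinOn ⟨x, hx⟩ hc
  suffices h : u y ≤ ‖y‖ + C by
    have : ‖y‖ - u y ≤ ‖x‖ - u x := hmin hx
    linarith
  rcases mem_of_mem_solDom hy with hi | hb
  · exfalso
    have hy0 : y ≠ 0 := fun h0 => by
      subst h0
      exact hi.2 (interior_subset S.hK0)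
    have hlocal : IsLocalMin (fun x => ‖x‖ - u x) y := hmin.isLocalMin (solDom_mem_nhds hi)
    have hj := ((hasJet_line y (contDiffAt_norm ℝ hy0)).sub
      (hasJet_line y ((hu.contDiffAt hi).of_le two_le_infty))).of_isLocalMin (by
        have hcont : Tendsto (fun t : ℝ => y + t • y) (𝓝 0) (𝓝 y) := by
          have : Continuous fun t : ℝ => y + t • y := by fun_prop
          simpa using this.tendsto 0
        have := hcont.eventually hlocal
        filter_upwards [this] with t ht
        simpa using ht)
    have h1 : hessForm (fun x : Euc n => ‖x‖) y y = 0 := by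
      rw [hessForm, iteratedFDeriv_two_norm hy0]
      simp only [Matrix.cons_val_zero, Matrix.cons_val_one, real_inner_self_eq_norm_sq]
      have : ‖y‖ ≠ 0 := norm_ne_zero_iff.2 hy0
      field_simp
      ring
    have h2 : 0 < hessForm u y y := by
      rw [hessForm_eq_matrix]
      have := (hu.2.1 y hi).dotProduct_mulVec_pos (x := y.ofLp) (by simpa using hy0)
      simpa using this
    have := hj.2
    rw [show hessForm norm y y = 0 from h1] at this
    linarith
  · rw [hu.2.2.2 y hb]
    have := (abs_le.1 (hB.cone y hy.2)).2
    linarith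

lemma IsSol.norm_sub_const_le (hB : S.Bounds C ρ) (hu : IsSol S R u) {x : Euc n}
    (hx : x ∈ solDom S R) : ‖x‖ - C ≤ u x := by
  have := (abs_le.1 (hB.cone x hx.2)).1
  have := hu.ul_le hx
  linarith

/-- The outer normal derivative of a solution on the outer boundary is almost one. -/
lemma IsSol.normal_deriv_ge (hB : S.Bounds C ρ) (hu : IsSol S R u) (hR : 2 * ρ ≤ R) {y : Euc n}
    (hy : ‖y‖ = R) {G : Euc n →L[ℝ] ℝ} (hG : HasFDerivWithinAt u G (solDom S R) y) :
    R - 4 * C ≤ G y := by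
  have h1 := hB.R₀_le
  have h2 := hB.one_le_radius
  have hn : ∀ t : ℝ, t ≤ 1 → ‖y + t • (-(1 / 2 : ℝ) • y)‖ = (1 - t / 2) * R := fun t ht => by
    have : y + t • (-(1 / 2 : ℝ) • y) = (1 - t / 2) • y := by module
    rw [this, norm_smul, hy, Real.norm_of_nonneg (by linarith)]
  have hn1 := hn 1 le_rfl
  rw [one_smul] at hn1
  have hys : y ∈ solDom S R := mem_solDom_of_norm (by linarith) hy.le
  have hzs : y + -(1 / 2 : ℝ) • y ∈ solDom S R :=
    mem_solDom_of_norm (by linarith) (by linarith)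
  have := hu.tangent_le hG hys hzs fun t ht =>
      mem_ball_diff_of_norm (by rw [hn t ht.2.le]; nlinarith [ht.1, ht.2])
        (by rw [hn t ht.2.le]; nlinarith [ht.1, ht.2])
  rw [map_smul, smul_eq_mul] at this
  have h3 := hu.le_norm_add hB hzs
  have h4 := hu.norm_sub_const_le hB hys
  linarith

/-- The gradient bound. -/
lemma IsSol.norm_fderiv_le (hB : S.Bounds C ρ) (hu : IsSol S R u) {x : Euc n}
    (hx : 2 * ρ ≤ ‖x‖) (hxR : ‖x‖ < R) : ‖fderiv ℝ u x‖ ≤ 20 * C := by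
  have h1 := hB.R₀_le
  have h2 := hB.one_le_radius
  have hC := hB.one_le
  set r := ‖x‖ with hr
  have hr0 : 0 < r := by linarith
  have hxi : x ∈ ball (0 : Euc n) R \ S.K := mem_ball_diff_of_norm (by linarith) hxR
  have hxs := mem_of_mem_nhds (solDom_mem_nhds hxi)
  have hG := (hu.hasFDerivAt hxi).hasFDerivWithinAt (s := solDom S R)
  set ν : Euc n := r⁻¹ • x with hν
  have hν1 : ‖ν‖ = 1 := by
    rw [hν, norm_smul, ← hr, norm_inv, Real.norm_of_nonneg hr0.le, inv_mul_cancel₀ hr0.ne']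
  have hxν : x = r • ν := by rw [hν, smul_inv_smul₀ hr0.ne']
  have hnν : ∀ a : ℝ, 0 ≤ a → ‖a • ν‖ = a := fun a ha => by
    rw [norm_smul, hν1, mul_one, Real.norm_of_nonneg ha]
  have hnormal : fderiv ℝ u x ν ≤ C := by
    have e1 : ∀ t : ℝ, x + t • ((R - r) • ν) = (r + t * (R - r)) • ν := fun t => by
      nth_rewrite 1 [hxν]
      module
    have e2 : x + (R - r) • ν = R • ν := by
      nth_rewrite 1 [hxν]
      module
    have hnR : ‖R • ν‖ = R := hnν R (by linarith)
    have h3 := hu.tangent_le hG hxs (v := (R - r) • ν)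
      (by rw [e2]; exact mem_solDom_of_norm (by linarith) hnR.le)
      (fun t ht => by
        have h4 : 0 < t * (R - r) := mul_pos ht.1 (by linarith)
        rw [e1]
        refine mem_ball_diff_of_norm ?_ ?_ <;> rw [hnν _ (by linarith)]
        · linarith
        · nlinarith [ht.2])
    rw [e2, hu.2.2.2 _ (Or.inl (mem_sphere_zero_iff_norm.2 hnR)), map_smul, smul_eq_mul] at h3
    have h5 : ‖S.ul (R • ν) - S.ul x‖ ≤ C * ‖R • ν - x‖ := by
      refine (convex_segment x (R • ν)).norm_image_sub_le_of_norm_fderiv_le (𝕜 := ℝ) ?_ ?_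
        (left_mem_segment ℝ _ _) (right_mem_segment ℝ _ _)
      all_goals
        intro z hz
        have hz' : ρ ≤ ‖z‖ := by
          rw [segment_eq_image'] at hz
          obtain ⟨t, ht, rfl⟩ := hz
          have h4 : 0 ≤ t * (R - r) := mul_nonneg ht.1 (by linarith)
          dsimp only
          rw [← e2, add_sub_cancel_left, e1, hnν _ (by linarith)]
          linarith
      · exact (S.contDiffAt_ul (S.notMem_K (by linarith))).differentiableAt (by simp)
      · exact hB.grad z hz'
    have e3 : ‖R • ν - x‖ = R - r := by
      rw [← e2, add_sub_cancel_left, hnν _ (by linarith)]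
    rw [e3] at h5
    have h6 := hu.ul_le hxs
    have h7 := le_of_abs_le h5
    have h8 : (R - r) * fderiv ℝ u x ν ≤ (R - r) * C := by linarith
    exact le_of_mul_le_mul_left h8 (by linarith)
  have hdir : ∀ e : Euc n, ‖e‖ ≤ 1 → fderiv ℝ u x e ≤ 20 * C := fun e he => by
    set w : Euc n := e - (2 : ℝ) • ν with hw
    have hlow : ∀ s : ℝ, 0 ≤ s → s ≤ r / 9 → 2 * r / 3 ≤ ‖x + s • w‖ ∧ ‖x + s • w‖ ≤ r - s := by
      intro s hs0 hs
      have e1 : x + s • w = (r - 2 * s) • ν + s • e := by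
        rw [hw]
        nth_rewrite 1 [hxν]
        module
      have e2 : ‖s • e‖ ≤ s := by
        rw [norm_smul, Real.norm_of_nonneg hs0]
        exact mul_le_of_le_one_right hs0 he
      have e3 := hnν (r - 2 * s) (by linarith)
      rw [e1]
      constructor
      · have := norm_sub_le ((r - 2 * s) • ν + s • e) (s • e)
        rw [add_sub_cancel_right] at this
        linarith
      · have := norm_add_le ((r - 2 * s) • ν) (s • e)
        linarith
    have hend := hlow (r / 9) (by positivity) le_rfl
    have hends : x + (r / 9) • w ∈ solDom S R :=
      mem_solDom_of_norm (by linarith) (by linarith)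
    have h3 := hu.tangent_le hG hxs (v := (r / 9) • w) hends (fun t ht => by
      rw [smul_smul]
      have ht0 : 0 ≤ t * (r / 9) := mul_nonneg ht.1.le (by positivity)
      have := hlow (t * (r / 9)) ht0 (mul_le_of_le_one_left (by positivity) ht.2.le)
      exact mem_ball_diff_of_norm (by linarith) (by linarith))
    have h4 := hu.le_norm_add hB hends
    have h5 := hu.norm_sub_const_le hB hxs
    rw [map_smul, smul_eq_mul] at h3
    have h6 : fderiv ℝ u x w ≤ 18 * C := by
      have h7 : (r / 9) * fderiv ℝ u x w ≤ 2 * C := by linarith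
      have h8 : (r / 9) * fderiv ℝ u x w ≤ (r / 9) * (18 * C) := by nlinarith
      exact le_of_mul_le_mul_left h8 (by positivity)
    rw [hw, map_sub, map_smul, smul_eq_mul] at h6
    linarith
  refine ContinuousLinearMap.opNorm_le_of_unit_norm (by positivity) fun e he => ?_
  refine abs_le.2 ⟨?_, hdir e he.le⟩
  have := hdir (-e) (by rw [norm_neg, he])
  rw [map_neg] at this
  linarith

end Gradient

/-! ### Rotations close to the identity -/

section Rotation

variable {n : ℕ} {S : ExtSetting n} {R C ρ θ : ℝ} {u : Euc n → ℝ} {Q : Euc n →ₗᵢ[ℝ] Euc n}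
  {x : Euc n}

lemma norm_mem_segment_rotation (hQ : ∀ ξ, ‖Q ξ - ξ‖ ≤ θ * ‖ξ‖) (hθ : θ ≤ 1 / 4) {z : Euc n}
    (hz : z ∈ segment ℝ x (Q x)) : 3 / 4 * ‖x‖ ≤ ‖z‖ ∧ ‖z‖ ≤ ‖x‖ := by
  constructor
  · rw [segment_eq_image'] at hz
    obtain ⟨t, ht, rfl⟩ := hz
    have h1 : ‖t • (Q x - x)‖ ≤ 1 / 4 * ‖x‖ := by
      rw [norm_smul, Real.norm_of_nonneg ht.1]
      calc t * ‖Q x - x‖ ≤ 1 * (θ * ‖x‖) :=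
            mul_le_mul ht.2 (hQ x) (norm_nonneg _) zero_le_one
        _ ≤ 1 / 4 * ‖x‖ := by
            rw [one_mul]
            gcongr
    have h2 := norm_sub_le (x + t • (Q x - x)) (t • (Q x - x))
    rw [add_sub_cancel_right] at h2
    dsimp only
    linarith
  · have h : segment ℝ x (Q x) ⊆ closedBall 0 ‖x‖ :=
      (convex_closedBall 0 ‖x‖).segment_subset (by simp) (by simp)
    simpa using h hz

lemma norm_fderiv_fderiv (v : Euc n → ℝ) (x : Euc n) :
    ‖fderiv ℝ (fderiv ℝ v) x‖ = ‖iteratedFDeriv ℝ 2 v x‖ := by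
  rw [← norm_iteratedFDeriv_one, norm_iteratedFDeriv_fderiv]

lemma ExtSetting.Bounds.ul_rotation (hB : S.Bounds C ρ) (hQ : ∀ ξ, ‖Q ξ - ξ‖ ≤ θ * ‖ξ‖)
    (hθ : θ ≤ 1 / 4) (hρ : 2 * ρ ≤ ‖x‖) : |S.ul (Q x) - S.ul x| ≤ C * (θ * ‖x‖) := by
  have h1 := hB.R₀_le
  have h2 := hB.one_le_radius
  refine ((convex_segment x (Q x)).norm_image_sub_le_of_norm_fderiv_le (𝕜 := ℝ) (f := S.ul)
    (C := C) (fun z hz => ?_) (fun z hz => ?_) (left_mem_segment ℝ _ _)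
    (right_mem_segment ℝ _ _)).trans
    (mul_le_mul_of_nonneg_left (hQ x) (by linarith [hB.one_le]))
  all_goals have hz' := (norm_mem_segment_rotation hQ hθ hz).1
  · exact (S.contDiffAt_ul (S.notMem_K (by linarith))).differentiableAt (by simp)
  · exact hB.grad z (by linarith)

lemma IsSol.rotation (hB : S.Bounds C ρ) (hu : IsSol S R u) (hQ : ∀ ξ, ‖Q ξ - ξ‖ ≤ θ * ‖ξ‖)
    (hθ : θ ≤ 1 / 4) (hρ : 4 * ρ ≤ ‖x‖) (hR : ‖x‖ < R) :
    |u (Q x) - u x| ≤ 20 * C * (θ * ‖x‖) := by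
  have h1 := hB.R₀_le
  have h2 := hB.one_le_radius
  refine ((convex_segment x (Q x)).norm_image_sub_le_of_norm_fderiv_le (𝕜 := ℝ) (f := u)
    (C := 20 * C) (fun z hz => ?_) (fun z hz => ?_) (left_mem_segment ℝ _ _)
    (right_mem_segment ℝ _ _)).trans
    (mul_le_mul_of_nonneg_left (hQ x) (by linarith [hB.one_le]))
  all_goals have hz' := norm_mem_segment_rotation hQ hθ hz
  · exact (hu.hasFDerivAt (mem_ball_diff_of_norm (by linarith) (by linarith))).differentiableAt
  · exact hu.norm_fderiv_le hB (by linarith) (by linarith)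

lemma ExtSetting.Bounds.fderiv_ul_rotation (hB : S.Bounds C ρ)
    (hQ : ∀ ξ, ‖Q ξ - ξ‖ ≤ θ * ‖ξ‖) (hθ0 : 0 ≤ θ) (hθ : θ ≤ 1 / 4) (hρ : 2 * ρ ≤ ‖x‖)
    (ξ : Euc n) : |fderiv ℝ S.ul (Q x) (Q ξ) - fderiv ℝ S.ul x ξ| ≤ 3 * C * θ * ‖ξ‖ := by
  have h1 := hB.R₀_le
  have h2 := hB.one_le_radius
  have hC := hB.one_le
  have hx0 : 0 < ‖x‖ := by linarith
  have h3 : ‖fderiv ℝ S.ul (Q x) - fderiv ℝ S.ul x‖ ≤ C / (3 / 4 * ‖x‖) * (θ * ‖x‖) := by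
    refine ((convex_segment x (Q x)).norm_image_sub_le_of_norm_fderiv_le (𝕜 := ℝ)
      (fun z hz => ?_) (fun z hz => ?_) (left_mem_segment ℝ _ _)
    (right_mem_segment ℝ _ _)).trans
      (mul_le_mul_of_nonneg_left (hQ x) (by positivity))
    all_goals have hz' := (norm_mem_segment_rotation hQ hθ hz).1
    · exact ((S.contDiffAt_ul (S.notMem_K (by linarith))).fderiv_right
        (m := 1) (nat_le_infty 2)).differentiableAt (by simp)
    · rw [norm_fderiv_fderiv]
      exact (hB.hess z (by linarith)).trans (by gcongr)
  have h4 : C / (3 / 4 * ‖x‖) * (θ * ‖x‖) ≤ 2 * C * θ := by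
    rw [div_mul_eq_mul_div, div_le_iff₀ (by positivity)]
    nlinarith [mul_nonneg (mul_nonneg (by linarith : 0 ≤ C) hθ0) hx0.le]
  have e : fderiv ℝ S.ul (Q x) (Q ξ) - fderiv ℝ S.ul x ξ
      = (fderiv ℝ S.ul (Q x) - fderiv ℝ S.ul x) (Q ξ) + fderiv ℝ S.ul x (Q ξ - ξ) := by
    simp
  rw [e]
  have h5 := ContinuousLinearMap.le_of_opNorm_le _ (h3.trans h4) (Q ξ)
  have h6 := ContinuousLinearMap.le_of_opNorm_le _ (hB.grad x (by linarith)) (Q ξ - ξ)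
  have h7 : C * ‖Q ξ - ξ‖ ≤ C * (θ * ‖ξ‖) := by gcongr; exact hQ ξ
  rw [Q.norm_map] at h5
  refine (abs_add_le _ _).trans ?_
  simp only [Real.norm_eq_abs] at h5 h6
  linarith

lemma ExtSetting.Bounds.hessForm_ul_rotation (hB : S.Bounds C ρ)
    (hQ : ∀ ξ, ‖Q ξ - ξ‖ ≤ θ * ‖ξ‖) (hθ0 : 0 ≤ θ) (hθ : θ ≤ 1 / 4) (hρ : 2 * ρ ≤ ‖x‖)
    (ξ : Euc n) :
    hessForm S.ul (Q x) (Q ξ) - hessForm S.ul x ξ ≤ 4 * C * θ / ‖x‖ * ‖ξ‖ ^ 2 := by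
  have h1 := hB.R₀_le
  have h2 := hB.one_le_radius
  have hC := hB.one_le
  have hx0 : 0 < ‖x‖ := by linarith
  have h3 : ‖iteratedFDeriv ℝ 2 S.ul (Q x) - iteratedFDeriv ℝ 2 S.ul x‖
      ≤ C / (3 / 4 * ‖x‖) ^ 2 * (θ * ‖x‖) := by
    refine ((convex_segment x (Q x)).norm_image_sub_le_of_norm_fderiv_le (𝕜 := ℝ)
      (fun z hz => ?_) (fun z hz => ?_) (left_mem_segment ℝ _ _)
    (right_mem_segment ℝ _ _)).trans
      (mul_le_mul_of_nonneg_left (hQ x) (by positivity))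
    all_goals have hz' := (norm_mem_segment_rotation hQ hθ hz).1
    · exact ((S.contDiffAt_ul (S.notMem_K (by linarith))).iteratedFDeriv_right
        (m := 1) (i := 2) (nat_le_infty 3)).differentiableAt (by simp)
    · rw [norm_fderiv_iteratedFDeriv]
      exact (hB.third z (by linarith)).trans (by gcongr)
  have h4 : C / (3 / 4 * ‖x‖) ^ 2 * (θ * ‖x‖) ≤ 2 * C * θ / ‖x‖ := by
    rw [div_mul_eq_mul_div, div_le_div_iff₀ (by positivity) hx0]
    nlinarith [mul_nonneg (mul_nonneg (by linarith : 0 ≤ C) hθ0) (sq_nonneg ‖x‖)]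
  have hb : ∀ a b : Euc n, iteratedFDeriv ℝ 2 S.ul x ![a, b]
      = fderiv ℝ (fderiv ℝ S.ul) x a b := fun a b => by rw [iteratedFDeriv_two_apply]; rfl
  have e : hessForm S.ul (Q x) (Q ξ) - hessForm S.ul x ξ
      = (iteratedFDeriv ℝ 2 S.ul (Q x) - iteratedFDeriv ℝ 2 S.ul x) ![Q ξ, Q ξ]
        + (iteratedFDeriv ℝ 2 S.ul x ![Q ξ - ξ, Q ξ] + iteratedFDeriv ℝ 2 S.ul x ![ξ, Q ξ - ξ]) := by
    rw [sub_apply, hb, hb, hb, hessForm, hessForm, hb ξ ξ]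
    simp
  rw [e]
  have h5 := ContinuousMultilinearMap.le_of_opNorm_le (h3.trans h4) ![Q ξ, Q ξ]
  have h6 := ContinuousMultilinearMap.le_of_opNorm_le (hB.hess x (by linarith)) ![Q ξ - ξ, Q ξ]
  have h7 := ContinuousMultilinearMap.le_of_opNorm_le (hB.hess x (by linarith)) ![ξ, Q ξ - ξ]
  simp only [Fin.prod_univ_two, Matrix.cons_val_zero, Matrix.cons_val_one, Q.norm_map] at h5 h6 h7
  have h8 : C / ‖x‖ * (‖Q ξ - ξ‖ * ‖ξ‖) ≤ C / ‖x‖ * (θ * ‖ξ‖ * ‖ξ‖) := by gcongr; exact hQ ξ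
  have h9 : C / ‖x‖ * (‖ξ‖ * ‖Q ξ - ξ‖) ≤ C / ‖x‖ * (‖ξ‖ * (θ * ‖ξ‖)) := by gcongr; exact hQ ξ
  refine (le_of_abs_le ((abs_add_le _ _).trans (add_le_add h5 ((abs_add_le _ _).trans
    (add_le_add (h6.trans h8) (h7.trans h9)))))).trans (le_of_eq ?_)
  ring

lemma ExtSetting.Bounds.log_f_rotation (hB : S.Bounds C ρ)
    (hQ : ∀ ξ, ‖Q ξ - ξ‖ ≤ θ * ‖ξ‖) (hθ : θ ≤ 1 / 4) (hρ : 2 * ρ ≤ ‖x‖) {z z' δ : ℝ}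
    (hz : |z' - z| ≤ δ) (hxδ : θ * ‖x‖ ≤ δ) :
    Real.log (S.f x z) - C * δ ≤ Real.log (S.f (Q x) z') := by
  have h1 := hB.R₀_le
  have h2 := hB.one_le_radius
  have hC := hB.one_le
  have hseg : ∀ p ∈ segment ℝ ((x, z) : Euc n × ℝ) (Q x, z'), p.1 ∉ S.K := fun p hp => by
    have hp1 : p.1 ∈ segment ℝ x (Q x) := by
      obtain ⟨a, b, ha, hb, hab, rfl⟩ := hp
      exact ⟨a, b, ha, hb, hab, rfl⟩
    exact S.notMem_K (by linarith [(norm_mem_segment_rotation hQ hθ hp1).1])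
  have hd : ∀ p ∈ segment ℝ ((x, z) : Euc n × ℝ) (Q x, z'),
      DifferentiableAt ℝ (fun q : Euc n × ℝ => S.f q.1 q.2) p := fun p hp =>
    (S.hfsm.contDiffAt (prod_mem_nhds (S.compl_mem_nhds (hseg p hp)) univ_mem)).differentiableAt
      (by simp)
  have hpos : ∀ p ∈ segment ℝ ((x, z) : Euc n × ℝ) (Q x, z'), 0 < S.f p.1 p.2 := fun p hp =>
    S.hfpos _ (fun h => hseg p hp (interior_subset h)) _
  have h3 : ‖Real.log (S.f (Q x) z') - Real.log (S.f x z)‖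
      ≤ C * ‖((Q x, z') - (x, z) : Euc n × ℝ)‖ :=
    (convex_segment ((x, z) : Euc n × ℝ) (Q x, z')).norm_image_sub_le_of_norm_fderiv_le (𝕜 := ℝ)
      (f := fun q : Euc n × ℝ => Real.log (S.f q.1 q.2)) (C := C)
      (fun p hp => (hd p hp).log (hpos p hp).ne') (fun p hp => by
        rw [fderiv.log (hd p hp) (hpos p hp).ne', norm_smul, norm_inv,
          Real.norm_of_nonneg (hpos p hp).le, inv_mul_le_iff₀ (hpos p hp), mul_comm]
        exact hB.f_grad p.1 (hseg p hp) p.2)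
      (left_mem_segment ℝ _ _) (right_mem_segment ℝ _ _)
  have h4 : ‖((Q x, z') - (x, z) : Euc n × ℝ)‖ ≤ δ :=
    max_le ((hQ x).trans hxδ) hz
  have h5 := (abs_le.1 h3).1
  nlinarith

end Rotation

/-! ### The barrier -/

section Barrier

variable {n : ℕ} {S : ExtSetting n} {R C ρ θ κ : ℝ} {u : Euc n → ℝ} {Q : Euc n →ₗᵢ[ℝ] Euc n}
  {x : Euc n}

/-- The radial part `σ - κ σ²`, `σ = 1 - |x|²/R²`, of the barrier. -/
def collar (R κ : ℝ) (x : Euc n) : ℝ :=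
  (R ^ 2 - ‖x‖ ^ 2) / R ^ 2 - κ * ((R ^ 2 - ‖x‖ ^ 2) / R ^ 2) ^ 2

lemma continuous_collar : Continuous (collar R κ : Euc n → ℝ) := by
  unfold collar
  fun_prop

lemma collar_nonneg (hκ : 0 < κ) (h0 : 0 ≤ (R ^ 2 - ‖x‖ ^ 2) / R ^ 2)
    (h1 : (R ^ 2 - ‖x‖ ^ 2) / R ^ 2 ≤ 1 / (4 * κ)) : 0 ≤ collar R κ x := by
  rw [le_div_iff₀ (by positivity)] at h1
  unfold collar
  nlinarith

lemma hasJet_collar (x ξ : Euc n) : HasJet (fun t : ℝ => collar R κ (x + t • ξ))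
    (-(2 * ⟪x, ξ⟫ / R ^ 2 * (1 - 2 * κ * ((R ^ 2 - ‖x‖ ^ 2) / R ^ 2))))
    (-(2 * ‖ξ‖ ^ 2 / R ^ 2 * (1 - 2 * κ * ((R ^ 2 - ‖x‖ ^ 2) / R ^ 2)))
      - 8 * κ * ⟪x, ξ⟫ ^ 2 / R ^ 4) := by
  have h := hasJet_quadratic ((R ^ 2 - ‖x‖ ^ 2) / R ^ 2) (-(2 * ⟪x, ξ⟫ / R ^ 2))
    (-(‖ξ‖ ^ 2 / R ^ 2))
  have h2 := h.sub (h.sq.const_mul κ)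
  convert h2 using 1
  · funext t
    have : ‖x + t • ξ‖ ^ 2 = ‖x‖ ^ 2 + 2 * t * ⟪x, ξ⟫ + t ^ 2 * ‖ξ‖ ^ 2 := by
      rw [norm_add_sq_real, real_inner_smul_right, norm_smul, mul_pow, Real.norm_eq_abs, sq_abs]
      ring
    rw [collar, this]
    ring
  · simp only [mul_zero, add_zero]
    ring
  · simp only [mul_zero, add_zero]
    ring

lemma log_det_radialMatrix (hn : 1 ≤ n) {a b : ℝ} (ha : 0 < a) (hb : 0 < b) {ν : Fin n → ℝ}
    (hν : ν ⬝ᵥ ν = 1) :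
    Real.log (radialMatrix a b ν).det = ((n : ℝ) - 1) * Real.log a + Real.log b := by
  obtain ⟨m, rfl⟩ : ∃ m, n = m + 1 := ⟨n - 1, by omega⟩
  rw [radialMatrix_det ha.ne' b hν, Real.log_mul (by positivity) hb.ne', Real.log_pow]
  push_cast
  ring

/-- The equation bounds the Hessian determinant near the outer boundary. -/
lemma IsSol.log_det_le (hB : S.Bounds C ρ) (hu : IsSol S R u) (hR : 4 * ρ ≤ R)
    (hx : R / 2 ≤ ‖x‖) (hxR : ‖x‖ < R) :
    Real.log (Hess u x).det ≤ Real.log C + ((n : ℝ) + 1) * Real.log 2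
      + ((n : ℝ) + 2) / 2 * Real.log (1 + (20 * C) ^ 2) - ((n : ℝ) + 1) * Real.log R := by
  have h1 := hB.R₀_le
  have h2 := hB.one_le_radius
  have hC := hB.one_le
  have hR0 : 0 < R := by linarith
  have hxi : x ∈ ball (0 : Euc n) R \ S.K := mem_ball_diff_of_norm (by linarith) hxR
  rw [hu.log_det hxi]
  have h3 : Real.log (S.f x (u x)) ≤ Real.log (C / (R / 2) ^ (n + 1)) :=
    Real.log_le_log (S.hfpos x (fun h => hxi.2 (interior_subset h)) _)
      ((hB.f_le x (by linarith) _).trans (by gcongr))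
  rw [Real.log_div (by positivity) (by positivity), Real.log_pow,
    Real.log_div (by linarith) (by norm_num)] at h3
  have h4 : Real.log (1 + ‖fderiv ℝ u x‖ ^ 2) ≤ Real.log (1 + (20 * C) ^ 2) := by
    refine Real.log_le_log (by positivity) ?_
    gcongr
    exact hu.norm_fderiv_le hB (by linarith) hxR
  have h5 : ((n : ℝ) + 2) / 2 * Real.log (1 + ‖fderiv ℝ u x‖ ^ 2)
      ≤ ((n : ℝ) + 2) / 2 * Real.log (1 + (20 * C) ^ 2) := by gcongr
  push_cast at h3
  linarith

/-- The difference of a solution and its rotation, compared with the barrier. -/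
def rotDefect (S : ExtSetting n) (u : Euc n → ℝ) (Q : Euc n →ₗᵢ[ℝ] Euc n) (R κ η : ℝ)
    (x : Euc n) : ℝ :=
  u (Q x) - u x - (S.ul (Q x) - S.ul x) - η * (u x - S.ul x) - η * collar R κ x

lemma hasJet_rotDefect {η : ℝ} (hu : IsSol S R u) (hx : x ∈ ball (0 : Euc n) R \ S.K)
    (hQx : Q x ∈ ball (0 : Euc n) R \ S.K) (ξ : Euc n) :
    HasJet (fun t : ℝ => rotDefect S u Q R κ η (x + t • ξ))
      (fderiv ℝ u (Q x) (Q ξ) - fderiv ℝ u x ξ - (fderiv ℝ S.ul (Q x) (Q ξ) - fderiv ℝ S.ul x ξ)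
        - η * (fderiv ℝ u x ξ - fderiv ℝ S.ul x ξ)
        - η * -(2 * ⟪x, ξ⟫ / R ^ 2 * (1 - 2 * κ * ((R ^ 2 - ‖x‖ ^ 2) / R ^ 2))))
      (hessForm u (Q x) (Q ξ) - hessForm u x ξ - (hessForm S.ul (Q x) (Q ξ) - hessForm S.ul x ξ)
        - η * (hessForm u x ξ - hessForm S.ul x ξ)
        - η * (-(2 * ‖ξ‖ ^ 2 / R ^ 2 * (1 - 2 * κ * ((R ^ 2 - ‖x‖ ^ 2) / R ^ 2)))
          - 8 * κ * ⟪x, ξ⟫ ^ 2 / R ^ 4)) := by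
  have hu1 := hasJet_line ξ ((hu.contDiffAt hx).of_le two_le_infty)
  have hu2 := hasJet_line (Q ξ) ((hu.contDiffAt hQx).of_le two_le_infty)
  have hl1 := hasJet_line ξ ((S.contDiffAt_ul hx.2).of_le two_le_infty)
  have hl2 := hasJet_line (Q ξ) ((S.contDiffAt_ul hQx.2).of_le two_le_infty)
  have := (((hu2.sub hu1).sub (hl2.sub hl1)).sub ((hu1.sub hl1).const_mul η)).sub
    ((hasJet_collar (R := R) (κ := κ) x ξ).const_mul η)
  simpa only [rotDefect, map_add, map_smul] using this

/-- The quadratic form estimate making the barrier a strict supersolution. -/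
lemma barrier_quadratic_le {η r σ T A H : ℝ} (hC : 1 ≤ C) (hR : 32 * C ≤ R) (hκ : 16 * C ≤ κ)
    (hσ0 : 0 ≤ σ) (hκσ : κ * σ ≤ 1 / 4) (hRθ : R * θ ≤ η) (hr : R / 2 ≤ r) (hrR : r ≤ R)
    (hrsq : r ^ 2 = (1 - σ) * R ^ 2) (hθ0 : 0 ≤ θ) (hT : 0 ≤ T) (hA : 0 ≤ A)
    (hH : T / r - C / r ^ 2 * (T + A) ≤ H) :
    4 * C * θ / r * (T + A) + η * (-(2 * (T + A) / R ^ 2 * (1 - 2 * κ * σ))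
      - 8 * κ * (r ^ 2 * A) / R ^ 4) - η * H ≤ -(η * (1 / (2 * R) * T + κ / R ^ 2 * A)) := by
  have hR0 : 0 < R := by linarith
  have hr0 : 0 < r := by linarith
  have hκ0 : 0 < κ := by linarith
  have hη0 : 0 ≤ η := le_trans (by positivity) hRθ
  have h4 : 4 * C * θ / r * (T + A) ≤ η * (8 * C / R ^ 2 * (T + A)) := by
    have : 4 * C * θ / r ≤ η * (8 * C / R ^ 2) := by
      rw [← mul_div_assoc, div_le_div_iff₀ hr0 (by positivity)]
      have : R * θ * (C * R) ≤ η * (C * (2 * r)) := by gcongr; linarith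
      linarith
    calc _ ≤ η * (8 * C / R ^ 2) * (T + A) := by gcongr
      _ = _ := by ring
  have h5 : T / R - 4 * C / R ^ 2 * (T + A) ≤ H := by
    refine le_trans (sub_le_sub ?_ ?_) hH
    · gcongr
    · have : C / r ^ 2 ≤ 4 * C / R ^ 2 := by
        rw [div_le_div_iff₀ (by positivity) (by positivity)]
        have : R ^ 2 ≤ (2 * r) ^ 2 := by gcongr; linarith
        nlinarith
      gcongr
  have h6 : 0 ≤ 2 * (T + A) / R ^ 2 * (1 - 2 * κ * σ) :=
    mul_nonneg (by positivity) (by linarith)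
  have hσ1 : σ ≤ 1 / 4 := by nlinarith
  have h7 : 6 * (κ * A / R ^ 2) ≤ 8 * κ * (r ^ 2 * A) / R ^ 4 := by
    have e : 8 * κ * (r ^ 2 * A) / R ^ 4 = 8 * (1 - σ) * (κ * A / R ^ 2) := by
      rw [hrsq]
      field_simp
    rw [e]
    gcongr
    linarith
  have h8 : 12 * C / R ^ 2 * T ≤ 1 / (2 * R) * T := by
    gcongr ?_ * T
    rw [div_le_div_iff₀ (by positivity) (by positivity)]
    nlinarith
  have h9 : 12 * C / R ^ 2 * A ≤ κ * A / R ^ 2 := by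
    rw [div_mul_eq_mul_div]
    gcongr
    linarith
  have e4 : T / R = 2 * (1 / (2 * R) * T) := by field_simp
  have e5 : 12 * C / R ^ 2 * T + 12 * C / R ^ 2 * A
    = 8 * C / R ^ 2 * (T + A) + 4 * C / R ^ 2 * (T + A) := by ring
  have e7 : κ / R ^ 2 * A = κ * A / R ^ 2 := by ring
  have h10 : 0 ≤ κ * A / R ^ 2 := by positivity
  have hmain : 8 * C / R ^ 2 * (T + A) - H
      + (-(2 * (T + A) / R ^ 2 * (1 - 2 * κ * σ)) - 8 * κ * (r ^ 2 * A) / R ^ 4)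
      ≤ -(1 / (2 * R) * T + κ / R ^ 2 * A) := by linarith
  have := mul_le_mul_of_nonneg_left hmain hη0
  linarith

lemma abs_le_of_rotDefect_critical {η p P l L c m N : ℝ} (hC : 1 ≤ C) (hm : 0 ≤ m) (hη : 0 ≤ η)
    (hθ : θ ≤ η) (hL : |L - l| ≤ 3 * C * θ * m) (hP : |P| ≤ N * m) (hp : |p| ≤ 20 * C * m)
    (hl : |l| ≤ C * m) (hc : |c| ≤ 2 * C * m)
    (h : P - p - (L - l) - η * (p - l) + η * c = 0) : |p| ≤ (N + 26 * C * η) * m := by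
  have g1 : 3 * C * θ * m ≤ 3 * C * η * m := by gcongr
  have g2 : |η * (p - l - c)| ≤ η * (23 * C * m) := by
    rw [abs_mul, abs_of_nonneg hη]
    gcongr
    rw [abs_le] at *
    constructor <;> linarith
  rw [abs_le] at *
  constructor <;> linarith

set_option maxHeartbeats 1000000 in
/-- A positive interior maximum of the defect is incompatible with the equation. -/
lemma IsSol.not_isLocalMax_rotDefect {A : ℝ} (hB : S.Bounds C ρ) (hu : IsSol S R u)
    (hR : 32 * C + 8 * ρ ≤ R) (hκ : 16 * C ≤ κ) (hA : 1 ≤ A)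
    (hκlog : Real.log C + ((n : ℝ) + 1) * Real.log 2
      + ((n : ℝ) + 2) / 2 * Real.log (1 + (20 * C) ^ 2) + ((n : ℝ) - 1) * Real.log 2
      + (C ^ 2 + 26 * (n + 2) * C) < Real.log κ)
    (hθ0 : 0 < θ) (hθ : θ ≤ 1 / 4) (hQ : ∀ ξ, ‖Q ξ - ξ‖ ≤ θ * ‖ξ‖) (hxR : ‖x‖ < R)
    (hσ : (R ^ 2 - ‖x‖ ^ 2) / R ^ 2 ≤ 1 / (4 * κ))
    (hpos : 0 < rotDefect S u Q R κ (A * R * θ) x) :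
    ¬ IsLocalMax (rotDefect S u Q R κ (A * R * θ)) x := by
  intro hmax
  have hρ1 := hB.R₀_le
  have hρ := hB.one_le_radius
  have hC := hB.one_le
  have hR0 : 0 < R := by linarith
  have hκ0 : 0 < κ := by linarith
  obtain ⟨η, hη⟩ : ∃ η, η = A * R * θ := ⟨_, rfl⟩
  rw [← hη] at hpos hmax
  have hη0 : 0 < η := by rw [hη]; positivity
  have hRθ : R * θ ≤ η := by
    rw [hη, mul_assoc]
    exact le_mul_of_one_le_left (by positivity) hA
  have hσ0 : 0 ≤ (R ^ 2 - ‖x‖ ^ 2) / R ^ 2 :=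
    div_nonneg (by nlinarith [norm_nonneg x]) (by positivity)
  obtain ⟨σ, hσdef⟩ : ∃ σ, σ = (R ^ 2 - ‖x‖ ^ 2) / R ^ 2 := ⟨_, rfl⟩
  have hcol : 0 ≤ collar R κ x := collar_nonneg hκ0 hσ0 hσ
  have hjet := hasJet_rotDefect (κ := κ) (η := η) hu (x := x) (Q := Q)
  rw [← hσdef] at hσ0 hσ hjet
  have hκσ : κ * σ ≤ 1 / 4 := by
    rw [le_div_iff₀ (by positivity)] at hσ
    linarith
  have hxsq : ‖x‖ ^ 2 = (1 - σ) * R ^ 2 := by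
    rw [hσdef]
    field_simp
    ring
  have hσ1 : σ ≤ 1 / 4 := by nlinarith
  have hxlow : R / 2 ≤ ‖x‖ := by
    refine (pow_le_pow_iff_left₀ (by positivity) (norm_nonneg x) two_ne_zero).1 ?_
    rw [hxsq]
    nlinarith
  have hxi : x ∈ ball (0 : Euc n) R \ S.K := mem_ball_diff_of_norm (by linarith) hxR
  have hQxn : ‖Q x‖ = ‖x‖ := Q.norm_map x
  have hQxi : Q x ∈ ball (0 : Euc n) R \ S.K :=
    mem_ball_diff_of_norm (by linarith) (by linarith)
  have hcrit : ∀ ξ : Euc n, _ ∧ _ := fun ξ => by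
    have h := ((hjet hxi hQxi ξ).const_mul (-1)).of_isLocalMin (by
      have hcont : Tendsto (fun t : ℝ => x + t • ξ) (𝓝 0) (𝓝 x) := by
        have : Continuous fun t : ℝ => x + t • ξ := by fun_prop
        simpa using this.tendsto 0
      filter_upwards [hcont.eventually hmax] with t ht
      simpa using ht)
    exact h
  set ν : Euc n := ‖x‖⁻¹ • x with hν
  have hx0 : 0 < ‖x‖ := by linarith
  have hνν : ν.ofLp ⬝ᵥ ν.ofLp = 1 := by
    rw [← norm_sq_eq_dot, hν, norm_smul, norm_inv, norm_norm, inv_mul_cancel₀ hx0.ne', one_pow]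
  have hxξ : ∀ ξ : Euc n, ⟪x, ξ⟫ = ‖x‖ * (ν.ofLp ⬝ᵥ ξ.ofLp) := fun ξ => by
    rw [← inner_eq_dot, hν, real_inner_smul_left, mul_inv_cancel_left₀ hx0.ne']
  have hdet := (hu.2.1 x hxi).log_det_concave hη0.le (rotHess_posDef Q (hu.2.1 _ hQxi))
    (radialMatrix_posDef (a := 1 / (2 * R)) (b := κ / R ^ 2) (by positivity) (by positivity) hνν)
    (fun ξ => by
      have h1 := (hcrit (WithLp.toLp 2 ξ)).2
      have h2 := hB.hessForm_ul_rotation hQ hθ0.le hθ (by linarith : 2 * ρ ≤ ‖x‖)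
        (WithLp.toLp 2 ξ)
      have h3 := hB.hess_lower x (WithLp.toLp 2 ξ) (by linarith)
      rw [radialMatrix_quadratic]
      have e1 : ξ ⬝ᵥ (rotHess u Q x).mulVec ξ
        = hessForm u (Q x) (Q (WithLp.toLp 2 ξ)) := rotHess_quadratic u Q x (WithLp.toLp 2 ξ)
      have e2 : ξ ⬝ᵥ (Hess u x).mulVec ξ = hessForm u x (WithLp.toLp 2 ξ) :=
        (hessForm_eq_matrix u x (WithLp.toLp 2 ξ)).symm
      rw [e1, e2]
      rw [hxξ, norm_sq_eq_dot] at h1 h3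
      rw [norm_sq_eq_dot] at h2
      simp only at h1 h2 h3
      have hT := sub_nonneg.2 (sq_dotProduct_le hνν ξ)
      set a := ν.ofLp ⬝ᵥ ξ
      obtain ⟨T, hTdef⟩ : ∃ T, T = ξ ⬝ᵥ ξ - a ^ 2 := ⟨_, rfl⟩
      have hξξ : ξ ⬝ᵥ ξ = T + a ^ 2 := by rw [hTdef]; ring
      rw [← hTdef] at hT
      rw [hξξ] at h1 h2 h3 ⊢
      have e3 : (‖x‖ * a) ^ 2 / ‖x‖ ^ 2 = a ^ 2 := by field_simp
      rw [e3, add_sub_cancel_right] at h3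
      rw [add_sub_cancel_right]
      have := barrier_quadratic_le hC (by linarith : 32 * C ≤ R) hκ hσ0 hκσ hRθ hxlow
        hxR.le hxsq hθ0.le hT (sq_nonneg a) h3
      rw [mul_pow] at h1
      linarith)
  rw [rotHess_det, log_det_radialMatrix (by have := S.hn; omega) (by positivity) (by positivity) hνν,
    Real.log_div (by positivity) (by positivity), Real.log_div (by positivity) (by positivity),
    Real.log_mul (by positivity) (by positivity), Real.log_one, Real.log_pow] at hdet
  have hlogA := hu.log_det_le hB (by linarith) hxlow hxR
  have hupper : Real.log (Hess u (Q x)).det - Real.log (Hess u x).det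
      < -(η * (C ^ 2 + 26 * (n + 2) * C)) := by
    refine lt_of_le_of_lt hdet ?_
    rw [← mul_neg]
    refine mul_lt_mul_of_pos_left ?_ hη0
    push_cast
    linarith
  have hlower : -(η * (C ^ 2 + 26 * (n + 2) * C))
      ≤ Real.log (Hess u (Q x)).det - Real.log (Hess u x).det := by
    rw [hu.log_det hxi, hu.log_det hQxi]
    have hh := hu.ul_le (mem_of_mem_nhds (solDom_mem_nhds hxi))
    have h1 := (abs_le.1 (hB.ul_rotation hQ hθ (by linarith : 2 * ρ ≤ ‖x‖))).1
    have h2 : 0 ≤ η * (u x - S.ul x) := mul_nonneg hη0.le (by linarith)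
    have h3 : 0 ≤ η * collar R κ x := mul_nonneg hη0.le hcol
    have h4 : θ * ‖x‖ ≤ η := le_trans (by rw [mul_comm]; gcongr) hRθ
    have h5 : C * (θ * ‖x‖) ≤ C * η := by gcongr
    have h6 : u x - C * η ≤ u (Q x) := by
      unfold rotDefect at hpos
      linarith
    have hlogf := hB.log_f_rotation hQ hθ (by linarith : 2 * ρ ≤ ‖x‖) (z := u x)
      (z' := u x - C * η) (δ := C * η)
      (by rw [sub_sub_cancel_left, abs_neg, abs_of_nonneg (by positivity)])
      (h4.trans (le_mul_of_one_le_left hη0.le hC))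
    have hQc : Q x ∈ (interior S.K)ᶜ := fun h => hQxi.2 (interior_subset h)
    have hmono := Real.log_le_log (S.hfpos (Q x) hQc _) (S.hfz (Q x) hQc h6)
    have hgrad : ‖fderiv ℝ u x‖ ≤ ‖fderiv ℝ u (Q x)‖ + 26 * C * η := by
      refine ContinuousLinearMap.opNorm_le_bound _ (by positivity) fun ξ => ?_
      have g1 := (hcrit ξ).1
      have g2 := hB.fderiv_ul_rotation hQ hθ0.le hθ (by linarith : 2 * ρ ≤ ‖x‖) ξ
      have g3 := ContinuousLinearMap.le_opNorm (fderiv ℝ u (Q x)) (Q ξ)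
      have g4 := ContinuousLinearMap.le_of_opNorm_le _
        (hu.norm_fderiv_le hB (by linarith) hxR) ξ
      have g5 := ContinuousLinearMap.le_of_opNorm_le _ (hB.grad x (by linarith)) ξ
      have g6 : |2 * ⟪x, ξ⟫ / R ^ 2 * (1 - 2 * κ * σ)| ≤ 2 * C * ‖ξ‖ := by
        have k1 : |1 - 2 * κ * σ| ≤ 1 := by
          have : 0 ≤ κ * σ := by positivity
          rw [abs_le]
          constructor <;> linarith
        have k2 : |2 * ⟪x, ξ⟫ / R ^ 2| ≤ 2 * C * ‖ξ‖ := by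
          rw [abs_div, abs_mul, abs_two, abs_of_nonneg (by positivity : 0 ≤ R ^ 2),
            div_le_iff₀ (by positivity)]
          have k3 := abs_real_inner_le_norm x ξ
          have k4 : ‖x‖ * ‖ξ‖ ≤ C * R ^ 2 * ‖ξ‖ := by
            gcongr
            nlinarith
          linarith
        rw [abs_mul]
        calc _ ≤ 2 * C * ‖ξ‖ * 1 := by gcongr
          _ = _ := by ring
      rw [Q.norm_map] at g3
      have hθη : θ ≤ η := (le_mul_of_one_le_left hθ0.le (by linarith)).trans hRθ
      refine abs_le_of_rotDefect_critical hC (norm_nonneg ξ) hη0.le hθη g2 g3 g4 g5 g6 ?_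
      linarith
    have hlogg := mul_le_mul_of_nonneg_left
      (log_one_add_sq_le (norm_nonneg _) (by positivity) hgrad)
      (by positivity : (0 : ℝ) ≤ ((n : ℝ) + 2) / 2)
    linarith
  linarith

/-- Solutions are almost invariant under small rotations. -/
theorem exists_rotation_bound (hB : S.Bounds C ρ) :
    ∃ A κ R₂ : ℝ, 1 ≤ A ∧ 1 ≤ κ ∧ ∀ R, R₂ ≤ R → ∀ u, IsSol S R u → ∀ θ, 0 < θ → θ ≤ 1 / 4 →
      ∀ Q : Euc n →ₗᵢ[ℝ] Euc n, (∀ ξ, ‖Q ξ - ξ‖ ≤ θ * ‖ξ‖) → ∀ x, ‖x‖ ≤ R →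
        (R ^ 2 - ‖x‖ ^ 2) / R ^ 2 ≤ 1 / (4 * κ) →
        rotDefect S u Q R κ (A * R * θ) x ≤ 0 := by
  have hρ1 := hB.R₀_le
  have hρ := hB.one_le_radius
  have hC := hB.one_le
  have hn : (2 : ℝ) ≤ n := by exact_mod_cast S.hn
  obtain ⟨M, hM⟩ : ∃ M, M = Real.log C + ((n : ℝ) + 1) * Real.log 2
      + ((n : ℝ) + 2) / 2 * Real.log (1 + (20 * C) ^ 2) + ((n : ℝ) - 1) * Real.log 2
      + (C ^ 2 + 26 * (n + 2) * C) := ⟨_, rfl⟩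
  have hM0 : 0 ≤ M := by
    have l1 := Real.log_nonneg hC
    have l2 := Real.log_nonneg one_le_two
    have l3 : 0 ≤ Real.log (1 + (20 * C) ^ 2) := Real.log_nonneg (by nlinarith)
    have l4 : 0 ≤ ((n : ℝ) - 1) * Real.log 2 := mul_nonneg (by linarith) l2
    rw [hM]
    positivity
  obtain ⟨κ, hκ⟩ : ∃ κ, κ = Real.exp (M + 16 * C) := ⟨_, rfl⟩
  have hκlog : M < Real.log κ := by
    rw [hκ, Real.log_exp]
    linarith
  have hκC : 16 * C ≤ κ := by
    have := Real.add_one_le_exp (M + 16 * C)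
    linarith
  have hκ0 : 0 < κ := by linarith
  have hA : 1 ≤ 112 * C * κ := by nlinarith
  refine ⟨112 * C * κ, κ, 32 * C + 8 * ρ, hA, by linarith, fun R hR u hu θ hθ0 hθ Q hQ => ?_⟩
  obtain ⟨A, hAdef⟩ : ∃ A, A = 112 * C * κ := ⟨_, rfl⟩
  rw [← hAdef] at hA ⊢
  have hR0 : 0 < R := by linarith
  let D : Set (Euc n) := {x | ‖x‖ ≤ R ∧ (R ^ 2 - ‖x‖ ^ 2) / R ^ 2 ≤ 1 / (4 * κ)}
  have hDlow : ∀ x ∈ D, R / 2 ≤ ‖x‖ := fun x hx => by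
    have h1 : 1 / (4 * κ) ≤ 1 / 4 := by
      apply one_div_le_one_div_of_le <;> linarith
    have h2 := hx.2.trans h1
    rw [div_le_iff₀ (by positivity)] at h2
    refine (pow_le_pow_iff_left₀ (by positivity) (norm_nonneg x) two_ne_zero).1 ?_
    nlinarith
  have hDdom : D ⊆ solDom S R := fun x hx =>
    mem_solDom_of_norm (by linarith [hDlow x hx]) hx.1
  have hσc : Continuous fun x : Euc n => (R ^ 2 - ‖x‖ ^ 2) / R ^ 2 := by fun_prop
  have hDclosed : IsClosed D :=
    (isClosed_le continuous_norm continuous_const).inter (isClosed_le hσc continuous_const)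
  have hDcompact : IsCompact D :=
    (isCompact_solDom (S := S) (R := R)).of_isClosed_subset hDclosed hDdom
  have hQD : MapsTo Q D D := fun x hx => by
    change _ ∧ _
    rw [Q.norm_map]
    exact hx
  have hcont : ContinuousOn (rotDefect S u Q R κ (A * R * θ)) D := by
    have c1 : ContinuousOn u D := hu.1.continuousOn.mono hDdom
    have c2 : ContinuousOn S.ul D := S.hulsm.continuousOn.mono fun x hx => (hDdom hx).2
    have c3 : ContinuousOn (fun x => u (Q x)) D := c1.comp Q.continuous.continuousOn hQD
    have c4 : ContinuousOn (fun x => S.ul (Q x)) D := c2.comp Q.continuous.continuousOn hQD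
    exact (((c3.sub c1).sub (c4.sub c2)).sub (continuousOn_const.mul (c1.sub c2))).sub
      (continuousOn_const.mul continuous_collar.continuousOn)
  intro x₁ hx₁ hx₁'
  by_contra! hpos₁
  obtain ⟨x, hx, hmax⟩ := hDcompact.exists_isMaxOn ⟨x₁, hx₁, hx₁'⟩ hcont
  have hpos : 0 < rotDefect S u Q R κ (A * R * θ) x := hpos₁.trans_le (hmax ⟨hx₁, hx₁'⟩)
  have hη0 : 0 < A * R * θ := by positivity
  have hxR : ‖x‖ < R := by
    refine lt_of_le_of_ne hx.1 fun h => hpos.ne' ?_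
    have e1 := hu.2.2.2 x (Or.inl (mem_sphere_zero_iff_norm.2 h))
    have e2 := hu.2.2.2 (Q x) (Or.inl (mem_sphere_zero_iff_norm.2 (by rw [Q.norm_map, h])))
    simp [rotDefect, collar, e1, e2, h]
  have hσ : (R ^ 2 - ‖x‖ ^ 2) / R ^ 2 < 1 / (4 * κ) := by
    refine lt_of_le_of_ne hx.2 fun h => hpos.not_ge ?_
    have hlow := hDlow x hx
    have h1 := (abs_le.1 (hB.ul_rotation hQ hθ (by linarith : 2 * ρ ≤ ‖x‖))).1
    have h2 := (abs_le.1 (hu.rotation hB hQ hθ (by linarith : 4 * ρ ≤ ‖x‖) hxR)).2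
    have h3 := mul_nonneg hη0.le (sub_nonneg.2 (hu.ul_le (hDdom hx)))
    have h4 : A * R * θ * collar R κ x = 21 * C * (R * θ) := by
      rw [collar, h, hAdef]
      field_simp
      ring
    have h5 : C * (θ * ‖x‖) ≤ C * (R * θ) := by
      rw [mul_comm R]
      gcongr
    unfold rotDefect
    linarith
  have hnhds : D ∈ 𝓝 x := by
    have h1 : {y : Euc n | ‖y‖ < R ∧ (R ^ 2 - ‖y‖ ^ 2) / R ^ 2 < 1 / (4 * κ)} ∈ 𝓝 x :=
      ((isOpen_lt continuous_norm continuous_const).inter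
        (isOpen_lt hσc continuous_const)).mem_nhds ⟨hxR, hσ⟩
    exact mem_of_superset h1 fun y hy => ⟨hy.1.le, hy.2.le⟩
  exact hu.not_isLocalMax_rotDefect hB hR hκC hA (hM ▸ hκlog) hθ0 hθ hQ hxR hx.2 hpos
    (hmax.isLocalMax hnhds)

end Barrier

/-! ### Second derivatives at the outer boundary -/

section PlaneRotation

variable {n : ℕ} {ν τ : Euc n}

/-- The rotation by the angle `t` in the plane spanned by the orthonormal pair `ν`, `τ`. -/
def planeRotation (hν : ‖ν‖ = 1) (hτ : ‖τ‖ = 1) (h : ⟪ν, τ⟫ = 0) (t : ℝ) :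
    Euc n →ₗᵢ[ℝ] Euc n where
  toFun ξ := ξ + (⟪ν, ξ⟫ * (Real.cos t - 1) - ⟪τ, ξ⟫ * Real.sin t) • ν
    + (⟪ν, ξ⟫ * Real.sin t + ⟪τ, ξ⟫ * (Real.cos t - 1)) • τ
  map_add' ξ ζ := by
    simp only [inner_add_right]
    module
  map_smul' c ξ := by
    simp only [real_inner_smul_right, RingHom.id_apply]
    module
  norm_map' ξ := by
    refine (pow_left_inj₀ (norm_nonneg _) (norm_nonneg _) two_ne_zero).1 ?_
    simp only [LinearMap.coe_mk, AddHom.coe_mk]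
    rw [norm_add_sq_real, norm_add_sq_real, inner_add_left]
    simp only [real_inner_smul_right, real_inner_smul_left, norm_smul, hν, hτ, h, mul_pow,
      Real.norm_eq_abs, sq_abs, real_inner_comm ν ξ, real_inner_comm τ ξ]
    linear_combination (⟪ν, ξ⟫ ^ 2 + ⟪τ, ξ⟫ ^ 2) * Real.sin_sq_add_cos_sq t

lemma planeRotation_apply (hν : ‖ν‖ = 1) (hτ : ‖τ‖ = 1) (h : ⟪ν, τ⟫ = 0) (t : ℝ) (ξ : Euc n) :
    planeRotation hν hτ h t ξ = ξ + (⟪ν, ξ⟫ * (Real.cos t - 1) - ⟪τ, ξ⟫ * Real.sin t) • ν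
    + (⟪ν, ξ⟫ * Real.sin t + ⟪τ, ξ⟫ * (Real.cos t - 1)) • τ := rfl

lemma planeRotation_smul (hν : ‖ν‖ = 1) (hτ : ‖τ‖ = 1) (h : ⟪ν, τ⟫ = 0) (t r : ℝ) :
    planeRotation hν hτ h t (r • ν) = r • (Real.cos t • ν + Real.sin t • τ) := by
  rw [map_smul, planeRotation_apply, real_inner_self_eq_norm_sq, hν, real_inner_comm, h]
  module

lemma norm_planeRotation_sub_le (hν : ‖ν‖ = 1) (hτ : ‖τ‖ = 1) (h : ⟪ν, τ⟫ = 0) (t : ℝ)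
    (ξ : Euc n) : ‖planeRotation hν hτ h t ξ - ξ‖ ≤ 2 * |t| * ‖ξ‖ := by
  refine (pow_le_pow_iff_left₀ (norm_nonneg _) (by positivity) two_ne_zero).1 ?_
  have e : planeRotation hν hτ h t ξ - ξ
      = (⟪ν, ξ⟫ * (Real.cos t - 1) - ⟪τ, ξ⟫ * Real.sin t) • ν
        + (⟪ν, ξ⟫ * Real.sin t + ⟪τ, ξ⟫ * (Real.cos t - 1)) • τ := by
    rw [planeRotation_apply]
    abel
  have e2 : ‖planeRotation hν hτ h t ξ - ξ‖ ^ 2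
      = (⟪ν, ξ⟫ ^ 2 + ⟪τ, ξ⟫ ^ 2) * (2 - 2 * Real.cos t) := by
    rw [e, norm_add_sq_real]
    simp only [real_inner_smul_right, real_inner_smul_left, norm_smul, hν, hτ, h, mul_pow,
      Real.norm_eq_abs, sq_abs]
    linear_combination (⟪ν, ξ⟫ ^ 2 + ⟪τ, ξ⟫ ^ 2) * Real.sin_sq_add_cos_sq t
  have hle : ∀ μ : Euc n, ‖μ‖ = 1 → ⟪μ, ξ⟫ ^ 2 ≤ ‖ξ‖ ^ 2 := fun μ hμ => by
    have := abs_real_inner_le_norm μ ξ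
    rw [hμ, one_mul] at this
    exact sq_le_sq' (abs_le.1 this).1 (abs_le.1 this).2
  have h1 := hle ν hν
  have h2 := hle τ hτ
  have h3 := Real.one_sub_sq_div_two_le_cos (x := t)
  have h4 := Real.cos_le_one t
  rw [e2, mul_pow, mul_pow, sq_abs]
  calc _ ≤ (‖ξ‖ ^ 2 + ‖ξ‖ ^ 2) * t ^ 2 := by gcongr <;> linarith
    _ ≤ _ := by nlinarith [mul_nonneg (sq_nonneg t) (sq_nonneg ‖ξ‖)]

end PlaneRotation

section Annulus

variable {n : ℕ} {R : ℝ} {h : Euc n → ℝ} {x y : Euc n}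

/-- The outer half of the closed ball of radius `R`. -/
def annulus (n : ℕ) (R : ℝ) : Set (Euc n) := closedBall 0 R ∩ (closedBall 0 (R / 2))ᶜ

lemma mem_annulus : x ∈ annulus n R ↔ ‖x‖ ≤ R ∧ R / 2 < ‖x‖ := by
  simp [annulus]

lemma uniqueDiffOn_annulus (hR : 0 < R) : UniqueDiffOn ℝ (annulus n R) := by
  refine (uniqueDiffOn_convex (convex_closedBall 0 R) ?_).inter isClosed_closedBall.isOpen_compl
  exact ⟨0, ball_subset_interior_closedBall (mem_ball_self hR)⟩

lemma mem_closure_interior_annulus (hR : 0 < R) (hx : ‖x‖ = R) :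
    x ∈ closure (interior (annulus n R)) := by
  have h1 : x ∈ (closedBall (0 : Euc n) (R / 2))ᶜ ∩ closure (ball 0 R) := by
    rw [closure_ball _ hR.ne']
    simp [hx]
    linarith
  refine closure_mono ?_ (isClosed_closedBall.isOpen_compl.inter_closure h1)
  refine interior_maximal ?_ (isClosed_closedBall.isOpen_compl.inter isOpen_ball)
  exact fun z hz => ⟨ball_subset_closedBall hz.2, hz.1⟩

lemma annulus_eventuallyEq_solDom {S : ExtSetting n} (hR : 2 * S.R₀ ≤ R) (hR0 : 0 < R)
    (hx : ‖x‖ = R) : solDom S R =ᶠ[𝓝 x] annulus n R := by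
  have : (closedBall (0 : Euc n) (R / 2))ᶜ ∈ 𝓝 x :=
    isClosed_closedBall.isOpen_compl.mem_nhds (by simp [hx]; linarith)
  filter_upwards [this] with z hz
  have hz' : R / 2 < ‖z‖ := by simpa using hz
  refine propext ⟨fun h => ⟨h.1, hz⟩, fun h => ⟨h.1, fun hK => ?_⟩⟩
  exact S.notMem_K (by linarith) (interior_subset hK)

lemma annulus_subset_solDom {S : ExtSetting n} (hR : 2 * S.R₀ ≤ R) :
    annulus n R ⊆ solDom S R := fun x hx => by
  rw [mem_annulus] at hx
  exact mem_solDom_of_norm (by linarith) hx.1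

lemma norm_circle (hx : ‖x‖ = R) (hy : ‖y‖ = R) (hxy : ⟪x, y⟫ = 0) (t : ℝ) :
    ‖Real.cos t • x + Real.sin t • y‖ = R := by
  have hR : 0 ≤ R := hx ▸ norm_nonneg x
  refine (pow_left_inj₀ (norm_nonneg _) hR two_ne_zero).1 ?_
  rw [norm_add_sq_real]
  simp only [real_inner_smul_right, real_inner_smul_left, norm_smul, hx, hy, hxy, mul_pow,
    Real.norm_eq_abs, sq_abs]
  linear_combination R ^ 2 * Real.sin_sq_add_cos_sq t

lemma hasDerivAt_circle (x y : Euc n) (t : ℝ) :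
    HasDerivAt (fun t : ℝ => Real.cos t • x + Real.sin t • y)
      (-Real.sin t • x + Real.cos t • y) t :=
  ((Real.hasDerivAt_cos t).smul_const x).add ((Real.hasDerivAt_sin t).smul_const y)

lemma mem_annulus_of_norm_eq (hR : 0 < R) (hx : ‖x‖ = R) : x ∈ annulus n R :=
  mem_annulus.2 ⟨hx.le, by linarith⟩

lemma hasFDerivWithinAt_annulus (hh : ContDiffOn ℝ (⊤ : ℕ∞) h (annulus n R))
    (hx : x ∈ annulus n R) :
    HasFDerivWithinAt h (fderivWithin ℝ h (annulus n R) x) (annulus n R) x :=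
  (hh.differentiableOn (by simp) x hx).hasFDerivWithinAt

lemma hasFDerivWithinAt_fderivWithin_annulus (hR : 0 < R)
    (hh : ContDiffOn ℝ (⊤ : ℕ∞) h (annulus n R)) (hx : x ∈ annulus n R) :
    HasFDerivWithinAt (fderivWithin ℝ h (annulus n R))
      (fderivWithin ℝ (fderivWithin ℝ h (annulus n R)) (annulus n R) x) (annulus n R) x :=
  ((hh.fderivWithin (m := 1) (uniqueDiffOn_annulus hR) two_le_infty).differentiableOn
    (by simp) x hx).hasFDerivWithinAt

/-- Tangential derivatives of a function vanishing on the sphere vanish. -/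
lemma fderivWithin_circle_eq_zero (hR : 0 < R) (hh : ContDiffOn ℝ (⊤ : ℕ∞) h (annulus n R))
    (h0 : ∀ z, ‖z‖ = R → h z = 0) (hx : ‖x‖ = R) (hy : ‖y‖ = R) (hxy : ⟪x, y⟫ = 0) (t : ℝ) :
    fderivWithin ℝ h (annulus n R) (Real.cos t • x + Real.sin t • y)
      (-Real.sin t • x + Real.cos t • y) = 0 := by
  have hm : ∀ t, Real.cos t • x + Real.sin t • y ∈ annulus n R := fun t =>
    mem_annulus_of_norm_eq hR (norm_circle hx hy hxy t)
  have h1 := (hasFDerivWithinAt_annulus hh (hm t)).comp_hasDerivAt t (hasDerivAt_circle x y t)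
    (Eventually.of_forall hm)
  refine h1.unique ((hasDerivAt_const t (0 : ℝ)).congr_of_eventuallyEq ?_)
  exact Eventually.of_forall fun s => h0 _ (norm_circle hx hy hxy s)

lemma hasDerivAt_fderivWithin_circle (hR : 0 < R) (hh : ContDiffOn ℝ (⊤ : ℕ∞) h (annulus n R))
    (hx : ‖x‖ = R) (hy : ‖y‖ = R) (hxy : ⟪x, y⟫ = 0) :
    HasDerivAt (fun t : ℝ => fderivWithin ℝ h (annulus n R) (Real.cos t • x + Real.sin t • y))
      (fderivWithin ℝ (fderivWithin ℝ h (annulus n R)) (annulus n R) x y) 0 := by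
  have hm : ∀ t, Real.cos t • x + Real.sin t • y ∈ annulus n R := fun t =>
    mem_annulus_of_norm_eq hR (norm_circle hx hy hxy t)
  have h1 := hasFDerivWithinAt_fderivWithin_annulus hR hh (mem_annulus_of_norm_eq hR hx)
  have h2 := hasDerivAt_circle x y 0
  simp only [Real.sin_zero, Real.cos_zero, neg_zero, zero_smul, one_smul, zero_add] at h2
  exact h1.comp_hasDerivAt_of_eq 0 h2 (Eventually.of_forall hm) (by simp)

/-- Second tangential derivatives of a function vanishing on the sphere. -/
lemma hess_tangential (hR : 0 < R) (hh : ContDiffOn ℝ (⊤ : ℕ∞) h (annulus n R))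
    (h0 : ∀ z, ‖z‖ = R → h z = 0) (hx : ‖x‖ = R) (hy : ‖y‖ = R) (hxy : ⟪x, y⟫ = 0) :
    fderivWithin ℝ (fderivWithin ℝ h (annulus n R)) (annulus n R) x y y
      = fderivWithin ℝ h (annulus n R) x x := by
  have h1 : HasDerivAt (fun t : ℝ => -Real.sin t • x + Real.cos t • y) (-x) 0 := by
    have := hasDerivAt_circle y (-x) 0
    simp only [Real.sin_zero, Real.cos_zero, neg_zero, zero_smul, one_smul, zero_add] at this
    convert this using 2 with t
    module
  have h2 := (hasDerivAt_fderivWithin_circle hR hh hx hy hxy).clm_apply h1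
  simp only [fderivWithin_circle_eq_zero hR hh h0 hx hy hxy] at h2
  have := h2.unique (hasDerivAt_const 0 (0 : ℝ))
  simp only [Real.sin_zero, Real.cos_zero, neg_zero, zero_smul, one_smul, zero_add, add_zero,
    map_neg] at this
  linarith

/-- The mixed second derivative is the tangential derivative of the normal derivative. -/
lemma hasDerivAt_normal_circle (hR : 0 < R) (hh : ContDiffOn ℝ (⊤ : ℕ∞) h (annulus n R))
    (h0 : ∀ z, ‖z‖ = R → h z = 0) (hx : ‖x‖ = R) (hy : ‖y‖ = R) (hxy : ⟪x, y⟫ = 0) :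
    HasDerivAt (fun t : ℝ => fderivWithin ℝ h (annulus n R) (Real.cos t • x + Real.sin t • y)
      (Real.cos t • x + Real.sin t • y))
      (fderivWithin ℝ (fderivWithin ℝ h (annulus n R)) (annulus n R) x y x) 0 := by
  have h1 := fderivWithin_circle_eq_zero hR hh h0 hx hy hxy 0
  have h2 := (hasDerivAt_fderivWithin_circle hR hh hx hy hxy).clm_apply (hasDerivAt_circle x y 0)
  rw [h1, add_zero] at h2
  simpa using h2

/-- The derivative along the inner normal at a point of the outer sphere. -/
lemma hasDerivWithinAt_radial (hR : 0 < R) (hh : ContDiffOn ℝ (⊤ : ℕ∞) h (annulus n R))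
    (hx : ‖x‖ = R) :
    HasDerivWithinAt (fun s : ℝ => h ((1 - s) • x)) (-fderivWithin ℝ h (annulus n R) x x)
      (Ioo 0 (1 / 2)) 0 := by
  have h1 : HasDerivWithinAt (fun s : ℝ => (1 - s) • x) (-x) (Ioo 0 (1 / 2)) 0 := by
    simpa using (((hasDerivAt_id' (0 : ℝ)).const_sub 1).smul_const x).hasDerivWithinAt
  have h2 := (hasFDerivWithinAt_annulus hh (mem_annulus_of_norm_eq hR hx))
  have h3 := HasFDerivWithinAt.comp_hasDerivWithinAt (f := fun s : ℝ => (1 - s) • x) 0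
    (by simpa using h2) h1 (fun s hs => mem_annulus.2 (by
      rw [norm_smul, Real.norm_eq_abs, abs_of_pos (by linarith [hs.2]), hx]
      constructor <;> nlinarith [hs.1, hs.2]))
  rw [map_neg] at h3
  exact h3

end Annulus

lemma nonpos_of_hasDerivWithinAt {φ : ℝ → ℝ} {d δ : ℝ} (hδ : 0 < δ)
    (h : HasDerivWithinAt φ d (Ioo 0 δ) 0) (h0 : φ 0 = 0) (hle : ∀ᶠ s in 𝓝[>] 0, φ s ≤ 0) :
    d ≤ 0 := by
  rw [hasDerivWithinAt_iff_tendsto_slope' (by simp), nhdsWithin_Ioo_eq_nhdsGT hδ] at h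
  refine le_of_tendsto h ?_
  filter_upwards [hle, self_mem_nhdsWithin] with s hs hs0
  rw [slope_def_field, h0, sub_zero, sub_zero]
  exact div_nonpos_of_nonpos_of_nonneg hs (le_of_lt hs0)

lemma abs_deriv_le_of_sub_le {φ : ℝ → ℝ} {d c : ℝ} (h : HasDerivAt φ d 0)
    (hle : ∀ᶠ t in 𝓝[≠] (0 : ℝ), φ 0 - φ t ≤ c * |t|) : |d| ≤ c := by
  have h' := hasDerivAt_iff_tendsto_slope.1 h
  rw [abs_le]
  constructor
  · refine ge_of_tendsto (h'.mono_left (nhdsGT_le_nhdsNE 0)) ?_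
    filter_upwards [hle.filter_mono (nhdsGT_le_nhdsNE 0), self_mem_nhdsWithin]
      with t ht (ht0 : 0 < t)
    rw [slope_def_field, sub_zero, le_div_iff₀ ht0]
    rw [abs_of_pos ht0] at ht
    linarith
  · refine le_of_tendsto (h'.mono_left (nhdsLT_le_nhdsNE 0)) ?_
    filter_upwards [hle.filter_mono (nhdsLT_le_nhdsNE 0), self_mem_nhdsWithin]
      with t ht (ht0 : t < 0)
    rw [slope_def_field, sub_zero, div_le_iff_of_neg ht0]
    rw [abs_of_neg ht0] at ht
    linarith

section Boundary

variable {n : ℕ} {S : ExtSetting n} {R C ρ A κ : ℝ} {u : Euc n → ℝ} {x y : Euc n}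

lemma ExtSetting.contDiffOn_ul_annulus (S : ExtSetting n) (hR : 2 * S.R₀ ≤ R) :
    ContDiffOn ℝ (⊤ : ℕ∞) S.ul (annulus n R) :=
  S.hulsm.mono fun _ hx => (annulus_subset_solDom hR hx).2

lemma IsSol.contDiffOn_annulus (hu : IsSol S R u) (hR : 2 * S.R₀ ≤ R) :
    ContDiffOn ℝ (⊤ : ℕ∞) u (annulus n R) :=
  hu.1.mono (annulus_subset_solDom hR)

lemma IsSol.contDiffOn_sub (hu : IsSol S R u) (hR : 2 * S.R₀ ≤ R) :
    ContDiffOn ℝ (⊤ : ℕ∞) (u - S.ul) (annulus n R) :=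
  (hu.contDiffOn_annulus hR).sub (S.contDiffOn_ul_annulus hR)

lemma IsSol.sub_eq_zero (hu : IsSol S R u) (hx : ‖x‖ = R) : (u - S.ul) x = 0 := by
  rw [Pi.sub_apply, hu.2.2.2 x (Or.inl (mem_sphere_zero_iff_norm.2 hx)), _root_.sub_self]

/-- The normal derivative of `u - u̲` on the outer sphere is bounded from below. -/
lemma IsSol.normal_deriv_sub_ge (hB : S.Bounds C ρ) (hu : IsSol S R u) (hR : 2 * ρ ≤ R)
    (hx : ‖x‖ = R) : -(5 * C) ≤ fderivWithin ℝ (u - S.ul) (annulus n R) x x := by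
  have h1 := hB.R₀_le
  have h2 := hB.one_le_radius
  have hR0 : 0 < R := by linarith
  have hxa := mem_annulus_of_norm_eq hR0 hx
  have h3 := hasFDerivWithinAt_annulus (hu.contDiffOn_sub (by linarith)) hxa
  have h4 : HasFDerivWithinAt S.ul (fderiv ℝ S.ul x) (annulus n R) x :=
    ((S.contDiffAt_ul (S.notMem_K (by linarith))).differentiableAt
      (by simp)).hasFDerivAt.hasFDerivWithinAt
  have h5 := h3.add h4
  rw [sub_add_cancel, ← hasFDerivWithinAt_congr_set
    (annulus_eventuallyEq_solDom (S := S) (by linarith) hR0 hx)] at h5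
  have h6 := hu.normal_deriv_ge hB hR hx h5
  have h7 := (abs_le.1 (hB.radial x (by linarith))).2
  rw [add_apply] at h6
  linarith

lemma hasDerivAt_collar_radial (hR : 0 < R) (hx : ‖x‖ = R) :
    HasDerivAt (fun s : ℝ => collar R κ ((1 - s) • x)) 2 0 := by
  have h1 := (hasJet_collar (R := R) (κ := κ) x (-x))
  obtain ⟨φ, h2, h3, -⟩ := h1
  have h4 := h2.self_of_nhds
  rw [h3] at h4
  convert h4 using 1
  · funext s
    congr 1
    module
  · rw [inner_neg_right, real_inner_self_eq_norm_sq, hx]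
    field_simp
    ring

/-- The normal derivative of `u - u̲` is almost invariant under rotations. -/
lemma IsSol.normal_deriv_sub_circle_le (hB : S.Bounds C ρ) (hu : IsSol S R u) (hR : 2 * ρ ≤ R)
    (hA : 1 ≤ A) (hκ : 1 ≤ κ)
    (hrot : ∀ θ, 0 < θ → θ ≤ 1 / 4 → ∀ Q : Euc n →ₗᵢ[ℝ] Euc n, (∀ ξ, ‖Q ξ - ξ‖ ≤ θ * ‖ξ‖) →
      ∀ x, ‖x‖ ≤ R → (R ^ 2 - ‖x‖ ^ 2) / R ^ 2 ≤ 1 / (4 * κ) →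
        rotDefect S u Q R κ (A * R * θ) x ≤ 0)
    (hx : ‖x‖ = R) (hy : ‖y‖ = R) (hxy : ⟪x, y⟫ = 0) {t : ℝ} (ht0 : t ≠ 0) (ht : |t| ≤ 1 / 8) :
    fderivWithin ℝ (u - S.ul) (annulus n R) x x
      - fderivWithin ℝ (u - S.ul) (annulus n R) (Real.cos t • x + Real.sin t • y)
        (Real.cos t • x + Real.sin t • y) ≤ 2 * A * R * (2 + 5 * C) * |t| := by
  have h1 := hB.R₀_le
  have h2 := hB.one_le_radius
  have hR0 : 0 < R := by linarith
  have ht' : 0 < |t| := abs_pos.2 ht0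
  obtain ⟨γ, hγ⟩ : ∃ γ, γ = Real.cos t • x + Real.sin t • y := ⟨_, rfl⟩
  have hγR : ‖γ‖ = R := hγ ▸ norm_circle hx hy hxy t
  obtain ⟨η, hη⟩ : ∃ η, η = A * R * (2 * |t|) := ⟨_, rfl⟩
  have hν : ‖R⁻¹ • x‖ = 1 := by
    rw [norm_smul, hx, norm_inv, Real.norm_eq_abs, abs_of_pos hR0, inv_mul_cancel₀ hR0.ne']
  have hτ : ‖R⁻¹ • y‖ = 1 := by
    rw [norm_smul, hy, norm_inv, Real.norm_eq_abs, abs_of_pos hR0, inv_mul_cancel₀ hR0.ne']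
  have hντ : ⟪R⁻¹ • x, R⁻¹ • y⟫ = 0 := by
    rw [real_inner_smul_left, real_inner_smul_right, hxy, mul_zero, mul_zero]
  have hQ : ∀ s : ℝ, planeRotation hν hτ hντ t ((1 - s) • x) = (1 - s) • γ := fun s => by
    have e : (1 - s) • x = ((1 - s) * R) • (R⁻¹ • x) := by
      rw [smul_smul, mul_assoc, mul_inv_cancel₀ hR0.ne', mul_one]
    rw [e, planeRotation_smul, hγ, smul_comm _ R⁻¹ x, smul_comm _ R⁻¹ y, ← smul_add, smul_smul,
      mul_assoc, mul_inv_cancel₀ hR0.ne', mul_one]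
  have hd := hu.contDiffOn_sub (S := S) (by linarith : 2 * S.R₀ ≤ R)
  have hder := ((hasDerivWithinAt_radial hR0 hd hγR).sub
    ((hasDerivWithinAt_radial hR0 hd hx).const_mul (1 + η))).sub
    ((hasDerivAt_collar_radial (κ := κ) hR0 hx).hasDerivWithinAt.const_mul η)
  have hneg := nonpos_of_hasDerivWithinAt (by norm_num) hder (by
    simp [collar, hx, hu.2.2.2 x (Or.inl (mem_sphere_zero_iff_norm.2 hx)),
      hu.2.2.2 γ (Or.inl (mem_sphere_zero_iff_norm.2 hγR))]) (by
    have hδ : (0 : ℝ) < 1 / (8 * κ) := by positivity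
    filter_upwards [Ioo_mem_nhdsGT hδ] with s hs
    have hs8 : s * (8 * κ) < 1 := (lt_div_iff₀ (by positivity)).1 hs.2
    have hs1 : s < 1 := by nlinarith [hs.1]
    have hn : ‖(1 - s) • x‖ = (1 - s) * R := by
      rw [norm_smul, Real.norm_eq_abs, abs_of_pos (by linarith), hx]
    have h := hrot (2 * |t|) (by positivity) (by linarith) (planeRotation hν hτ hντ t)
      (norm_planeRotation_sub_le hν hτ hντ t) ((1 - s) • x)
      (by rw [hn]; nlinarith [hs.1])
      (by
        have e : (R ^ 2 - ((1 - s) * R) ^ 2) / R ^ 2 = 2 * s - s ^ 2 := by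
          field_simp
          ring
        rw [hn, e, le_div_iff₀ (by positivity)]
        nlinarith [mul_nonneg (sq_nonneg s) (by linarith : 0 ≤ κ)])
    rw [← hη, rotDefect, hQ] at h
    simp only [Pi.sub_apply]
    linarith)
  have hη0 : 0 ≤ η := by rw [hη]; positivity
  have hlow := mul_le_mul_of_nonneg_left (hu.normal_deriv_sub_ge hB hR hx) hη0
  rw [← hγ]
  have e : 2 * A * R * (2 + 5 * C) * |t| = η * (2 + 5 * C) := by
    rw [hη]
    ring
  rw [e]
  linarith

lemma IsSol.mixed_sub_le (hB : S.Bounds C ρ) (hu : IsSol S R u) (hR : 2 * ρ ≤ R)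
    (hA : 1 ≤ A) (hκ : 1 ≤ κ)
    (hrot : ∀ θ, 0 < θ → θ ≤ 1 / 4 → ∀ Q : Euc n →ₗᵢ[ℝ] Euc n, (∀ ξ, ‖Q ξ - ξ‖ ≤ θ * ‖ξ‖) →
      ∀ x, ‖x‖ ≤ R → (R ^ 2 - ‖x‖ ^ 2) / R ^ 2 ≤ 1 / (4 * κ) →
        rotDefect S u Q R κ (A * R * θ) x ≤ 0)
    (hx : ‖x‖ = R) (hy : ‖y‖ = R) (hxy : ⟪x, y⟫ = 0) :
    |fderivWithin ℝ (fderivWithin ℝ (u - S.ul) (annulus n R)) (annulus n R) x y x|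
      ≤ 2 * A * R * (2 + 5 * C) := by
  have h1 := hB.R₀_le
  have h2 := hB.one_le_radius
  have hR0 : 0 < R := by linarith
  refine abs_deriv_le_of_sub_le (hasDerivAt_normal_circle hR0 (hu.contDiffOn_sub (by linarith))
    (fun z hz => hu.sub_eq_zero hz) hx hy hxy) ?_
  have hball : ∀ᶠ t in 𝓝[≠] (0 : ℝ), |t| < 1 / 8 :=
    nhdsWithin_le_nhds ((isOpen_lt continuous_abs continuous_const).mem_nhds (by simp))
  filter_upwards [hball, self_mem_nhdsWithin] with t ht ht0
  simpa using hu.normal_deriv_sub_circle_le hB hR hA hκ hrot hx hy hxy ht0 ht.le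

/-- The second derivatives of `u` on the outer sphere, split into those of `u - u̲` and `u̲`. -/
lemma IsSol.hess_split (hu : IsSol S R u) (hR : 2 * S.R₀ ≤ R) (hx : ‖x‖ = R) (v w : Euc n) :
    iteratedFDerivWithin ℝ 2 u (annulus n R) x ![v, w]
      = fderivWithin ℝ (fderivWithin ℝ (u - S.ul) (annulus n R)) (annulus n R) x v w
        + iteratedFDeriv ℝ 2 S.ul x ![v, w] := by
  have hR0 : 0 < R := by linarith [S.hR₀]
  have hxa := mem_annulus_of_norm_eq hR0 hx
  have hud := uniqueDiffOn_annulus (n := n) hR0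
  have h1 := iteratedFDerivWithin_add_apply (i := 2) (f := u - S.ul) (g := S.ul)
    (((hu.contDiffOn_sub hR) x hxa).of_le two_le_infty)
    (((S.contDiffOn_ul_annulus hR) x hxa).of_le two_le_infty) hud hxa
  rw [sub_add_cancel, iteratedFDerivWithin_eq_iteratedFDeriv (f := S.ul) hud
    ((S.contDiffAt_ul (S.notMem_K (by linarith [S.hR₀]))).of_le two_le_infty) hxa] at h1
  rw [h1, add_apply, iteratedFDerivWithin_two_apply' _ hud hxa]

lemma IsSol.tangential_ge (hB : S.Bounds C ρ) (hu : IsSol S R u) (hR : 2 * ρ + 12 * C ≤ R)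
    (hx : ‖x‖ = R) (hy : ‖y‖ = R) (hxy : ⟪x, y⟫ = 0) :
    R / 2 ≤ iteratedFDerivWithin ℝ 2 u (annulus n R) x ![y, y] := by
  have h1 := hB.R₀_le
  have h2 := hB.one_le_radius
  have hC := hB.one_le
  have hR0 : 0 < R := by linarith
  rw [hu.hess_split (by linarith) hx, hess_tangential hR0 (hu.contDiffOn_sub (by linarith))
    (fun z hz => hu.sub_eq_zero hz) hx hy hxy]
  have h3 := hu.normal_deriv_sub_ge hB (by linarith) hx
  have h4 := hB.hess_lower x y (by linarith)
  have e : (‖y‖ ^ 2 - ⟪x, y⟫ ^ 2 / ‖x‖ ^ 2) / ‖x‖ - C / ‖x‖ ^ 2 * ‖y‖ ^ 2 = R - C := by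
    rw [hx, hy, hxy]
    field_simp
    ring
  rw [e, hessForm] at h4
  linarith

lemma IsSol.mixed_le (hB : S.Bounds C ρ) (hu : IsSol S R u) (hR : 2 * ρ ≤ R)
    (hA : 1 ≤ A) (hκ : 1 ≤ κ)
    (hrot : ∀ θ, 0 < θ → θ ≤ 1 / 4 → ∀ Q : Euc n →ₗᵢ[ℝ] Euc n, (∀ ξ, ‖Q ξ - ξ‖ ≤ θ * ‖ξ‖) →
      ∀ x, ‖x‖ ≤ R → (R ^ 2 - ‖x‖ ^ 2) / R ^ 2 ≤ 1 / (4 * κ) →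
        rotDefect S u Q R κ (A * R * θ) x ≤ 0)
    (hx : ‖x‖ = R) (hy : ‖y‖ = R) (hxy : ⟪x, y⟫ = 0) :
    |iteratedFDerivWithin ℝ 2 u (annulus n R) x ![y, x]|
      ≤ (2 * A * (2 + 5 * C) + C) * R := by
  have h1 := hB.R₀_le
  have h2 := hB.one_le_radius
  have hR0 : 0 < R := by linarith
  have h3 := hu.mixed_sub_le hB hR hA hκ hrot hx hy hxy
  have h4 := ContinuousMultilinearMap.le_of_opNorm_le (hB.hess x (by linarith)) ![y, x]
  simp only [Fin.prod_univ_two, Matrix.cons_val_zero, Matrix.cons_val_one, hx, hy,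
    Real.norm_eq_abs] at h4
  have e : C / R * (R * R) = C * R := by field_simp
  rw [e] at h4
  rw [hu.hess_split (by linarith) hx]
  refine (abs_add_le _ _).trans ?_
  linarith

end Boundary

section NormalDerivative

variable {n : ℕ} {S : ExtSetting n} {R C ρ : ℝ} {u : Euc n → ℝ} {x : Euc n}

/-- A quadratic form with controlled tangential and mixed parts is bounded below by a radial one. -/
lemma radial_le_bilinear {G : Euc n →L[ℝ] Euc n →L[ℝ] ℝ} {M : ℝ} (hsymm : ∀ v w, G v w = G w v)
    (hR : 1 ≤ R) (hx : ‖x‖ = R) (htan : ∀ y, ‖y‖ = R → ⟪x, y⟫ = 0 → R / 2 ≤ G y y)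
    (hmix : ∀ y, ‖y‖ = R → ⟪x, y⟫ = 0 → |G y x| ≤ M * R) (ξ : Euc n) :
    1 / (4 * R) * (‖ξ‖ ^ 2 - ⟪‖x‖⁻¹ • x, ξ⟫ ^ 2)
      + (G (‖x‖⁻¹ • x) (‖x‖⁻¹ • x) - 4 * M ^ 2) * ⟪‖x‖⁻¹ • x, ξ⟫ ^ 2 ≤ G ξ ξ := by
  have hR0 : 0 < R := by linarith
  rw [hx]
  set ν : Euc n := R⁻¹ • x with hν
  have hνn : ‖ν‖ = 1 := by
    rw [hν, norm_smul, hx, norm_inv, Real.norm_eq_abs, abs_of_pos hR0, inv_mul_cancel₀ hR0.ne']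
  have hxν : x = R • ν := by rw [hν, smul_inv_smul₀ hR0.ne']
  set a := ⟪ν, ξ⟫ with ha
  obtain ⟨T, hT⟩ : ∃ T, T = ξ - a • ν := ⟨_, rfl⟩
  have hξ : ξ = a • ν + T := by rw [hT]; abel
  have hνT : ⟪ν, T⟫ = 0 := by
    rw [hT, inner_sub_right, real_inner_smul_right, real_inner_self_eq_norm_sq, hνn]
    ring
  have hTn : ‖ξ‖ ^ 2 - a ^ 2 = ‖T‖ ^ 2 := by
    rw [hT, norm_sub_sq_real, real_inner_smul_right, real_inner_comm, ← ha, norm_smul, hνn,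
      Real.norm_eq_abs, mul_one, sq_abs]
    ring
  have hG : G ξ ξ = a ^ 2 * G ν ν + 2 * a * G T ν + G T T := by
    rw [hξ]
    simp only [map_add, map_smul, add_apply, smul_apply, smul_eq_mul]
    rw [hsymm ν T]
    ring
  rw [hTn, hG]
  rcases eq_or_ne T 0 with h0 | h0
  · simp only [h0, map_zero, zero_apply, norm_zero]
    nlinarith [mul_nonneg (sq_nonneg M) (sq_nonneg a)]
  have hr : 0 < ‖T‖ := norm_pos_iff.2 h0
  obtain ⟨r, hrdef⟩ : ∃ r, r = ‖T‖ := ⟨_, rfl⟩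
  rw [← hrdef] at hr ⊢
  obtain ⟨y, hy⟩ : ∃ y, y = (R / r) • T := ⟨_, rfl⟩
  have hyn : ‖y‖ = R := by
    rw [hy, norm_smul, ← hrdef, Real.norm_eq_abs, abs_of_pos (by positivity)]
    field_simp
  have hxy : ⟪x, y⟫ = 0 := by
    rw [hxν, hy, real_inner_smul_left, real_inner_smul_right, hνT, mul_zero, mul_zero]
  have hTy : T = (r / R) • y := by
    rw [hy, smul_smul]
    field_simp
    rw [one_smul]
  have h1 := htan y hyn hxy
  have h2 := hmix y hyn hxy
  rw [hxν, map_smul, smul_eq_mul, abs_mul, abs_of_pos hR0, mul_comm] at h2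
  have h3 := le_of_mul_le_mul_right h2 hR0
  have h4 : G T ν = r / R * G y ν := by rw [hTy]; simp
  have h5 : G T T = (r / R) ^ 2 * G y y := by
    rw [hTy]
    simp only [map_smul, smul_apply, smul_eq_mul]
    ring
  have h6 : r ^ 2 / (2 * R) ≤ G T T := by
    rw [h5]
    calc r ^ 2 / (2 * R) = (r / R) ^ 2 * (R / 2) := by field_simp
      _ ≤ _ := by gcongr
  set m := G y ν
  have h7 : m ^ 2 ≤ M ^ 2 := sq_le_sq' (abs_le.1 h3).1 (abs_le.1 h3).2
  have h8 : 4 * a ^ 2 * m ^ 2 / R ≤ 4 * M ^ 2 * a ^ 2 := by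
    rw [div_le_iff₀ hR0]
    calc 4 * a ^ 2 * m ^ 2 ≤ 4 * a ^ 2 * M ^ 2 := by gcongr
      _ ≤ 4 * a ^ 2 * M ^ 2 * R := le_mul_of_one_le_right (by positivity) hR
      _ = _ := by ring
  have h9 : 0 ≤ (r / 2 + 2 * a * m) ^ 2 / R := by positivity
  have e1 : (r / 2 + 2 * a * m) ^ 2 / R
      = r ^ 2 / (4 * R) + 2 * a * (r / R * m) + 4 * a ^ 2 * m ^ 2 / R := by
    field_simp
    ring
  have e2 : r ^ 2 / (2 * R) = 2 * (r ^ 2 / (4 * R)) := by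
    field_simp
    ring
  have e3 : 1 / (4 * R) * r ^ 2 = r ^ 2 / (4 * R) := by ring
  rw [h4, e3]
  linarith

lemma norm_lt_of_mem_interior_annulus (hR : 0 < R) (hx : x ∈ interior (annulus n R)) : ‖x‖ < R := by
  have := interior_mono inter_subset_left hx
  rwa [interior_closedBall _ hR.ne', mem_ball_zero_iff] at this

lemma IsSol.tendsto_hess (hu : IsSol S R u) (hR : 2 * S.R₀ ≤ R) (hx : ‖x‖ = R) :
    Tendsto (iteratedFDeriv ℝ 2 u) (𝓝[interior (annulus n R)] x)
      (𝓝 (iteratedFDerivWithin ℝ 2 u (annulus n R) x)) := by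
  have hR0 : 0 < R := by linarith [S.hR₀]
  have hud := uniqueDiffOn_annulus (n := n) hR0
  have hxa := mem_annulus_of_norm_eq hR0 hx
  have h1 := ((hu.contDiffOn_annulus hR).continuousOn_iteratedFDerivWithin (m := 2)
    (nat_le_infty 2) hud x hxa).mono_left (nhdsWithin_mono x interior_subset)
  refine h1.congr' ?_
  filter_upwards [self_mem_nhdsWithin] with z hz
  have hza := interior_subset hz
  refine iteratedFDerivWithin_eq_iteratedFDeriv hud ?_ hza
  exact ((hu.contDiffOn_annulus hR).contDiffAt (mem_interior_iff_mem_nhds.1 hz)).of_le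
    (nat_le_infty 2)

lemma neBot_nhdsWithin_interior_annulus (hR : 0 < R) (hx : ‖x‖ = R) :
    (𝓝[interior (annulus n R)] x).NeBot :=
  mem_closure_iff_nhdsWithin_neBot.1 (mem_closure_interior_annulus hR hx)

lemma interior_annulus_subset (hR : 2 * S.R₀ ≤ R) :
    interior (annulus n R) ⊆ ball (0 : Euc n) R \ S.K := fun z hz => by
  have := (mem_annulus.1 (interior_subset hz)).2
  have := norm_lt_of_mem_interior_annulus (by linarith [S.hR₀]) hz
  exact mem_ball_diff_of_norm (by linarith) this

lemma IsSol.hess_boundary_nonneg (hu : IsSol S R u) (hR : 2 * S.R₀ ≤ R) (hx : ‖x‖ = R)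
    (ξ : Euc n) : 0 ≤ iteratedFDerivWithin ℝ 2 u (annulus n R) x ![ξ, ξ] := by
  have := neBot_nhdsWithin_interior_annulus (n := n) (by linarith [S.hR₀]) hx
  have h1 := ((ContinuousMultilinearMap.apply ℝ (fun _ : Fin 2 => Euc n) ℝ
    ![ξ, ξ]).continuous.tendsto _).comp (hu.tendsto_hess hR hx)
  refine ge_of_tendsto h1 ?_
  filter_upwards [self_mem_nhdsWithin] with z hz
  exact hessForm_nonneg (hu.2.1 z (interior_annulus_subset hR hz)) ξ

/-- A radial lower bound for the Hessian at the boundary is limited by the equation. -/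
lemma IsSol.log_le_of_radial_le (hB : S.Bounds C ρ) (hu : IsSol S R u) (hR : 4 * ρ ≤ R)
    (hx : ‖x‖ = R) {a b : ℝ} (ha : 0 < a) (hb : 0 < b)
    (h : ∀ ξ, a * (‖ξ‖ ^ 2 - ⟪‖x‖⁻¹ • x, ξ⟫ ^ 2) + b * ⟪‖x‖⁻¹ • x, ξ⟫ ^ 2
      ≤ iteratedFDerivWithin ℝ 2 u (annulus n R) x ![ξ, ξ]) :
    ((n : ℝ) - 1) * Real.log (a / 2) + Real.log (b / 2)
      ≤ Real.log C + ((n : ℝ) + 1) * Real.log 2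
      + ((n : ℝ) + 2) / 2 * Real.log (1 + (20 * C) ^ 2) - ((n : ℝ) + 1) * Real.log R := by
  have h1 := hB.R₀_le
  have h2 := hB.one_le_radius
  have hR0 : 0 < R := by linarith
  have hne := neBot_nhdsWithin_interior_annulus (n := n) hR0 hx
  obtain ⟨ε, hε⟩ : ∃ ε, ε = min a b / 2 := ⟨_, rfl⟩
  have hε0 : 0 < ε := by rw [hε]; positivity
  have hεa : ε ≤ a / 2 := by rw [hε]; gcongr; exact min_le_left _ _
  have hεb : ε ≤ b / 2 := by rw [hε]; gcongr; exact min_le_right _ _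
  obtain ⟨z, hz, hzi⟩ := ((Metric.tendsto_nhds.1 (hu.tendsto_hess (by linarith) hx) ε hε0).and
    self_mem_nhdsWithin).exists
  have hzK := interior_annulus_subset (by linarith) hzi
  have hzR := norm_lt_of_mem_interior_annulus hR0 hzi
  have hzR2 := (mem_annulus.1 (interior_subset hzi)).2
  have hνn : ‖‖x‖⁻¹ • x‖ = 1 := by
    rw [norm_smul, norm_inv, norm_norm, inv_mul_cancel₀ (by rw [hx]; exact hR0.ne')]
  set ν : Euc n := ‖x‖⁻¹ • x
  have hνν : ν.ofLp ⬝ᵥ ν.ofLp = 1 := by rw [← norm_sq_eq_dot, hνn, one_pow]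
  have hrad := radialMatrix_posDef (a := a / 2) (b := b / 2) (by positivity) (by positivity) hνν
  have hdet := (hu.2.1 z hzK).det_mono hrad (fun v => by
    have e := hessForm_eq_matrix u z (WithLp.toLp 2 v)
    simp only at e
    rw [radialMatrix_quadratic, ← e]
    have h3 := h (WithLp.toLp 2 v)
    rw [norm_sq_eq_dot, inner_eq_dot] at h3
    simp only at h3
    rw [dist_eq_norm] at hz
    have h4 := ContinuousMultilinearMap.le_of_opNorm_le hz.le ![WithLp.toLp 2 v, WithLp.toLp 2 v]
    simp only [Fin.prod_univ_two, Matrix.cons_val_zero, Matrix.cons_val_one, Real.norm_eq_abs,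
      sub_apply] at h4
    have h5 := (abs_le.1 h4).1
    rw [← sq, norm_sq_eq_dot] at h5
    simp only at h5
    have h6 := sq_dotProduct_le hνν v
    have h7 := mul_le_mul_of_nonneg_right hεa (sub_nonneg.2 h6)
    have h8 := mul_le_mul_of_nonneg_right hεb (sq_nonneg (ν.ofLp ⬝ᵥ v))
    rw [hessForm]
    linarith)
  have hlog := Real.log_le_log hrad.det_pos hdet
  rw [log_det_radialMatrix (by have := S.hn; omega) (by positivity) (by positivity) hνν] at hlog
  exact hlog.trans (hu.log_det_le hB hR hzR2.le hzR)

end NormalDerivative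

theorem double_normal_second_derivatives
    (n : ℕ) (S : ExtSetting n) :
    ∃ c R₁ : ℝ, ∀ R : ℝ, 4 * S.R₀ < R → R₁ ≤ R → ∀ u : Euc n → ℝ, IsSol S R u →
      ∀ x₀ ∈ sphere (0 : Euc n) R,
        |iteratedFDerivWithin ℝ 2 u (solDom S R) x₀ ![‖x₀‖⁻¹ • x₀, ‖x₀‖⁻¹ • x₀]| ≤ c := by
  obtain ⟨C, ρ, hB⟩ := S.exists_bounds
  obtain ⟨A, κ, R₂, hA, hκ, hrot⟩ := exists_rotation_bound hB
  have hR₀ := hB.R₀_le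
  have hρ := hB.one_le_radius
  have hC := hB.one_le
  have hn : (1 : ℝ) ≤ n := by exact_mod_cast (by have := S.hn; omega : 1 ≤ n)
  obtain ⟨L, hL⟩ : ∃ L, L = Real.log C + ((n : ℝ) + 1) * Real.log 2
      + ((n : ℝ) + 2) / 2 * Real.log (1 + (20 * C) ^ 2) := ⟨_, rfl⟩
  obtain ⟨M, hM⟩ : ∃ M, M = 2 * A * (2 + 5 * C) + C := ⟨_, rfl⟩
  refine ⟨4 * M ^ 2 + Real.exp (L + Real.log 2 + ((n : ℝ) - 1) * Real.log 8),
    |R₂| + 4 * ρ + 12 * C, fun R _ hR u hu x hx => ?_⟩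
  have hR₂ := le_abs_self R₂
  have hR₂' := abs_nonneg R₂
  have hR0 : 0 < R := by linarith
  have hxR : ‖x‖ = R := mem_sphere_zero_iff_norm.1 hx
  have hxa := mem_annulus_of_norm_eq hR0 hxR
  have hud := uniqueDiffOn_annulus (n := n) hR0
  rw [iteratedFDerivWithin_congr_set (annulus_eventuallyEq_solDom (by linarith) hR0 hxR)]
  have hpos := hu.hess_boundary_nonneg (by linarith) hxR (‖x‖⁻¹ • x)
  rw [abs_of_nonneg hpos]
  have hrot' := hrot R (by linarith) u hu
  have hsymm := ((hu.contDiffOn_annulus (by linarith)) x hxa).isSymmSndFDerivWithinAt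
    (by rw [minSmoothness_of_isRCLikeNormedField]; exact two_le_infty) hud
    (mem_closure_interior_annulus hR0 hxR) hxa
  have hlow := fun ξ => radial_le_bilinear hsymm (by linarith : 1 ≤ R) hxR (M := M)
    (fun y hy hxy => by
      have := hu.tangential_ge hB (by linarith) hxR hy hxy
      rwa [iteratedFDerivWithin_two_apply' _ hud hxa] at this)
    (fun y hy hxy => by
      have := hu.mixed_le hB (by linarith) hA hκ hrot' hxR hy hxy
      rwa [iteratedFDerivWithin_two_apply' _ hud hxa, ← hM] at this) ξ
  simp only [← iteratedFDerivWithin_two_apply' u hud hxa] at hlow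
  set N := iteratedFDerivWithin ℝ 2 u (annulus n R) x ![‖x‖⁻¹ • x, ‖x‖⁻¹ • x]
  rw [← sub_le_iff_le_add']
  rcases le_or_gt (N - 4 * M ^ 2) 0 with hb | hb
  · exact hb.trans (Real.exp_nonneg _)
  have hlog := hu.log_le_of_radial_le hB (by linarith) hxR (by positivity) hb hlow
  rw [← hL] at hlog
  have e : (1 / (4 * R) / 2 : ℝ) = (8 * R)⁻¹ := by
    field_simp
    norm_num
  rw [e, Real.log_inv, Real.log_mul (by norm_num) hR0.ne', Real.log_div hb.ne' two_ne_zero] at hlog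
  have hlogR := Real.log_nonneg (by linarith : 1 ≤ R)
  rw [← Real.log_le_iff_le_exp hb]
  linarith
end
end

section
/- Let n ≥ 2, ρ₁ > 0 and a > 2. Define φ(r) = ((a−1)/2)·ρ₁^{a−1}·r^{−a} for r > 0, ψ(r) = −∫_{ρ₁}^r (∫_ρ^∞ φ(τ) dτ) dρ, and u̲(x) = |x| − ρ₁ + ψ(|x|) for |x| ≥ ρ₁. Then u̲ is smooth on ℝⁿ∖B_{ρ₁}, vanishes on ∂B_{ρ₁}, is strictly convex, satisfies sup|u̲(x) − |x|| < ∞, satisfies |D(u̲ − |x|)| = O(1/|x|) and |D²(u̲ − |x|)| + |D³u̲| = O(1/|x|²) as |x| → ∞, and K[u̲](x) ≥ (a−1)·2^{−3n/2−1}·ρ₁^{a−1}·|x|^{1−n−a} for all |x| ≥ ρ₁. In particular, if f ∈ C^∞((ℝⁿ∖B_{ρ₁})×ℝ) satisfies 0 < f(x,z) ≤ (a−1)·2^{−3n/2−1}·ρ₁^{a−1}·|x|^{1−n−a}, then u̲ is a strictly convex subsolution: K[u̲] ≥ f(x,u̲). -/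
open Metric Set Filter MeasureTheory
open scoped Topology

noncomputable section

/-- `φ(r) = ((a−1)/2)·ρ₁^{a−1}·r^{−a}`. -/
noncomputable def phi (ρ₁ a r : ℝ) : ℝ := (a - 1) / 2 * ρ₁ ^ (a - 1) * r ^ (-a)

/-- `ψ(r) = −∫_{ρ₁}^r (∫_ρ^∞ φ(τ) dτ) dρ`. -/
noncomputable def psi (ρ₁ a r : ℝ) : ℝ := -∫ ρ in ρ₁..r, ∫ τ in Set.Ioi ρ, phi ρ₁ a τ

/-- `u̲(x) = |x| − ρ₁ + ψ(|x|)`. -/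
noncomputable def subsol {n : ℕ} (ρ₁ a : ℝ) (x : Euc n) : ℝ := ‖x‖ - ρ₁ + psi ρ₁ a ‖x‖

section Norm

variable {E : Type*} [NormedAddCommGroup E] [InnerProductSpace ℝ E]

theorem hasFDerivAt_norm_rpow_of_ne_zero {x : E} (hx : x ≠ 0) (p : ℝ) :
    HasFDerivAt (fun y : E => ‖y‖ ^ p) ((p * ‖x‖ ^ (p - 2)) • innerSL ℝ x) x := by
  have hx' : 0 < ‖x‖ := norm_pos_iff.2 hx
  have h1 := (hasStrictFDerivAt_norm_sq x).hasFDerivAt.rpow_const (p := p / 2)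
    (Or.inl (pow_ne_zero 2 hx'.ne'))
  have hfun : (fun y : E => (‖y‖ ^ 2) ^ (p / 2)) = fun y : E => ‖y‖ ^ p := by
    ext y
    rw [← Real.rpow_natCast, ← Real.rpow_mul (norm_nonneg y)]
    congr 1
    push_cast
    ring
  rw [hfun] at h1
  refine h1.congr_fderiv ?_
  have hpow : (‖x‖ ^ 2) ^ (p / 2 - 1) = ‖x‖ ^ (p - 2) := by
    rw [← Real.rpow_natCast, ← Real.rpow_mul hx'.le]
    congr 1
    push_cast
    ring
  rw [hpow, ← Nat.cast_smul_eq_nsmul ℝ, smul_smul]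
  congr 1
  push_cast
  ring

theorem contDiffAt_norm_rpow_of_ne_zero {x : E} (hx : x ≠ 0) (p : ℝ) {k : WithTop ℕ∞} :
    ContDiffAt ℝ k (fun y : E => ‖y‖ ^ p) x :=
  (contDiffAt_norm ℝ hx).rpow_const_of_ne (norm_ne_zero_iff.2 hx)

theorem exists_norm_iteratedFDeriv_norm_rpow_le [ProperSpace E] (p : ℝ) (k : ℕ) :
    ∃ C : ℝ, 0 ≤ C ∧ ∀ x : E, x ≠ 0 →
      ‖iteratedFDeriv ℝ k (fun y : E => ‖y‖ ^ p) x‖ ≤ C * ‖x‖ ^ (p - k) := by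
  set F : E → ℝ := fun y => ‖y‖ ^ p with hF
  obtain ⟨M, hM⟩ := (isCompact_sphere (0 : E) 1).exists_bound_of_continuousOn
    (f := iteratedFDeriv ℝ k F) fun y hy =>
      ((contDiffAt_norm_rpow_of_ne_zero (ne_zero_of_mem_unit_sphere ⟨y, hy⟩)
        p).continuousAt_iteratedFDeriv le_rfl).continuousWithinAt
  refine ⟨max M 0, le_max_right _ _, fun x hx => ?_⟩
  set t := ‖x‖ with ht
  have ht0 : 0 < t := norm_pos_iff.2 hx
  set g : E ≃L[ℝ] E := ContinuousLinearEquiv.smulLeft (Units.mk0 t⁻¹ (inv_ne_zero ht0.ne')) with hg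
  have hg_apply (z : E) : g z = t⁻¹ • z := rfl
  have hnorm (z : E) : ‖g z‖ = t⁻¹ * ‖z‖ := by
    rw [hg_apply, norm_smul, Real.norm_of_nonneg (inv_nonneg.2 ht0.le)]
  have hscale : F = t ^ p • (F ∘ g) := by
    ext z
    simp only [hF, Pi.smul_apply, Function.comp_apply, smul_eq_mul, hnorm]
    rw [← Real.mul_rpow ht0.le (by positivity), mul_inv_cancel_left₀ ht0.ne']
  have hgx : g x ≠ 0 := by simpa using hx
  have hcomp : iteratedFDeriv ℝ k (F ∘ g) x =
      (iteratedFDeriv ℝ k F (g x)).compContinuousLinearMap fun _ => (g : E →L[ℝ] E) := by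
    simpa [iteratedFDerivWithin_univ] using
      g.iteratedFDerivWithin_comp_right F uniqueDiffOn_univ (mem_univ (g x)) k
  have hsmooth : ContDiffAt ℝ k (F ∘ g) x :=
    (contDiffAt_norm_rpow_of_ne_zero hgx p).comp x g.contDiff.contDiffAt
  have hgnorm : ‖(g : E →L[ℝ] E)‖ ≤ t⁻¹ :=
    ContinuousLinearMap.opNorm_le_bound _ (by positivity) fun z => (hnorm z).le
  have hgx_mem : g x ∈ sphere (0 : E) 1 := by
    rw [mem_sphere_zero_iff_norm, hnorm, inv_mul_cancel₀ ht0.ne']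
  calc ‖iteratedFDeriv ℝ k F x‖
      = t ^ p * ‖iteratedFDeriv ℝ k (F ∘ g) x‖ := by
        conv_lhs => rw [hscale]
        rw [iteratedFDeriv_const_smul_apply hsmooth, norm_smul,
          Real.norm_of_nonneg (by positivity)]
    _ ≤ t ^ p * (max M 0 * t⁻¹ ^ k) := by
        gcongr
        rw [hcomp]
        refine (ContinuousMultilinearMap.norm_compContinuousLinearMap_le _ _).trans ?_
        rw [Finset.prod_const, Finset.card_univ, Fintype.card_fin]
        gcongr
        exact (hM _ hgx_mem).trans (le_max_left _ _)
    _ = max M 0 * t ^ (p - k) := by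
        rw [Real.rpow_sub ht0, Real.rpow_natCast, inv_pow]
        field_simp

end Norm

theorem det_smul_one_add_smul_vecMulVec {n : ℕ} {h : ℝ} (hh : h ≠ 0) (k : ℝ) (v : Fin n → ℝ) :
    (h • (1 : Matrix (Fin n) (Fin n) ℝ) + k • Matrix.vecMulVec v v).det =
      h ^ n * (1 + k / h * (v ⬝ᵥ v)) := by
  have hM : h • (1 : Matrix (Fin n) (Fin n) ℝ) + k • Matrix.vecMulVec v v =
      h • (1 + Matrix.replicateCol Unit ((k / h) • v) * Matrix.replicateRow Unit v) := by
    rw [← Matrix.vecMulVec_eq, Matrix.smul_vecMulVec, smul_add, smul_smul,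
      mul_div_cancel₀ _ hh]
  rw [hM, Matrix.det_smul, Matrix.det_one_add_replicateCol_mul_replicateRow, Fintype.card_fin,
    dotProduct_smul, smul_eq_mul]

theorem posDef_smul_one_add_smul_vecMulVec {n : ℕ} {h k : ℝ} {v : Fin n → ℝ} (hh : 0 < h)
    (hk : 0 < h + k * (v ⬝ᵥ v)) :
    (h • (1 : Matrix (Fin n) (Fin n) ℝ) + k • Matrix.vecMulVec v v).PosDef := by
  refine Matrix.PosDef.of_dotProduct_mulVec_pos ?_ fun w hw => ?_
  · ext i j
    simp [Matrix.vecMulVec_apply, Matrix.one_apply, mul_comm, eq_comm]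
  · have hww : 0 < w ⬝ᵥ w := by
      simpa using Matrix.dotProduct_star_self_pos_iff.2 hw
    have hcs : (v ⬝ᵥ w) ^ 2 ≤ (v ⬝ᵥ v) * (w ⬝ᵥ w) := by
      simpa [dotProduct, sq] using Finset.sum_mul_sq_le_sq_mul_sq Finset.univ v w
    have hexp : star w ⬝ᵥ ((h • (1 : Matrix (Fin n) (Fin n) ℝ) +
        k • Matrix.vecMulVec v v).mulVec w) = h * (w ⬝ᵥ w) + k * (v ⬝ᵥ w) ^ 2 := by
      simp [Matrix.add_mulVec, Matrix.smul_mulVec, Matrix.vecMulVec_mulVec, dotProduct_comm w v, sq]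
    rw [hexp]
    rcases le_or_gt 0 k with hk0 | hk0
    · positivity
    · nlinarith [mul_le_mul_of_nonpos_left hcs hk0.le, mul_pos hk hww]

theorem psi_eq {ρ₁ a r : ℝ} (hρ₁ : 0 < ρ₁) (ha : 2 < a) (hr : 0 < r) :
    psi ρ₁ a r = ρ₁ ^ (a - 1) / (2 * (a - 2)) * (r ^ (2 - a) - ρ₁ ^ (2 - a)) := by
  have hpos : ∀ ρ ∈ uIcc ρ₁ r, 0 < ρ := fun ρ hρ =>
    (lt_min hρ₁ hr).trans_le hρ.1
  have hinner : ∀ ρ ∈ uIcc ρ₁ r, ∫ τ in Ioi ρ, phi ρ₁ a τ = ρ₁ ^ (a - 1) / 2 * ρ ^ (1 - a) := by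
    intro ρ hρ
    simp only [phi]
    rw [integral_const_mul, integral_Ioi_rpow_of_lt (by linarith) (hpos ρ hρ),
      show -a + 1 = 1 - a by ring]
    have : 1 - a ≠ 0 := by linarith
    field_simp
    ring
  rw [psi, intervalIntegral.integral_congr hinner, intervalIntegral.integral_const_mul,
    integral_rpow (Or.inr ⟨by linarith, fun h => (hpos 0 h).false⟩),
    show 1 - a + 1 = 2 - a by ring]
  have h2 : 2 - a ≠ 0 := by linarith
  have h3 : a - 2 ≠ 0 := by linarith
  field_simp
  ring

section Subsol

variable {n : ℕ} {ρ₁ a : ℝ}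

theorem subsol_eq (hρ₁ : 0 < ρ₁) (ha : 2 < a) {x : Euc n} (hx : x ≠ 0) :
    subsol ρ₁ a x = ‖x‖ + (ρ₁ ^ (a - 1) / (2 * (a - 2)) * ‖x‖ ^ (2 - a) +
      (-ρ₁ - ρ₁ ^ (a - 1) / (2 * (a - 2)) * ρ₁ ^ (2 - a))) := by
  rw [subsol, psi_eq hρ₁ ha (norm_pos_iff.2 hx)]
  ring

theorem subsol_eventuallyEq (hρ₁ : 0 < ρ₁) (ha : 2 < a) {x : Euc n} (hx : x ≠ 0) :
    subsol (n := n) ρ₁ a =ᶠ[𝓝 x] fun y => ‖y‖ ^ (1 : ℝ) +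
      (ρ₁ ^ (a - 1) / (2 * (a - 2)) * ‖y‖ ^ (2 - a) +
        (-ρ₁ - ρ₁ ^ (a - 1) / (2 * (a - 2)) * ρ₁ ^ (2 - a))) := by
  filter_upwards [isOpen_ne.mem_nhds hx] with y hy
  rw [subsol_eq hρ₁ ha hy, Real.rpow_one]

theorem subsol_sub_norm_eventuallyEq (hρ₁ : 0 < ρ₁) (ha : 2 < a) {x : Euc n} (hx : x ≠ 0) :
    (fun y : Euc n => subsol ρ₁ a y - ‖y‖) =ᶠ[𝓝 x] fun y =>
      ρ₁ ^ (a - 1) / (2 * (a - 2)) * ‖y‖ ^ (2 - a) +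
        (-ρ₁ - ρ₁ ^ (a - 1) / (2 * (a - 2)) * ρ₁ ^ (2 - a)) := by
  filter_upwards [isOpen_ne.mem_nhds hx] with y hy
  rw [subsol_eq hρ₁ ha hy, add_sub_cancel_left]

theorem contDiffAt_subsol (hρ₁ : 0 < ρ₁) (ha : 2 < a) {x : Euc n} (hx : x ≠ 0)
    {k : WithTop ℕ∞} : ContDiffAt ℝ k (subsol (n := n) ρ₁ a) x :=
  ((contDiffAt_norm_rpow_of_ne_zero hx 1).add
    ((contDiffAt_const.mul (contDiffAt_norm_rpow_of_ne_zero hx (2 - a))).add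
      contDiffAt_const)).congr_of_eventuallyEq (subsol_eventuallyEq hρ₁ ha hx)

theorem hasFDerivAt_subsol (hρ₁ : 0 < ρ₁) (ha : 2 < a) {x : Euc n} (hx : x ≠ 0) :
    HasFDerivAt (subsol (n := n) ρ₁ a)
      ((‖x‖ ^ (-1 : ℝ) - ρ₁ ^ (a - 1) / 2 * ‖x‖ ^ (-a)) • innerSL ℝ x) x := by
  have h := (hasFDerivAt_norm_rpow_of_ne_zero hx 1).add
    (((hasFDerivAt_norm_rpow_of_ne_zero hx (2 - a)).const_mul
      (ρ₁ ^ (a - 1) / (2 * (a - 2)))).add_const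
        (-ρ₁ - ρ₁ ^ (a - 1) / (2 * (a - 2)) * ρ₁ ^ (2 - a)))
  refine (h.congr_of_eventuallyEq (subsol_eventuallyEq hρ₁ ha hx)).congr_fderiv ?_
  rw [smul_smul, ← add_smul]
  congr 1
  have h2 : a - 2 ≠ 0 := by linarith
  rw [show (1 : ℝ) - 2 = -1 by norm_num, show 2 - a - 2 = -a by ring]
  field_simp
  ring

theorem fderiv_fderiv_subsol_apply (hρ₁ : 0 < ρ₁) (ha : 2 < a) {x : Euc n} (hx : x ≠ 0)
    (v w : Euc n) :
    fderiv ℝ (fderiv ℝ (subsol (n := n) ρ₁ a)) x v w =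
      (‖x‖ ^ (-1 : ℝ) - ρ₁ ^ (a - 1) / 2 * ‖x‖ ^ (-a)) * inner ℝ v w +
        (-‖x‖ ^ (-3 : ℝ) + a * ρ₁ ^ (a - 1) / 2 * ‖x‖ ^ (-a - 2)) *
          (inner ℝ x v * inner ℝ x w) := by
  have heq : fderiv ℝ (subsol (n := n) ρ₁ a) =ᶠ[𝓝 x] fun y =>
      (‖y‖ ^ (-1 : ℝ) - ρ₁ ^ (a - 1) / 2 * ‖y‖ ^ (-a)) • innerSL ℝ y := by
    filter_upwards [isOpen_ne.mem_nhds hx] with y hy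
    exact (hasFDerivAt_subsol hρ₁ ha hy).fderiv
  have h := ((hasFDerivAt_norm_rpow_of_ne_zero hx (-1)).sub
    ((hasFDerivAt_norm_rpow_of_ne_zero hx (-a)).const_mul (ρ₁ ^ (a - 1) / 2))).smul
      (innerSL ℝ (E := Euc n)).hasFDerivAt
  rw [heq.fderiv_eq, (show HasFDerivAt (fun y : Euc n =>
    (‖y‖ ^ (-1 : ℝ) - ρ₁ ^ (a - 1) / 2 * ‖y‖ ^ (-a)) • innerSL ℝ y) _ x from h).fderiv]
  change (‖x‖ ^ (-1 : ℝ) - ρ₁ ^ (a - 1) / 2 * ‖x‖ ^ (-a)) * inner ℝ v w +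
    (-1 * ‖x‖ ^ (-1 - 2 : ℝ) * inner ℝ x v -
      ρ₁ ^ (a - 1) / 2 * (-a * ‖x‖ ^ (-a - 2) * inner ℝ x v)) * inner ℝ x w = _
  rw [show (-1 : ℝ) - 2 = -3 by norm_num]
  ring

theorem Hess_subsol (hρ₁ : 0 < ρ₁) (ha : 2 < a) {x : Euc n} (hx : x ≠ 0) :
    Hess (subsol ρ₁ a) x =
      (‖x‖ ^ (-1 : ℝ) - ρ₁ ^ (a - 1) / 2 * ‖x‖ ^ (-a)) • (1 : Matrix (Fin n) (Fin n) ℝ) +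
        (-‖x‖ ^ (-3 : ℝ) + a * ρ₁ ^ (a - 1) / 2 * ‖x‖ ^ (-a - 2)) •
          Matrix.vecMulVec x.ofLp x.ofLp := by
  ext i j
  rw [Hess, iteratedFDeriv_two_apply, fderiv_fderiv_subsol_apply hρ₁ ha hx]
  simp [Matrix.vecMulVec_apply, Matrix.one_apply, EuclideanSpace.inner_single_right,
    eq_comm]

theorem dotProduct_ofLp_self (x : Euc n) : x.ofLp ⬝ᵥ x.ofLp = ‖x‖ ^ 2 := by
  rw [EuclideanSpace.norm_sq_eq]
  simp [dotProduct, sq]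

theorem rpow_mul_rpow_neg_le_inv {r : ℝ} (hρ₁ : 0 < ρ₁) (ha : 2 < a) (hr : ρ₁ ≤ r) :
    ρ₁ ^ (a - 1) * r ^ (-a) ≤ r⁻¹ := by
  have hr0 : 0 < r := hρ₁.trans_le hr
  calc ρ₁ ^ (a - 1) * r ^ (-a) ≤ r ^ (a - 1) * r ^ (-a) := by
        gcongr
        linarith
    _ = r⁻¹ := by
        rw [← Real.rpow_add hr0, ← Real.rpow_neg_one]
        congr 1
        ring

theorem radial_add_mul_sq {r : ℝ} (hr : 0 < r) :
    (r ^ (-1 : ℝ) - ρ₁ ^ (a - 1) / 2 * r ^ (-a)) +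
      (-r ^ (-3 : ℝ) + a * ρ₁ ^ (a - 1) / 2 * r ^ (-a - 2)) * r ^ 2 = phi ρ₁ a r := by
  have h1 : r ^ (-3 : ℝ) * r ^ 2 = r ^ (-1 : ℝ) := by
    rw [← Real.rpow_natCast, ← Real.rpow_add hr]
    norm_num
  have h2 : r ^ (-a - 2) * r ^ 2 = r ^ (-a) := by
    rw [← Real.rpow_natCast, ← Real.rpow_add hr]
    norm_num
  rw [phi]
  linear_combination -h1 + a * ρ₁ ^ (a - 1) / 2 * h2

theorem phi_pos {r : ℝ} (hρ₁ : 0 < ρ₁) (ha : 2 < a) (hr : 0 < r) : 0 < phi ρ₁ a r := by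
  have : 0 < a - 1 := by linarith
  unfold phi
  positivity

theorem half_inv_le_radial {r : ℝ} (hρ₁ : 0 < ρ₁) (ha : 2 < a) (hr : ρ₁ ≤ r) :
    r⁻¹ / 2 ≤ r ^ (-1 : ℝ) - ρ₁ ^ (a - 1) / 2 * r ^ (-a) := by
  rw [Real.rpow_neg_one]
  linarith [rpow_mul_rpow_neg_le_inv hρ₁ ha hr]

theorem posDef_Hess_subsol (hρ₁ : 0 < ρ₁) (ha : 2 < a) {x : Euc n} (hx : ρ₁ ≤ ‖x‖) :
    (Hess (subsol ρ₁ a) x).PosDef := by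
  have hr : 0 < ‖x‖ := hρ₁.trans_le hx
  rw [Hess_subsol hρ₁ ha (norm_pos_iff.1 hr)]
  refine posDef_smul_one_add_smul_vecMulVec
    ((half_pos (inv_pos.2 hr)).trans_le (half_inv_le_radial hρ₁ ha hx)) ?_
  rw [dotProduct_ofLp_self, radial_add_mul_sq hr]
  exact phi_pos hρ₁ ha hr

theorem det_Hess_subsol (hρ₁ : 0 < ρ₁) (ha : 2 < a) {x : Euc (n + 1)} (hx : ρ₁ ≤ ‖x‖) :
    (Hess (subsol ρ₁ a) x).det =
      (‖x‖ ^ (-1 : ℝ) - ρ₁ ^ (a - 1) / 2 * ‖x‖ ^ (-a)) ^ n * phi ρ₁ a ‖x‖ := by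
  have hr : 0 < ‖x‖ := hρ₁.trans_le hx
  have hh := ((half_pos (inv_pos.2 hr)).trans_le (half_inv_le_radial hρ₁ ha hx)).ne'
  rw [Hess_subsol hρ₁ ha (norm_pos_iff.1 hr), det_smul_one_add_smul_vecMulVec hh,
    dotProduct_ofLp_self, ← radial_add_mul_sq hr, pow_succ, mul_assoc, mul_add, mul_one, ← mul_assoc _ (_ / _),
    mul_div_cancel₀ _ hh]

theorem norm_fderiv_subsol_le_one (hρ₁ : 0 < ρ₁) (ha : 2 < a) {x : Euc n} (hx : ρ₁ ≤ ‖x‖) :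
    ‖fderiv ℝ (subsol (n := n) ρ₁ a) x‖ ≤ 1 := by
  have hr : 0 < ‖x‖ := hρ₁.trans_le hx
  have hh := (half_pos (inv_pos.2 hr)).trans_le (half_inv_le_radial hρ₁ ha hx)
  rw [(hasFDerivAt_subsol hρ₁ ha (norm_pos_iff.1 hr)).fderiv, norm_smul, innerSL_apply_norm,
    Real.norm_of_nonneg hh.le]
  have h0 : 0 ≤ ρ₁ ^ (a - 1) / 2 * ‖x‖ ^ (-a) := by positivity
  calc _ ≤ ‖x‖ ^ (-1 : ℝ) * ‖x‖ := by
        gcongr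
        linarith
    _ = 1 := by rw [Real.rpow_neg_one, inv_mul_cancel₀ hr.ne']

theorem le_gaussK_subsol (hρ₁ : 0 < ρ₁) (ha : 2 < a) {x : Euc (n + 1)} (hx : ρ₁ ≤ ‖x‖) :
    (a - 1) * (2 : ℝ) ^ (-(3 * ((n + 1 : ℕ) : ℝ)) / 2 - 1) * ρ₁ ^ (a - 1) *
      ‖x‖ ^ (1 - ((n + 1 : ℕ) : ℝ) - a) ≤ gaussK (subsol ρ₁ a) x := by
  have hr : 0 < ‖x‖ := hρ₁.trans_le hx
  have hphi := phi_pos hρ₁ ha hr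
  have hK : (‖x‖⁻¹ / 2) ^ n * phi ρ₁ a ‖x‖ / 2 ^ ((((n + 1 : ℕ) : ℝ) + 2) / 2) ≤
      gaussK (subsol ρ₁ a) x := by
    have hlow := half_inv_le_radial hρ₁ ha hx
    have hgrad := norm_fderiv_subsol_le_one hρ₁ ha hx
    rw [gaussK, det_Hess_subsol hρ₁ ha hx]
    gcongr
    · exact mul_nonneg (pow_nonneg ((by positivity : 0 ≤ ‖x‖⁻¹ / 2).trans hlow) _) hphi.le
    · nlinarith [norm_nonneg (fderiv ℝ (subsol (n := n + 1) ρ₁ a) x)]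
  refine le_of_eq_of_le ?_ hK
  have h2 : (2 : ℝ) ^ (-(3 * ((n + 1 : ℕ) : ℝ)) / 2 - 1) =
      (2 ^ n)⁻¹ * 2⁻¹ / 2 ^ ((((n + 1 : ℕ) : ℝ) + 2) / 2) := by
    rw [← Real.rpow_natCast, ← Real.rpow_neg zero_le_two, ← Real.rpow_neg_one,
      ← Real.rpow_add zero_lt_two, ← Real.rpow_sub zero_lt_two]
    congr 1
    push_cast
    ring
  have hx' : ‖x‖ ^ (1 - ((n + 1 : ℕ) : ℝ) - a) = (‖x‖ ^ n)⁻¹ * ‖x‖ ^ (-a) := by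
    rw [← Real.rpow_natCast, ← Real.rpow_neg hr.le, ← Real.rpow_add hr]
    congr 1
    push_cast
    ring
  rw [h2, hx', phi, div_pow, inv_pow]
  ring

theorem exists_norm_iteratedFDeriv_subsol_sub_norm_le (hρ₁ : 0 < ρ₁) (ha : 2 < a) {k : ℕ}
    (hk : k ≠ 0) : ∃ C : ℝ, 0 ≤ C ∧ ∀ x : Euc n, x ≠ 0 →
      ‖iteratedFDeriv ℝ k (fun y : Euc n => subsol ρ₁ a y - ‖y‖) x‖ ≤ C * ‖x‖ ^ (2 - a - k) := by
  obtain ⟨C, hC0, hC⟩ := exists_norm_iteratedFDeriv_norm_rpow_le (E := Euc n) (2 - a) k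
  refine ⟨‖ρ₁ ^ (a - 1) / (2 * (a - 2))‖ * C, by positivity, fun x hx => ?_⟩
  have hs : ContDiffAt ℝ k (fun y : Euc n => ‖y‖ ^ (2 - a)) x :=
    contDiffAt_norm_rpow_of_ne_zero hx _
  rw [((subsol_sub_norm_eventuallyEq hρ₁ ha hx).iteratedFDeriv ℝ k).eq_of_nhds,
    fun_iteratedFDeriv_add_apply (contDiffAt_const.mul hs) contDiffAt_const,
    iteratedFDeriv_const_of_ne hk, Pi.zero_apply, add_zero]
  simp_rw [← smul_eq_mul (a := ρ₁ ^ (a - 1) / (2 * (a - 2)))]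
  rw [iteratedFDeriv_const_smul_apply' hs, norm_smul, mul_assoc]
  gcongr
  exact hC x hx

theorem exists_norm_iteratedFDeriv_subsol_le (hρ₁ : 0 < ρ₁) (ha : 2 < a) {k : ℕ}
    (hk : k ≠ 0) : ∃ C : ℝ, 0 ≤ C ∧ ∀ x : Euc n, 1 ≤ ‖x‖ →
      ‖iteratedFDeriv ℝ k (subsol (n := n) ρ₁ a) x‖ ≤ C * ‖x‖ ^ (1 - k : ℝ) := by
  obtain ⟨C, hC0, hC⟩ := exists_norm_iteratedFDeriv_subsol_sub_norm_le (n := n) hρ₁ ha hk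
  obtain ⟨C', hC0', hC'⟩ := exists_norm_iteratedFDeriv_norm_rpow_le (E := Euc n) 1 k
  refine ⟨C + C', by positivity, fun x hx => ?_⟩
  have hx0 : x ≠ 0 := norm_pos_iff.1 (zero_lt_one.trans_le hx)
  have hsplit : subsol (n := n) ρ₁ a = fun y => (subsol ρ₁ a y - ‖y‖) + ‖y‖ ^ (1 : ℝ) := by
    ext y
    rw [Real.rpow_one, sub_add_cancel]
  rw [hsplit, fun_iteratedFDeriv_add_apply
    ((contDiffAt_subsol hρ₁ ha hx0).sub (contDiffAt_norm ℝ hx0))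
    (contDiffAt_norm_rpow_of_ne_zero hx0 1), add_mul]
  refine (norm_add_le _ _).trans (add_le_add ((hC x hx0).trans ?_) (hC' x hx0))
  gcongr
  linarith

theorem abs_subsol_sub_norm_le (hρ₁ : 0 < ρ₁) (ha : 2 < a) {x : Euc n} (hx : ρ₁ ≤ ‖x‖) :
    |subsol ρ₁ a x - ‖x‖| ≤
      ρ₁ + ρ₁ ^ (a - 1) / (2 * (a - 2)) * ρ₁ ^ (2 - a) := by
  have hr : 0 < ‖x‖ := hρ₁.trans_le hx
  have hc : 0 < ρ₁ ^ (a - 1) / (2 * (a - 2)) :=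
    div_pos (by positivity) (by linarith)
  have h1 : ‖x‖ ^ (2 - a) ≤ ρ₁ ^ (2 - a) :=
    Real.rpow_le_rpow_of_nonpos hρ₁ hx (by linarith)
  have h2 : 0 ≤ ρ₁ ^ (a - 1) / (2 * (a - 2)) * ‖x‖ ^ (2 - a) := by positivity
  have h3 := mul_le_mul_of_nonneg_left h1 hc.le
  rw [subsol_eq hρ₁ ha (norm_pos_iff.1 hr), abs_le]
  constructor <;> linarith

end Subsol

theorem explicit_subsolution
    (n : ℕ) (hn : 2 ≤ n) (ρ₁ a : ℝ) (hρ₁ : 0 < ρ₁) (ha : 2 < a) :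
    ContDiffOn ℝ (⊤ : ℕ∞) (subsol (n := n) ρ₁ a) {x : Euc n | ρ₁ ≤ ‖x‖} ∧
    (∀ x : Euc n, ‖x‖ = ρ₁ → subsol ρ₁ a x = 0) ∧
    (∀ x : Euc n, ρ₁ ≤ ‖x‖ → (Hess (subsol ρ₁ a) x).PosDef) ∧
    (∃ C : ℝ, ∀ x : Euc n, ρ₁ ≤ ‖x‖ → |subsol ρ₁ a x - ‖x‖| ≤ C) ∧
    (∃ C R₁ : ℝ, ∀ x : Euc n, R₁ ≤ ‖x‖ →
      ‖fderiv ℝ (fun y : Euc n => subsol ρ₁ a y - ‖y‖) x‖ ≤ C / ‖x‖) ∧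
    (∃ C R₁ : ℝ, ∀ x : Euc n, R₁ ≤ ‖x‖ →
      ‖iteratedFDeriv ℝ 2 (fun y : Euc n => subsol ρ₁ a y - ‖y‖) x‖ +
        ‖iteratedFDeriv ℝ 3 (subsol (n := n) ρ₁ a) x‖ ≤ C / ‖x‖ ^ 2) ∧
    (∀ x : Euc n, ρ₁ ≤ ‖x‖ →
      (a - 1) * (2 : ℝ) ^ (-(3 * (n : ℝ)) / 2 - 1) * ρ₁ ^ (a - 1) * ‖x‖ ^ (1 - (n : ℝ) - a)
        ≤ gaussK (subsol ρ₁ a) x) ∧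
    (∀ f : Euc n → ℝ → ℝ,
      (∀ x : Euc n, ρ₁ ≤ ‖x‖ → ∀ z : ℝ, 0 < f x z ∧
        f x z ≤ (a - 1) * (2 : ℝ) ^ (-(3 * (n : ℝ)) / 2 - 1) * ρ₁ ^ (a - 1) *
          ‖x‖ ^ (1 - (n : ℝ) - a)) →
      ∀ x : Euc n, ρ₁ ≤ ‖x‖ → f x (subsol ρ₁ a x) ≤ gaussK (subsol ρ₁ a) x) := by
  have hne : ∀ {x : Euc n}, ρ₁ ≤ ‖x‖ → x ≠ 0 := fun hx => norm_pos_iff.1 (hρ₁.trans_le hx)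
  have hK : ∀ x : Euc n, ρ₁ ≤ ‖x‖ →
      (a - 1) * (2 : ℝ) ^ (-(3 * (n : ℝ)) / 2 - 1) * ρ₁ ^ (a - 1) * ‖x‖ ^ (1 - (n : ℝ) - a)
        ≤ gaussK (subsol ρ₁ a) x := by
    obtain ⟨m, rfl⟩ : ∃ m, n = m + 1 := ⟨n - 1, by omega⟩
    exact fun x hx => le_gaussK_subsol hρ₁ ha hx
  refine ⟨fun x hx => (contDiffAt_subsol hρ₁ ha (hne hx)).contDiffWithinAt, fun x hx => ?_,
    fun x hx => posDef_Hess_subsol hρ₁ ha hx,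
    ⟨_, fun x hx => abs_subsol_sub_norm_le hρ₁ ha hx⟩, ?_, ?_, hK,
    fun f hf x hx => (hf x hx _).2.trans (hK x hx)⟩
  · rw [subsol_eq hρ₁ ha (hne hx.ge), hx]
    ring
  · obtain ⟨C, hC0, hC⟩ :=
      exists_norm_iteratedFDeriv_subsol_sub_norm_le (n := n) hρ₁ ha one_ne_zero
    refine ⟨C, 1, fun x hx => ?_⟩
    have hx0 : x ≠ 0 := norm_pos_iff.1 (zero_lt_one.trans_le hx)
    rw [← norm_iteratedFDeriv_one, div_eq_mul_inv, ← Real.rpow_neg_one]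
    refine (hC x hx0).trans ?_
    gcongr
    push_cast
    linarith
  · obtain ⟨C, hC0, hC⟩ :=
      exists_norm_iteratedFDeriv_subsol_sub_norm_le (n := n) hρ₁ ha two_ne_zero
    obtain ⟨C', hC0', hC'⟩ :=
      exists_norm_iteratedFDeriv_subsol_le (n := n) hρ₁ ha three_ne_zero
    refine ⟨C + C', 1, fun x hx => ?_⟩
    have hx0 : 0 < ‖x‖ := zero_lt_one.trans_le hx
    rw [div_eq_mul_inv, ← Real.rpow_natCast, ← Real.rpow_neg hx0.le, add_mul]
    refine add_le_add ((hC x (norm_pos_iff.1 hx0)).trans ?_) ((hC' x hx).trans ?_)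
    · gcongr
      push_cast
      linarith
    · gcongr
      norm_num
end
end

section
/- Let Ω ⊂ ℝⁿ be a bounded open set, let f : Ω̄ × ℝ → (0,∞) be continuous, nondecreasing in its real variable z, and let u, v ∈ C²(Ω̄) be convex functions with u strictly convex, satisfying K[u] ≥ f(x,u) in Ω, K[v] ≤ f(x,v) in Ω, and u ≤ v on ∂Ω. Then u ≤ v in Ω. -/
open Metric Set Filter
open scoped Topology

noncomputable section

open scoped Matrix

theorem Matrix.PosSemidef.one_le_det_one_add {m : Type*} [Fintype m] [DecidableEq m]
    {Q : Matrix m m ℝ} (hQ : Q.PosSemidef) : 1 ≤ (1 + Q).det := by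
  have h : (1 + Q).det = ∏ i, (1 + hQ.1.eigenvalues i) := by
    have h1 : (1 + Q) = -(Matrix.scalar m (-1) - Q) := by
      rw [map_neg, map_one]; abel
    rw [h1, Matrix.det_neg, ← Matrix.eval_charpoly, hQ.1.charpoly_eq, Polynomial.eval_prod,
      ← Finset.card_univ, ← Finset.prod_const, ← Finset.prod_mul_distrib]
    refine Finset.prod_congr rfl fun i _ ↦ ?_
    simp [add_comm]
  rw [h]
  exact Finset.one_le_prod fun i _ ↦ by linarith [hQ.eigenvalues_nonneg i]

open scoped MatrixOrder in
theorem Matrix.PosDef.det_le_det_add_posSemidef {m : Type*} [Fintype m] [DecidableEq m]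
    {A P : Matrix m m ℝ} (hA : A.PosDef) (hP : P.PosSemidef) : A.det ≤ (A + P).det := by
  obtain ⟨C, rfl⟩ := CStarAlgebra.nonneg_iff_eq_star_mul_self.mp hP.nonneg
  have hQ : (C * A⁻¹ * star C).PosSemidef := hA.inv.posSemidef.mul_mul_conjTranspose_same C
  rw [Matrix.det_add_mul _ _ hA.det_pos.ne'.isUnit]
  exact le_mul_of_one_le_right hA.det_pos.le hQ.one_le_det_one_add

/-- A rank-one increase of a positive definite matrix in the direction of a coordinate vector. -/
theorem Matrix.PosDef.det_mul_le_det_add_single {m : Type*} [Fintype m] [DecidableEq m]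
    {A : Matrix m m ℝ} (hA : A.PosDef) (i : m) {t : ℝ} (ht : 0 ≤ t) :
    A.det * (1 + t / A i i) ≤ (A + t • Matrix.single i i 1).det := by
  have hs : t • Matrix.single i i (1 : ℝ) =
      Matrix.replicateCol Unit (Pi.single i t) * Matrix.replicateRow Unit (Pi.single i (1 : ℝ)) := by
    ext a b
    simp [Matrix.single_apply, Matrix.mul_apply, Pi.single_apply]
    grind
  have hdet : (A + t • Matrix.single i i 1).det = A.det * (1 + A⁻¹ i i * t) := by
    rw [hs, Matrix.det_add_replicateCol_mul_replicateRow hA.det_pos.ne'.isUnit]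
    simp [Matrix.mul_apply, Pi.single_apply]
  have hq : 0 < A⁻¹ i i := hA.inv.diag_pos
  have hp : 0 < A i i := hA.diag_pos
  have hinv : A * A⁻¹ = 1 := Matrix.mul_nonsing_inv _ hA.det_pos.ne'.isUnit
  have key : 1 ≤ A⁻¹ i i * A i i := by
    set y : m → ℝ := A⁻¹ *ᵥ Pi.single i 1 with hy
    have hAy : A *ᵥ y = Pi.single i 1 := by rw [hy, Matrix.mulVec_mulVec, hinv, Matrix.one_mulVec]
    have hyA : y ᵥ* A = Pi.single i 1 := by
      have : Aᵀ = A := by simpa using hA.1.eq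
      rw [← Matrix.mulVec_transpose, this, hAy]
    have hyi : y i = A⁻¹ i i := by simp [hy]
    have h := hA.posSemidef.dotProduct_mulVec_nonneg (A⁻¹ i i • Pi.single i 1 - y)
    have : star (A⁻¹ i i • Pi.single i 1 - y) ⬝ᵥ A *ᵥ (A⁻¹ i i • Pi.single i 1 - y) =
        A⁻¹ i i * (A⁻¹ i i * A i i - 1) := by
      rw [star_trivial, Matrix.dotProduct_mulVec, Matrix.sub_vecMul, Matrix.smul_vecMul, hyA,
        sub_dotProduct, smul_dotProduct, ← Matrix.dotProduct_mulVec, Matrix.mulVec_sub, hAy,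
        Matrix.mulVec_smul]
      simp [hyi]
    rw [this] at h
    nlinarith [nonneg_of_mul_nonneg_right h hq]
  rw [hdet]
  have : t / A i i ≤ A⁻¹ i i * t := by
    rw [div_le_iff₀ hp]; nlinarith
  have := hA.det_pos
  gcongr

theorem IsLocalMax.iteratedFDeriv_two_nonpos {E : Type*} [NormedAddCommGroup E] [NormedSpace ℝ E]
    {g : E → ℝ} {x : E} (h : IsLocalMax g x) (hg : ContDiffAt ℝ 2 g x) (y : E) :
    iteratedFDeriv ℝ 2 g x ![y, y] ≤ 0 := by
  rw [iteratedFDeriv_two_apply]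
  simp only [Matrix.cons_val_zero, Matrix.cons_val_one]
  set ℓ : ℝ → E := fun s ↦ x + s • y with hℓ
  have hℓ0 : ℓ 0 = x := by simp [hℓ]
  have hℓd : ∀ s, HasDerivAt ℓ y s := fun s ↦ by
    simpa [hℓ] using ((hasDerivAt_id s).smul_const y).const_add x
  have hℓt : Tendsto ℓ (𝓝 0) (𝓝 x) := by
    simpa [hℓ0] using (hℓd 0).continuousAt.tendsto
  have hd : ∀ᶠ z in 𝓝 x, DifferentiableAt ℝ g z :=
    (hg.eventually (by simp)).mono fun z hz ↦ hz.differentiableAt (by simp)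
  have hL : deriv (g ∘ ℓ) =ᶠ[𝓝 0] fun s ↦ fderiv ℝ g (ℓ s) y :=
    (hℓt.eventually hd).mono fun s hs ↦ (hs.hasFDerivAt.comp_hasDerivAt s (hℓd s)).deriv
  have hdd : DifferentiableAt ℝ (fderiv ℝ g) (ℓ 0) := by
    rw [hℓ0]
    exact (hg.fderiv_right (m := 1) (by norm_num)).differentiableAt (by simp)
  have hL2 : deriv (deriv (g ∘ ℓ)) 0 = fderiv ℝ (fderiv ℝ g) x y y := by
    rw [hL.deriv_eq, ← hℓ0]
    have := (hdd.hasFDerivAt.comp_hasDerivAt (0 : ℝ) (hℓd 0)).clm_apply (hasDerivAt_const 0 y)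
    simpa using this.deriv
  have hmax : IsLocalMax (g ∘ ℓ) 0 := by
    rw [← hℓ0] at h
    exact h.comp_continuous (hℓd 0).continuousAt
  by_contra! hpos
  have hcont : ContinuousAt (g ∘ ℓ) 0 := by
    refine ContinuousAt.comp ?_ (hℓd 0).continuousAt
    rw [hℓ0]
    exact hg.continuousAt
  have hmin : IsLocalMin (g ∘ ℓ) 0 :=
    isLocalMin_of_deriv_deriv_pos (by rwa [hL2]) hmax.deriv_eq_zero hcont
  have hconst : g ∘ ℓ =ᶠ[𝓝 0] fun _ ↦ (g ∘ ℓ) 0 := by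
    filter_upwards [hmax, hmin] with s h1 h2 using le_antisymm h1 h2
  have : deriv (deriv (g ∘ ℓ)) 0 = 0 := by
    rw [hconst.deriv.deriv_eq]
    simp
  linarith [hL2]

theorem dotProduct_Hess_mulVec {n : ℕ} (g : Euc n → ℝ) (x : Euc n) (y : Fin n → ℝ) :
    y ⬝ᵥ Hess g x *ᵥ y = iteratedFDeriv ℝ 2 g x ![WithLp.toLp 2 y, WithLp.toLp 2 y] := by
  have hy : WithLp.toLp 2 y = ∑ i, y i • EuclideanSpace.single i (1 : ℝ) := by
    ext j
    simp [Pi.single_apply]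
  rw [iteratedFDeriv_two_apply]
  simp only [Matrix.cons_val_zero, Matrix.cons_val_one]
  rw [hy]
  simp only [map_sum, map_smul, sum_apply, smul_apply,
    dotProduct, Matrix.mulVec, Hess, iteratedFDeriv_two_apply, Matrix.cons_val_zero,
    Matrix.cons_val_one, smul_eq_mul, Finset.mul_sum]
  rw [Finset.sum_comm]
  refine Finset.sum_congr rfl fun i _ ↦ Finset.sum_congr rfl fun j _ ↦ ?_
  ring

theorem Hess_sub_add_smul {n : ℕ} {u v φ : Euc n → ℝ} {x : Euc n} (hu : ContDiffAt ℝ 2 u x)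
    (hv : ContDiffAt ℝ 2 v x) (hφ : ContDiffAt ℝ 2 φ x) (ε : ℝ) :
    Hess (u - v + ε • φ) x = Hess u x - Hess v x + ε • Hess φ x := by
  have h : iteratedFDeriv ℝ 2 (u - v + ε • φ) x =
      iteratedFDeriv ℝ 2 u x - iteratedFDeriv ℝ 2 v x + ε • iteratedFDeriv ℝ 2 φ x := by
    rw [← iteratedFDeriv_const_smul_apply (i := 2) hφ, ← iteratedFDeriv_sub_apply (i := 2) hu hv]
    exact iteratedFDeriv_add_apply (i := 2) (hu.sub hv) (hφ.const_smul ε)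
  ext i j
  exact congrArg (fun L ↦ L ![EuclideanSpace.single i 1, EuclideanSpace.single j 1]) h

theorem hasFDerivAt_exp_mul_coord {n : ℕ} (c : ℝ) (i : Fin n) (x : Euc n) :
    HasFDerivAt (fun x : Euc n ↦ Real.exp (c * x i))
      ((c * Real.exp (c * x i)) • EuclideanSpace.proj (𝕜 := ℝ) i) x := by
  have h := (((EuclideanSpace.proj i : Euc n →L[ℝ] ℝ).hasFDerivAt
    (x := x)).const_mul c).exp
  refine h.congr_fderiv ?_
  rw [smul_smul, mul_comm]
  rfl

theorem Hess_exp_mul_coord {n : ℕ} (c : ℝ) (i : Fin n) (x : Euc n) :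
    Hess (fun x : Euc n ↦ Real.exp (c * x i)) x =
      (c ^ 2 * Real.exp (c * x i)) • Matrix.single i i 1 := by
  have h1 : fderiv ℝ (fun x : Euc n ↦ Real.exp (c * x i)) =
      fun x ↦ (c * Real.exp (c * x i)) • EuclideanSpace.proj (𝕜 := ℝ) i :=
    funext fun x ↦ (hasFDerivAt_exp_mul_coord c i x).fderiv
  have h2 := ((hasFDerivAt_exp_mul_coord c i x).const_mul c).smul_const
    (EuclideanSpace.proj i : Euc n →L[ℝ] ℝ)
  ext a b
  rw [Hess, iteratedFDeriv_two_apply, h1, h2.fderiv]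
  simp only [Matrix.cons_val_zero, Matrix.cons_val_one, ContinuousLinearMap.smulRight_apply,
    smul_apply, PiLp.proj_apply, PiLp.single_apply, Matrix.smul_apply,
    Matrix.single_apply, smul_eq_mul]
  grind

theorem one_add_pow_le_one_add_two_pow_mul {h : ℝ} (h0 : 0 ≤ h) (h1 : h ≤ 1) (m : ℕ) :
    (1 + h) ^ m ≤ 1 + 2 ^ m * h := by
  suffices H : (1 + h) ^ m ≤ 1 + (2 ^ m - 1) * h by nlinarith
  induction m with
  | zero => simp
  | succ m ih =>
    have h2 : (1 : ℝ) ≤ 2 ^ m := one_le_pow₀ (by norm_num)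
    calc (1 + h) ^ (m + 1) = (1 + h) ^ m * (1 + h) := pow_succ _ _
      _ ≤ (1 + (2 ^ m - 1) * h) * (1 + h) := by gcongr
      _ ≤ 1 + (2 ^ (m + 1) - 1) * h := by
        rw [pow_succ]
        nlinarith [mul_nonneg (mul_nonneg (sub_nonneg.2 h2) h0) (sub_nonneg.2 h1)]

theorem one_add_sq_rpow_le {a b h : ℝ} (ha : 0 ≤ a) (hb : 0 ≤ b) (h0 : 0 ≤ h) (h1 : h ≤ 1)
    (hab : b ≤ a + h) (m : ℕ) :
    (1 + b ^ 2) ^ ((m : ℝ) / 2) ≤ (1 + a ^ 2) ^ ((m : ℝ) / 2) * (1 + 2 ^ m * h) := by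
  have hsq : 1 + b ^ 2 ≤ (1 + a ^ 2) * (1 + h) ^ 2 := by
    nlinarith [mul_nonneg h0 (sq_nonneg (a - 1)), mul_nonneg ha h0, sq_nonneg (a * h),
      pow_le_pow_left₀ hb hab 2, mul_nonneg h0 (sq_nonneg a)]
  calc (1 + b ^ 2) ^ ((m : ℝ) / 2) ≤ ((1 + a ^ 2) * (1 + h) ^ 2) ^ ((m : ℝ) / 2) := by gcongr
    _ = (1 + a ^ 2) ^ ((m : ℝ) / 2) * (1 + h) ^ m := by
      rw [Real.mul_rpow (by positivity) (by positivity), ← Real.rpow_natCast (1 + h) 2,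
        ← Real.rpow_mul (by positivity), ← Real.rpow_natCast (1 + h) m]
      congr 2
      push_cast
      ring
    _ ≤ _ := by
      gcongr
      exact one_add_pow_le_one_add_two_pow_mul h0 h1 m

theorem ContDiffAt.continuousAt_Hess_apply {n : ℕ} {u : Euc n → ℝ} {x : Euc n}
    (hu : ContDiffAt ℝ 2 u x) (i j : Fin n) : ContinuousAt (fun x ↦ Hess u x i j) x := by
  have h : ContinuousAt (iteratedFDeriv ℝ 2 u) x :=
    (hu.iteratedFDeriv_right (m := 0) (i := 2) (by norm_num)).continuousAt
  exact (ContinuousMultilinearMap.apply ℝ (fun _ : Fin 2 ↦ Euc n) ℝ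
    ![EuclideanSpace.single i 1, EuclideanSpace.single j 1]).continuous.continuousAt.comp h

/-- At an interior maximum of `u - v + ε e^{c xᵢ}` at which `K[v] ≤ K[u]`, the rate `c` is
controlled by `u_{ii}`. -/
theorem le_two_pow_mul_Hess_of_isLocalMax {n : ℕ} {u v : Euc n → ℝ} {x : Euc n} {i : Fin n}
    {c ε : ℝ} (hc : 0 < c) (hε : 0 < ε) (hsmall : ε * (c * Real.exp (c * x i)) ≤ 1)
    (hu : ContDiffAt ℝ 2 u x) (hv : ContDiffAt ℝ 2 v x)
    (hA : (Hess u x).PosDef) (hB : (Hess v x).IsHermitian) (hK : gaussK v x ≤ gaussK u x)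
    (hmax : IsLocalMax (u - v + ε • fun x : Euc n ↦ Real.exp (c * x i)) x) :
    c ≤ 2 ^ (n + 2) * Hess u x i i := by
  have hφ : ContDiffAt ℝ 2 (fun x : Euc n ↦ Real.exp (c * x i)) x := by fun_prop
  set e := Real.exp (c * x i) with he
  set A := Hess u x
  set B := Hess v x
  set h := ε * (c * e) with hh
  have he0 : 0 < e := Real.exp_pos _
  have hh0 : 0 < h := by positivity
  have ht0 : 0 ≤ c * h := by positivity
  have hHess : Hess (u - v + ε • fun x : Euc n ↦ Real.exp (c * x i)) x =
      A - B + (c * h) • Matrix.single i i 1 := by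
    rw [Hess_sub_add_smul hu hv hφ, Hess_exp_mul_coord, smul_smul]
    congr 2
    rw [hh, he]
    ring
  have hP : (B - (A + (c * h) • Matrix.single i i 1)).PosSemidef := by
    refine .of_dotProduct_mulVec_nonneg (hB.sub (hA.1.add ?_)) fun y ↦ ?_
    · ext a b
      simp [Matrix.single_apply, and_comm]
    · have hneg := hmax.iteratedFDeriv_two_nonpos ((hu.sub hv).add (hφ.const_smul ε))
        (WithLp.toLp 2 y)
      rw [← dotProduct_Hess_mulVec, hHess] at hneg
      have : B - (A + (c * h) • Matrix.single i i 1) =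
        -(A - B + (c * h) • Matrix.single i i 1) := by abel
      rw [this, Matrix.neg_mulVec, dotProduct_neg, star_trivial]
      linarith
  have hS : ((c * h) • Matrix.single i i (1 : ℝ)).PosSemidef := by
    have : (c * h) • Matrix.single i i (1 : ℝ) = Matrix.diagonal (Pi.single i (c * h)) := by
      rw [Matrix.diagonal_single, Matrix.smul_single]
      simp
    rw [this]
    exact .diagonal (Pi.single_nonneg.2 ht0)
  have hdet : A.det * (1 + c * h / A i i) ≤ B.det := by
    refine (hA.det_mul_le_det_add_single i ht0).trans ?_
    simpa using (hA.add_posSemidef hS).det_le_det_add_posSemidef hP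
  have hgrad : fderiv ℝ v x =
      fderiv ℝ u x + h • (EuclideanSpace.proj i : Euc n →L[ℝ] ℝ) := by
    have h0 := hmax.fderiv_eq_zero
    have hsum := ((hu.differentiableAt (by simp)).hasFDerivAt.sub
      (hv.differentiableAt (by simp)).hasFDerivAt).add
        ((hasFDerivAt_exp_mul_coord c i x).const_smul ε)
    rw [hsum.fderiv, smul_smul] at h0
    rw [← sub_eq_zero, ← neg_eq_zero, ← h0]
    abel
  have hproj : ‖(EuclideanSpace.proj i : Euc n →L[ℝ] ℝ)‖ ≤ 1 :=
    ContinuousLinearMap.opNorm_le_bound _ zero_le_one fun y ↦ by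
      simpa using PiLp.norm_apply_le y i
  have hnorm : ‖fderiv ℝ v x‖ ≤ ‖fderiv ℝ u x‖ + h := by
    rw [hgrad]
    refine (norm_add_le _ _).trans (add_le_add le_rfl ?_)
    rw [norm_smul, Real.norm_of_nonneg hh0.le]
    exact mul_le_of_le_one_right hh0.le hproj
  have hpow := one_add_sq_rpow_le (norm_nonneg _) (norm_nonneg _) hh0.le hsmall hnorm (n + 2)
  push_cast at hpow
  unfold gaussK at hK
  have hX : 0 < (1 + ‖fderiv ℝ u x‖ ^ 2) ^ (((n : ℝ) + 2) / 2) := by positivity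
  have hY : 0 < (1 + ‖fderiv ℝ v x‖ ^ 2) ^ (((n : ℝ) + 2) / 2) := by positivity
  have hdetA : 0 < A.det := hA.det_pos
  have hAii : 0 < A i i := hA.diag_pos
  have hBA : B.det ≤ A.det * (1 + 2 ^ (n + 2) * h) := by
    calc B.det ≤ A.det / (1 + ‖fderiv ℝ u x‖ ^ 2) ^ (((n : ℝ) + 2) / 2) *
          (1 + ‖fderiv ℝ v x‖ ^ 2) ^ (((n : ℝ) + 2) / 2) := (div_le_iff₀ hY).1 hK
      _ ≤ A.det / (1 + ‖fderiv ℝ u x‖ ^ 2) ^ (((n : ℝ) + 2) / 2) *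
          ((1 + ‖fderiv ℝ u x‖ ^ 2) ^ (((n : ℝ) + 2) / 2) * (1 + 2 ^ (n + 2) * h)) := by gcongr
      _ = A.det * (1 + 2 ^ (n + 2) * h) := by field_simp
  have hfin := le_of_mul_le_mul_left (hdet.trans hBA) hdetA
  have h3 : c * h / A i i ≤ 2 ^ (n + 2) * h := by linarith
  rw [div_le_iff₀ hAii] at h3
  exact le_of_mul_le_mul_right (by linarith) hh0

theorem comparison_principle
    (n : ℕ) (hn : 2 ≤ n) (Ω : Set (Euc n)) (hΩopen : IsOpen Ω)
    (hΩbdd : Bornology.IsBounded Ω)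
    (f : Euc n → ℝ → ℝ)
    (hfcont : ContinuousOn (fun p : Euc n × ℝ => f p.1 p.2) (closure Ω ×ˢ univ))
    (hfpos : ∀ x ∈ closure Ω, ∀ z : ℝ, 0 < f x z)
    (hfz : ∀ x ∈ closure Ω, Monotone (f x))
    (u v : Euc n → ℝ)
    (husm : ContDiffOn ℝ 2 u (closure Ω)) (hvsm : ContDiffOn ℝ 2 v (closure Ω))
    (huconv : ∀ x ∈ Ω, (Hess u x).PosDef)
    (hvconv : ∀ x ∈ Ω, (Hess v x).PosSemidef)
    (husub : ∀ x ∈ Ω, f x (u x) ≤ gaussK u x)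
    (hvsup : ∀ x ∈ Ω, gaussK v x ≤ f x (v x))
    (hbc : ∀ x ∈ frontier Ω, u x ≤ v x) :
    ∀ x ∈ Ω, u x ≤ v x := by
  intro x₁ hx₁
  by_contra! hlt
  let i : Fin n := ⟨0, by omega⟩
  have hcl : closure Ω = Ω ∪ frontier Ω := closure_eq_self_union_frontier Ω
  have hcpt : IsCompact (closure Ω) := hΩbdd.isCompact_closure
  have hu : ∀ x ∈ Ω, ContDiffAt ℝ 2 u x := fun x hx ↦
    husm.contDiffAt (mem_of_superset (hΩopen.mem_nhds hx) subset_closure)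
  have hv : ∀ x ∈ Ω, ContDiffAt ℝ 2 v x := fun x hx ↦
    hvsm.contDiffAt (mem_of_superset (hΩopen.mem_nhds hx) subset_closure)
  have hwc : ContinuousOn (u - v) (closure Ω) := husm.continuousOn.sub hvsm.continuousOn
  set δ := u x₁ - v x₁ with hδ
  have hδ0 : 0 < δ := sub_pos.2 hlt
  set D : Set (Euc n) := closure Ω ∩ (u - v) ⁻¹' Ici (δ / 2) with hD
  have hDcpt : IsCompact D :=
    hcpt.of_isClosed_subset (hwc.preimage_isClosed_of_isClosed isClosed_closure isClosed_Ici)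
      inter_subset_left
  have hDΩ : D ⊆ Ω := by
    rintro x ⟨hx, hxD⟩
    rcases hcl ▸ hx with hx | hx
    · exact hx
    · have h1 := hbc x hx
      have h2 : δ / 2 ≤ u x - v x := hxD
      linarith
  obtain ⟨M, hM⟩ := hDcpt.bddAbove_image (f := fun x ↦ Hess u x i i) fun x hx ↦
    ((hu x (hDΩ hx)).continuousAt_Hess_apply i i).continuousWithinAt
  set c : ℝ := 2 ^ (n + 2) * |M| + 1 with hc
  have hc0 : 0 < c := by positivity
  have hφ : Continuous fun x : Euc n ↦ Real.exp (c * x i) := by fun_prop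
  obtain ⟨Φ, hΦ⟩ := hcpt.bddAbove_image (f := fun x : Euc n ↦ Real.exp (c * x i)) hφ.continuousOn
  replace hΦ : ∀ x ∈ closure Ω, Real.exp (c * x i) ≤ Φ := fun x hx ↦ hΦ (mem_image_of_mem _ hx)
  have hΦ0 : 0 < Φ := (Real.exp_pos _).trans_le (hΦ x₁ (subset_closure hx₁))
  obtain ⟨ε, hε0, hε1, hε2⟩ : ∃ ε > 0, ε * Φ ≤ δ / 2 ∧ ε * (c * Φ) ≤ 1 :=
    ⟨min (δ / 2 / Φ) (1 / (c * Φ)), by positivity,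
      (le_div_iff₀ hΦ0).1 (min_le_left _ _), (le_div_iff₀ (by positivity)).1 (min_le_right _ _)⟩
  obtain ⟨x, hx, hmax⟩ := hcpt.exists_isMaxOn ⟨x₁, subset_closure hx₁⟩
    (hwc.add (hφ.continuousOn.const_smul ε))
  have hxw : δ / 2 ≤ u x - v x := by
    have h1 : u x₁ - v x₁ + ε * Real.exp (c * x₁ i) ≤ u x - v x + ε * Real.exp (c * x i) :=
      hmax (subset_closure hx₁)
    have h2 := mul_le_mul_of_nonneg_left (hΦ x hx) hε0.le
    have h3 : 0 < ε * Real.exp (c * x₁ i) := by positivity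
    linarith
  have hxD : x ∈ D := ⟨hx, hxw⟩
  have hxΩ := hDΩ hxD
  have hK : gaussK v x ≤ gaussK u x :=
    (hvsup x hxΩ).trans ((hfz x hx (by linarith)).trans (husub x hxΩ))
  have hbound := le_two_pow_mul_Hess_of_isLocalMax (i := i) hc0 hε0
    (le_trans (by gcongr; exact hΦ x hx) hε2) (hu x hxΩ) (hv x hxΩ) (huconv x hxΩ)
    (hvconv x hxΩ).1 hK
    (hmax.isLocalMax (mem_of_superset (hΩopen.mem_nhds hxΩ) subset_closure))
  have hxM : Hess u x i i ≤ |M| := (hM (mem_image_of_mem _ hxD)).trans (le_abs_self M)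
  have := mul_le_mul_of_nonneg_left hxM (by positivity : (0 : ℝ) ≤ 2 ^ (n + 2))
  linarith
end
end
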